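/- arXiv:2004.14825 — 4 statements merged into one kernel-verified Lean document; each statement's English description precedes it below -/
import Mathlib

section
/- Let E ⊂ ℝⁿ be a Borel set of finite measure, s ∈ (0,1), and let K ⊂ ℝⁿ be an origin-symmetric convex body symmetric with respect to the hyperplane {x_n = 0}. If E^# is the Steiner symmetrization of E with respect to x_n, then P_s(E,K) ≥ P_s(E^#,K). -/
open MeasureTheory Set Bornology ENNReal Pointwise

noncomputable section

/-- `ℝ^{n-1}` with the Euclidean norm. -/
abbrev Rm (m : ℕ) := EuclideanSpace ℝ (Fin m)

/-- `ℝⁿ` decomposed as `ℝ^{n-1} × ℝ` (so the total dimension is `n = m + 1`). -/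
abbrev Vm (m : ℕ) := Rm m × ℝ

/-- The Euclidean norm on `ℝⁿ = ℝ^{n-1} × ℝ`. -/
noncomputable def prodEnorm {m : ℕ} (p : Vm m) : ℝ := Real.sqrt (‖p.1‖ ^ 2 + p.2 ^ 2)

/-- A convex body: a compact convex set with nonempty interior. -/
def IsConvexBody {m : ℕ} (K : Set (Vm m)) : Prop :=
  Convex ℝ K ∧ IsCompact K ∧ (interior K).Nonempty

/-- Origin-symmetric set. -/
def IsOriginSymmetric {m : ℕ} (K : Set (Vm m)) : Prop := ∀ x ∈ K, -x ∈ K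

/-- Strict convexity: every proper convex combination of two distinct points of `K`
lies in the interior of `K`. -/
def IsStrictlyConvexSet {m : ℕ} (K : Set (Vm m)) : Prop :=
  ∀ x ∈ K, ∀ y ∈ K, x ≠ y → ∀ l : ℝ, 0 < l → l < 1 → (1 - l) • x + l • y ∈ interior K

/-- Symmetry with respect to the hyperplane `{xₙ = 0}`. -/
def IsSymmLast {m : ℕ} (K : Set (Vm m)) : Prop := ∀ p ∈ K, (p.1, -p.2) ∈ K

/-- One-dimensional Schwarz symmetrization `B*`: the origin-centered open interval with
the same measure as `B`. -/
noncomputable def schwarz1 (B : Set ℝ) : Set ℝ :=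
  Set.Ioo (-((volume B).toReal / 2)) ((volume B).toReal / 2)

/-- Steiner symmetrization of a set with respect to the hyperplane `{xₙ = 0}`,
defined section-wise by `[A^#]_{x′} = (A_{x′})*`. -/
def steinerSet {m : ℕ} (A : Set (Vm m)) : Set (Vm m) :=
  {p | p.2 ∈ schwarz1 {t : ℝ | (p.1, t) ∈ A}}

/-- Steiner symmetrization of a function with respect to the hyperplane `{xₙ = 0}`:
`f^#(x′,xₙ) = sup {τ > 0 : xₙ ∈ {t : f(x′,t) > τ}*}`. -/
noncomputable def steinerFn {m : ℕ} (f : Vm m → ℝ) (p : Vm m) : ℝ :=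
  sSup {τ : ℝ | 0 < τ ∧ p.2 ∈ schwarz1 {t : ℝ | τ < f (p.1, t)}}

/-- The anisotropic fractional `s`-perimeter `P_s(E,K)` on `ℝⁿ = ℝ^{n-1} × ℝ`
(total dimension `n = m + 1`); the norm with unit ball `K` is the gauge of `K`. -/
noncomputable def fracPerP {m : ℕ} (s : ℝ) (E K : Set (Vm m)) : ℝ≥0∞ :=
  ∫⁻ x in E, ∫⁻ y in Eᶜ, (ENNReal.ofReal (gauge K (x - y) ^ ((m : ℝ) + 1 + s)))⁻¹

theorem measurableSet_snd_mem_and_mem_Ioo {B : Set ℝ} (hB : MeasurableSet B) (c d : ℝ) :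
    MeasurableSet {q : ℝ × ℝ | q.2 ∈ B ∧ q.1 + c < q.2 ∧ q.2 < q.1 + d} := by
  have h1 : MeasurableSet {q : ℝ × ℝ | q.1 + c < q.2} :=
    measurableSet_lt (by fun_prop) (by fun_prop)
  have h2 : MeasurableSet {q : ℝ × ℝ | q.2 < q.1 + d} :=
    measurableSet_lt (by fun_prop) (by fun_prop)
  exact (measurable_snd hB).inter (h1.inter h2)

theorem lintegral_volume_inter_Ioo {B : Set ℝ} (hB : MeasurableSet B) (c d : ℝ) :
    ∫⁻ x, volume (B ∩ Ioo (x + c) (x + d)) = volume B * ENNReal.ofReal (d - c) := by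
  have hS := measurableSet_snd_mem_and_mem_Ioo hB c d
  have h1 := Measure.prod_apply (μ := (volume : Measure ℝ)) (ν := (volume : Measure ℝ)) hS
  have h2 := Measure.prod_apply_symm (μ := (volume : Measure ℝ)) (ν := (volume : Measure ℝ)) hS
  calc ∫⁻ x, volume (B ∩ Ioo (x + c) (x + d))
      = ∫⁻ y, volume ((fun x : ℝ => (x, y)) ⁻¹'
          {q : ℝ × ℝ | q.2 ∈ B ∧ q.1 + c < q.2 ∧ q.2 < q.1 + d}) := h1.symm.trans h2
    _ = ∫⁻ y, B.indicator (fun _ => ENNReal.ofReal (d - c)) y := by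
        refine lintegral_congr fun y => ?_
        by_cases hy : y ∈ B
        · rw [indicator_of_mem hy,
            show d - c = (y - c) - (y - d) by ring, ← Real.volume_Ioo]
          congr 1
          ext x
          simp only [mem_preimage, mem_ofPred_eq, mem_Ioo, hy, true_and]
          constructor <;> rintro ⟨h, h'⟩ <;> constructor <;> linarith
        · simp [hy]
    _ = volume B * ENNReal.ofReal (d - c) := by
        rw [lintegral_indicator hB, setLIntegral_const, mul_comm]

theorem exists_volume_inter_Iic_eq {B : Set ℝ} {b t : ℝ}
    (hb : volume B = ENNReal.ofReal b) (ht : 0 < t) (htb : t < b) :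
    ∃ p : ℝ, volume (B ∩ Iic p) = ENNReal.ofReal t := by
  have hfin : volume B ≠ ⊤ := by rw [hb]; exact ENNReal.ofReal_ne_top
  set μ : Measure ℝ := volume.restrict B with hμ
  have : IsFiniteMeasure μ := ⟨by simpa [hμ] using hfin.lt_top⟩
  have hμI : ∀ p, μ (Iic p) = volume (B ∩ Iic p) := fun p => by
    rw [hμ, Measure.restrict_apply measurableSet_Iic, inter_comm]
  have hcont : Continuous fun p => μ.real (Iic p) := by
    have hlip : LipschitzWith 1 fun p => μ.real (Iic p) := by
      refine LipschitzWith.of_le_add_mul 1 fun x y => ?_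
      have h1 : μ (Iic x) ≤ μ (Iic y) + ENNReal.ofReal |x - y| := by
        calc μ (Iic x) ≤ μ (Iic y ∪ Ioc y x) := measure_mono fun z hz => by
              rcases le_or_gt z y with h | h
              · exact Or.inl h
              · exact Or.inr ⟨h, hz⟩
          _ ≤ μ (Iic y) + μ (Ioc y x) := measure_union_le _ _
          _ ≤ μ (Iic y) + volume (Ioc y x) := by gcongr; exact Measure.restrict_le_self
          _ ≤ _ := by rw [Real.volume_Ioc]; gcongr; exact le_abs_self _
      have h2 := ENNReal.toReal_mono (by finiteness) h1
      rw [ENNReal.toReal_add (by finiteness) (by finiteness),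
        ENNReal.toReal_ofReal (abs_nonneg _)] at h2
      simpa [Measure.real, Real.dist_eq] using h2
    exact hlip.continuous
  have hbot : Filter.Tendsto (fun p => μ.real (Iic p)) Filter.atBot (nhds 0) := by
    rw [← ENNReal.toReal_zero]
    refine (ENNReal.tendsto_toReal ENNReal.zero_ne_top).comp ?_
    have h := tendsto_measure_iInter_atBot (μ := μ) (s := fun p : ℝ => Iic p)
      (fun _ => measurableSet_Iic.nullMeasurableSet) (fun _ _ h => Iic_subset_Iic.2 h)
      ⟨0, by finiteness⟩
    have he : ⋂ p : ℝ, Iic p = ∅ :=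
      eq_empty_of_forall_notMem fun x hx => by
        have := mem_iInter.1 hx (x - 1)
        rw [mem_Iic] at this
        linarith
    rwa [he, measure_empty] at h
  have htop : Filter.Tendsto (fun p => μ.real (Iic p)) Filter.atTop (nhds b) := by
    have hu : (μ univ).toReal = b := by
      rw [hμ, Measure.restrict_apply_univ, hb, ENNReal.toReal_ofReal (ht.trans htb).le]
    rw [← hu]
    exact (ENNReal.tendsto_toReal (by finiteness)).comp (tendsto_measure_Iic_atTop μ)
  obtain ⟨x, hx⟩ := (hbot.eventually (gt_mem_nhds ht)).exists
  obtain ⟨y, hy⟩ := (htop.eventually (lt_mem_nhds htb)).exists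
  obtain ⟨p, hp⟩ := mem_range_of_exists_le_of_exists_ge hcont ⟨x, hx.le⟩ ⟨y, hy.le⟩
  refine ⟨p, ?_⟩
  rw [← hμI, ← hp]
  change μ (Iic p) = ENNReal.ofReal (μ (Iic p)).toReal
  rw [ENNReal.ofReal_toReal (by finiteness)]

theorem measurable_volume_inter_Ioo {B : Set ℝ} (hB : MeasurableSet B) (c d : ℝ) :
    Measurable fun x : ℝ => volume (B ∩ Ioo (x + c) (x + d)) := by
  exact measurable_measure_prodMk_left (measurableSet_snd_mem_and_mem_Ioo hB c d)

/-- A one-parameter family of upper bounds for the interaction of two sets of reals through the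
indicator of an interval of length `2 * r`; optimizing in `t` gives the Riesz inequality. -/
theorem setLIntegral_volume_inter_Ioo_le {A B : Set ℝ} (hB : MeasurableSet B) {b r t : ℝ}
    (hb : volume B = ENNReal.ofReal b) (ht : 0 ≤ t) (htb : t ≤ b) (htr : t ≤ 2 * r) :
    ∫⁻ x in A, volume (B ∩ Ioo (x + -r) (x + r)) ≤
      ENNReal.ofReal t * volume A + ENNReal.ofReal (b - t) * ENNReal.ofReal (2 * r - t) := by
  rcases ht.eq_or_lt with rfl | ht0
  · calc _ ≤ ∫⁻ x, volume (B ∩ Ioo (x + -r) (x + r)) := setLIntegral_le_lintegral _ _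
      _ = _ := by
        rw [lintegral_volume_inter_Ioo hB, hb]; simp [two_mul]
  rcases htb.eq_or_lt with rfl | htb
  · calc _ ≤ ∫⁻ x in A, ENNReal.ofReal t :=
          lintegral_mono fun x => (measure_mono inter_subset_left).trans hb.le
      _ = _ := by simp
  obtain ⟨p, hp⟩ := exists_volume_inter_Iic_eq hb ht0 htb
  have hp' : volume (B ∩ Ioi p) = ENNReal.ofReal (b - t) := by
    have h := measure_inter_add_sdiff (μ := volume) B (measurableSet_Iic (a := p))
    rw [sdiff_eq, compl_Iic, hp, hb] at h
    rw [ENNReal.ofReal_sub _ ht, ← h, ENNReal.add_sub_cancel_left ENNReal.ofReal_ne_top]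
  have hpt : ∀ x, volume (B ∩ Ioo (x + -r) (x + r)) ≤
      ENNReal.ofReal t + volume (B ∩ Ioi p ∩ Ioo (x + (t - r)) (x + r)) := by
    intro x
    rcases le_or_gt (x + (t - r)) p with h | h
    · rw [← hp]
      refine (measure_mono fun z hz => ?_).trans (measure_union_le _ _)
      rcases le_or_gt z p with hz' | hz'
      · exact Or.inl ⟨hz.1, hz'⟩
      · exact Or.inr ⟨⟨hz.1, hz'⟩, h.trans_lt hz', hz.2.2⟩
    · have : ENNReal.ofReal t = volume (Ioc (x + -r) (x + (t - r))) := by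
        rw [Real.volume_Ioc]; congr 1; ring
      rw [this]
      refine (measure_mono fun z hz => ?_).trans (measure_union_le _ _)
      rcases le_or_gt z (x + (t - r)) with hz' | hz'
      · exact Or.inl ⟨hz.2.1, hz'⟩
      · exact Or.inr ⟨⟨hz.1, h.trans hz'⟩, hz', hz.2.2⟩
  calc ∫⁻ x in A, volume (B ∩ Ioo (x + -r) (x + r))
      ≤ ∫⁻ x in A, (ENNReal.ofReal t + volume (B ∩ Ioi p ∩ Ioo (x + (t - r)) (x + r))) :=
        lintegral_mono hpt
    _ = ENNReal.ofReal t * volume A +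
        ∫⁻ x in A, volume (B ∩ Ioi p ∩ Ioo (x + (t - r)) (x + r)) := by
        rw [lintegral_add_left measurable_const, setLIntegral_const]
    _ ≤ ENNReal.ofReal t * volume A +
        ∫⁻ x, volume (B ∩ Ioi p ∩ Ioo (x + (t - r)) (x + r)) := by
        gcongr; exact Measure.restrict_le_self
    _ = _ := by
        rw [lintegral_volume_inter_Ioo (hB.inter measurableSet_Ioi), hp']
        congr 3; ring

theorem le_setLIntegral_volume_Ioo_inter_Ioo {a b r t : ℝ} (ht : 0 ≤ t) (htb : t ≤ b)
    (htr : t ≤ 2 * r) (hlow : t = 0 ∨ a ≤ b + 2 * r - 2 * t)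
    (hupp : t = b ∨ t = 2 * r ∨ b + 2 * r - 2 * t ≤ a) :
    ENNReal.ofReal t * ENNReal.ofReal a + ENNReal.ofReal (b - t) * ENNReal.ofReal (2 * r - t) ≤
      ∫⁻ x in Ioo (-(a / 2)) (a / 2),
        volume (Ioo (-(b / 2)) (b / 2) ∩ Ioo (x + -r) (x + r)) := by
  have hw : ∀ x : ℝ, volume (Ioo (-(b / 2) + t) (b / 2) ∩ Ioo (x + (t - r)) (x + r)) =
      ENNReal.ofReal (min (b / 2) (x + r) - max (-(b / 2)) (x + -r) - t) := fun x => by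
    rw [Ioo_inter_Ioo, Real.volume_Ioo, show x + (t - r) = x + -r + t by ring]
    change ENNReal.ofReal (min _ _ - max _ _) = _
    rw [max_add_add_right]
    congr 1; ring
  calc ENNReal.ofReal t * ENNReal.ofReal a + ENNReal.ofReal (b - t) * ENNReal.ofReal (2 * r - t)
      = ENNReal.ofReal t * volume (Ioo (-(a / 2)) (a / 2)) +
        ∫⁻ x, volume (Ioo (-(b / 2) + t) (b / 2) ∩ Ioo (x + (t - r)) (x + r)) := by
        rw [lintegral_volume_inter_Ioo measurableSet_Ioo, Real.volume_Ioo, Real.volume_Ioo]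
        congr 3 <;> ring_nf
    _ = ENNReal.ofReal t * volume (Ioo (-(a / 2)) (a / 2)) +
        ∫⁻ x in Ioo (-(a / 2)) (a / 2),
          volume (Ioo (-(b / 2) + t) (b / 2) ∩ Ioo (x + (t - r)) (x + r)) := by
        congr 1
        refine (setLIntegral_eq_of_support_subset ?_).symm
        intro x hx
        rw [Function.mem_support, hw, ← pos_iff_ne_zero, ENNReal.ofReal_pos] at hx
        have h1 := min_le_left (b / 2) (x + r)
        have h2 := min_le_right (b / 2) (x + r)
        have h3 := le_max_left (-(b / 2)) (x + -r)
        have h4 := le_max_right (-(b / 2)) (x + -r)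
        rcases hupp with h | h | h
        · linarith
        · linarith
        · constructor <;> linarith
    _ = ∫⁻ x in Ioo (-(a / 2)) (a / 2), (ENNReal.ofReal t +
          volume (Ioo (-(b / 2) + t) (b / 2) ∩ Ioo (x + (t - r)) (x + r))) := by
        rw [lintegral_add_left measurable_const, setLIntegral_const]
    _ ≤ _ := by
        refine setLIntegral_mono' measurableSet_Ioo fun x hx => ?_
        rw [hw, Ioo_inter_Ioo, Real.volume_Ioo]
        change _ ≤ ENNReal.ofReal (min _ _ - max _ _)
        rcases hlow with rfl | h
        · simp
        · rw [← ENNReal.ofReal_add ht]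
          · apply ENNReal.ofReal_le_ofReal; linarith
          · have h1 := hx.1
            have h2 := hx.2
            rcases min_choice (b / 2) (x + r) with e | e <;>
            rcases max_choice (-(b / 2)) (x + -r) with e' | e' <;>
            rw [e, e'] <;> linarith

theorem setLIntegral_volume_inter_Ioo_le_symm {A B : Set ℝ} (hB : MeasurableSet B) {a b r : ℝ}
    (ha : volume A = ENNReal.ofReal a) (hb : volume B = ENNReal.ofReal b)
    (ha0 : 0 ≤ a) (hb0 : 0 ≤ b) (hr : 0 ≤ r) :
    ∫⁻ x in A, volume (B ∩ Ioo (x + -r) (x + r)) ≤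
      ∫⁻ x in Ioo (-(a / 2)) (a / 2),
        volume (Ioo (-(b / 2)) (b / 2) ∩ Ioo (x + -r) (x + r)) := by
  obtain ⟨t, ht, htb, htr, hlow, hupp⟩ : ∃ t : ℝ, 0 ≤ t ∧ t ≤ b ∧ t ≤ 2 * r ∧
      (t = 0 ∨ a ≤ b + 2 * r - 2 * t) ∧ (t = b ∨ t = 2 * r ∨ b + 2 * r - 2 * t ≤ a) := by
    rcases le_total (b + 2 * r) a with h | h
    · exact ⟨0, le_rfl, hb0, by linarith, Or.inl rfl, Or.inr (Or.inr (by linarith))⟩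
    rcases le_total a (b - 2 * r) with h1 | h1
    · exact ⟨2 * r, by linarith, by linarith, le_rfl, Or.inr (by linarith), Or.inr (Or.inl rfl)⟩
    rcases le_total a (2 * r - b) with h2 | h2
    · exact ⟨b, hb0, le_rfl, by linarith, Or.inr (by linarith), Or.inl rfl⟩
    exact ⟨(b + 2 * r - a) / 2, by linarith, by linarith, by linarith, Or.inr (by linarith),
      Or.inr (Or.inr (by linarith))⟩
  refine (setLIntegral_volume_inter_Ioo_le hB hb ht htb htr).trans ?_
  rw [ha]
  exact le_setLIntegral_volume_Ioo_inter_Ioo ht htb htr hlow hupp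

theorem setLIntegral_volume_compl_inter_Ioo_symm_le {A B : Set ℝ} (hB : MeasurableSet B)
    {a b r : ℝ} (ha : volume A = ENNReal.ofReal a) (hb : volume B = ENNReal.ofReal b)
    (ha0 : 0 ≤ a) (hb0 : 0 ≤ b) (hr : 0 ≤ r) :
    ∫⁻ x in Ioo (-(a / 2)) (a / 2),
        volume ((Ioo (-(b / 2)) (b / 2))ᶜ ∩ Ioo (x + -r) (x + r)) ≤
      ∫⁻ x in A, volume (Bᶜ ∩ Ioo (x + -r) (x + r)) := by
  have key : ∀ (C D : Set ℝ), MeasurableSet D → volume C = ENNReal.ofReal a →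
      (∫⁻ x in C, volume (Dᶜ ∩ Ioo (x + -r) (x + r))) +
        ∫⁻ x in C, volume (D ∩ Ioo (x + -r) (x + r)) =
      ENNReal.ofReal (2 * r) * ENNReal.ofReal a := by
    intro C D hD hC
    rw [← lintegral_add_right _ (measurable_volume_inter_Ioo hD _ _), ← hC, ← setLIntegral_const]
    refine lintegral_congr fun x => ?_
    have h := measure_inter_add_sdiff (μ := volume) (Ioo (x + -r) (x + r)) hD
    rw [Real.volume_Ioo, sdiff_eq] at h
    rw [inter_comm, inter_comm D, add_comm, h]
    congr 1; ring
  have h1 := key A B hB ha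
  have h2 := key (Ioo (-(a / 2)) (a / 2)) (Ioo (-(b / 2)) (b / 2)) measurableSet_Ioo
    (by rw [Real.volume_Ioo]; congr 1; ring)
  have h3 := setLIntegral_volume_inter_Ioo_le_symm hB ha hb ha0 hb0 hr
  have hfin : ∫⁻ x in A, volume (B ∩ Ioo (x + -r) (x + r)) ≠ ⊤ := fun h => by
    rw [h, add_top] at h1
    exact ENNReal.mul_ne_top ENNReal.ofReal_ne_top ENNReal.ofReal_ne_top h1.symm
  refine (ENNReal.add_le_add_iff_right hfin).1 ?_
  rw [h1, ← h2]
  gcongr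

/-- The one-dimensional inequality for a symmetric interval `L`, open, closed or infinite. -/
theorem setLIntegral_volume_compl_inter_symm_le {A B L : Set ℝ} (hB : MeasurableSet B)
    (hAfin : volume A ≠ ⊤) (hBfin : volume B ≠ ⊤) (hL : ∀ u v : ℝ, |u| ≤ |v| → v ∈ L → u ∈ L) :
    ∫⁻ x in schwarz1 A, volume ((schwarz1 B)ᶜ ∩ {y | x - y ∈ L}) ≤
      ∫⁻ x in A, volume (Bᶜ ∩ {y | x - y ∈ L}) := by
  have hA' := (ENNReal.ofReal_toReal hAfin).symm
  have hB' := (ENNReal.ofReal_toReal hBfin).symm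
  have hvA : volume (schwarz1 A) = volume A := by
    rw [schwarz1, Real.volume_Ioo, sub_neg_eq_add, add_halves, ← hA']
  by_cases hbdd : BddAbove L
  · rcases L.eq_empty_or_nonempty with rfl | ⟨v₀, hv₀⟩
    · simp
    set r := sSup L
    have hr0 : 0 ≤ r := le_csSup hbdd (hL 0 v₀ (by simp) hv₀)
    have hin : ∀ u, |u| < r → u ∈ L := fun u hu => by
      obtain ⟨v, hv, huv⟩ := exists_lt_of_lt_csSup ⟨v₀, hv₀⟩ hu
      exact hL u v (huv.le.trans (le_abs_self v)) hv
    have hout : ∀ u ∈ L, |u| ≤ r := fun u hu => le_csSup hbdd (hL |u| u (abs_abs u).le hu)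
    have hae : ∀ (C : Set ℝ) (x : ℝ),
        volume (C ∩ {y | x - y ∈ L}) = volume (C ∩ Ioo (x + -r) (x + r)) := fun C x => by
      refine le_antisymm ?_ (measure_mono fun y hy => ⟨hy.1, hin _ ?_⟩)
      · rw [measure_congr ((ae_eq_refl C).inter
          (Ioo_ae_eq_Icc (μ := (volume : Measure ℝ)) (a := x + -r) (b := x + r)))]
        refine measure_mono fun y hy => ⟨hy.1, ?_⟩
        have := abs_le.1 (hout _ hy.2)
        constructor <;> linarith [this.1, this.2]
      · rw [abs_lt]
        constructor <;> linarith [hy.2.1, hy.2.2]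
    simp only [hae]
    exact setLIntegral_volume_compl_inter_Ioo_symm_le hB hA' hB' ENNReal.toReal_nonneg
      ENNReal.toReal_nonneg hr0
  · have huniv : ∀ u, u ∈ L := fun u => by
      obtain ⟨v, hv, huv⟩ := not_bddAbove_iff.1 hbdd |u|
      exact hL u v (huv.le.trans (le_abs_self v)) hv
    have hBc : volume Bᶜ = ⊤ := by
      rw [measure_compl hB hBfin, Real.volume_univ, ENNReal.top_sub hBfin]
    calc _ ≤ ∫⁻ _ in schwarz1 A, (⊤ : ℝ≥0∞) := lintegral_mono fun _ => le_top
      _ = ∫⁻ _ in A, (⊤ : ℝ≥0∞) := by rw [setLIntegral_const, setLIntegral_const, hvA]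
      _ = _ := by simp [huniv, hBc, ofPred_true]

theorem lintegral_eq_lintegral_meas_ofReal_lt {α : Type*} [MeasurableSpace α] (μ : Measure α)
    [SFinite μ] {f : α → ℝ≥0∞} (hf : Measurable f) :
    ∫⁻ y, f y ∂μ = ∫⁻ τ in Ioi (0 : ℝ), μ {y | ENNReal.ofReal τ < f y} := by
  have hS : MeasurableSet {q : α × ℝ | ENNReal.ofReal q.2 < f q.1} :=
    measurableSet_lt (by fun_prop) (by fun_prop)
  have h1 := Measure.prod_apply (μ := μ) (ν := volume.restrict (Ioi (0 : ℝ))) hS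
  have h2 := Measure.prod_apply_symm (μ := μ) (ν := volume.restrict (Ioi (0 : ℝ))) hS
  refine Eq.trans (lintegral_congr fun y => ?_) (h1.symm.trans h2)
  rw [Measure.restrict_apply (measurable_prodMk_left hS)]
  by_cases hy : f y = ⊤
  · have : (Prod.mk y ⁻¹' {q : α × ℝ | ENNReal.ofReal q.2 < f q.1}) ∩ Ioi 0 = Ioi 0 := by
      ext τ; simp [hy]
    rw [this, Real.volume_Ioi, hy]
  · have : (Prod.mk y ⁻¹' {q : α × ℝ | ENNReal.ofReal q.2 < f q.1}) ∩ Ioi 0 =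
        Ioo 0 (f y).toReal := by
      ext τ
      simp only [mem_inter_iff, mem_preimage, mem_ofPred_eq, mem_Ioi, mem_Ioo]
      rw [and_comm]
      refine and_congr_right fun hτ => ?_
      rw [ENNReal.ofReal_lt_iff_lt_toReal hτ.le hy]
    rw [this, Real.volume_Ioo, sub_zero, ENNReal.ofReal_toReal hy]

theorem setLIntegral_setLIntegral_sub_eq {A B : Set ℝ} (hB : MeasurableSet B) {φ : ℝ → ℝ≥0∞}
    (hφ : Measurable φ) :
    ∫⁻ x in A, ∫⁻ y in B, φ (x - y) =
      ∫⁻ τ in Ioi (0 : ℝ), ∫⁻ x in A, volume (B ∩ {y | x - y ∈ {z | ENNReal.ofReal τ < φ z}}) := by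
  have hS : MeasurableSet {q : (ℝ × ℝ) × ℝ | ENNReal.ofReal q.1.2 < φ (q.1.1 - q.2)} :=
    measurableSet_lt (by fun_prop) (by fun_prop)
  have hm : Measurable fun q : ℝ × ℝ =>
      volume.restrict B {y | ENNReal.ofReal q.2 < φ (q.1 - y)} :=
    measurable_measure_prodMk_left hS
  calc ∫⁻ x in A, ∫⁻ y in B, φ (x - y)
      = ∫⁻ x in A, ∫⁻ τ in Ioi (0 : ℝ), volume.restrict B {y | ENNReal.ofReal τ < φ (x - y)} :=
        lintegral_congr fun x => lintegral_eq_lintegral_meas_ofReal_lt _ (by fun_prop)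
    _ = ∫⁻ τ in Ioi (0 : ℝ), ∫⁻ x in A, volume.restrict B {y | ENNReal.ofReal τ < φ (x - y)} :=
        lintegral_lintegral_swap hm.aemeasurable
    _ = _ := by
        refine lintegral_congr fun τ => lintegral_congr fun x => ?_
        rw [Measure.restrict_apply' hB, inter_comm]
        rfl

/-- The one-dimensional inequality for a kernel which is even and nonincreasing in `|·|`. -/
theorem setLIntegral_schwarz1_le {A B : Set ℝ} (hB : MeasurableSet B) (hAfin : volume A ≠ ⊤)
    (hBfin : volume B ≠ ⊤) {φ : ℝ → ℝ≥0∞} (hφ : Measurable φ)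
    (hmono : ∀ u v : ℝ, |u| ≤ |v| → φ v ≤ φ u) :
    ∫⁻ x in schwarz1 A, ∫⁻ y in (schwarz1 B)ᶜ, φ (x - y) ≤
      ∫⁻ x in A, ∫⁻ y in Bᶜ, φ (x - y) := by
  rw [setLIntegral_setLIntegral_sub_eq hB.compl hφ,
    setLIntegral_setLIntegral_sub_eq (B := (schwarz1 B)ᶜ) measurableSet_Ioo.compl hφ]
  exact lintegral_mono fun τ => setLIntegral_volume_compl_inter_symm_le hB hAfin hBfin
    fun u v huv hv => lt_of_lt_of_le hv (hmono u v huv)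

theorem setLIntegral_prod_sections {α β : Type*} [MeasurableSpace α] [MeasurableSpace β]
    (μ : Measure α) (ν : Measure β) [SFinite ν] {E : Set (α × β)} (hE : MeasurableSet E)
    {f : α × β → ℝ≥0∞} (hf : Measurable f) :
    ∫⁻ p in E, f p ∂(μ.prod ν) = ∫⁻ x, ∫⁻ t in {t | (x, t) ∈ E}, f (x, t) ∂ν ∂μ := by
  rw [← lintegral_indicator hE, lintegral_prod _ (hf.indicator hE).aemeasurable]
  refine lintegral_congr fun x => ?_
  exact lintegral_indicator (measurable_prodMk_left hE) fun t => f (x, t)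

theorem setLIntegral_setLIntegral_compl_eq {m : ℕ} {E : Set (Vm m)} (hE : MeasurableSet E)
    {k : Vm m → ℝ≥0∞} (hk : Measurable k) :
    ∫⁻ x in E, ∫⁻ y in Eᶜ, k (x - y) =
      ∫⁻ x' : Rm m, ∫⁻ y' : Rm m, ∫⁻ t in {t | (x', t) ∈ E}, ∫⁻ u in {u | (y', u) ∈ E}ᶜ,
        k (x' - y', t - u) := by
  have hsec : ∀ x : Vm m, ∫⁻ y in Eᶜ, k (x - y) =
      ∫⁻ y' : Rm m, ∫⁻ u in {u | (y', u) ∈ E}ᶜ, k (x - (y', u)) := fun x => by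
    rw [Measure.volume_eq_prod, setLIntegral_prod_sections _ _ hE.compl (by fun_prop)]
    rfl
  have hmeas : Measurable fun q : Vm m × Rm m =>
      ∫⁻ u in {u | (q.2, u) ∈ E}ᶜ, k (q.1 - (q.2, u)) := by
    have hset : MeasurableSet {w : (Vm m × Rm m) × ℝ | (w.1.2, w.2) ∈ Eᶜ} :=
      (by fun_prop : Measurable fun w : (Vm m × Rm m) × ℝ => (w.1.2, w.2)) hE.compl
    have hf : Measurable fun w : (Vm m × Rm m) × ℝ => k (w.1.1 - (w.1.2, w.2)) := by fun_prop
    convert (hf.indicator hset).lintegral_prod_right' (ν := (volume : Measure ℝ)) using 2 with q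
    exact (lintegral_indicator (measurable_prodMk_left hE).compl
      fun u => k (q.1 - (q.2, u))).symm
  have hmeas' : Measurable fun x : Vm m =>
      ∫⁻ y' : Rm m, ∫⁻ u in {u | (y', u) ∈ E}ᶜ, k (x - (y', u)) := hmeas.lintegral_prod_right'
  simp only [hsec]
  rw [Measure.volume_eq_prod, setLIntegral_prod_sections _ _ hE hmeas']
  refine lintegral_congr fun x' => ?_
  rw [lintegral_lintegral_swap]
  · rfl
  · exact (hmeas.comp (by fun_prop : Measurable fun q : ℝ × Rm m =>
      (((x', q.1) : Vm m), q.2))).aemeasurable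

theorem measurableSet_steinerSet {m : ℕ} {E : Set (Vm m)} (hE : MeasurableSet E) :
    MeasurableSet (steinerSet E) := by
  have hv : Measurable fun p : Vm m => (volume {t : ℝ | (p.1, t) ∈ E}).toReal / 2 :=
    (((measurable_measure_prodMk_left (ν := (volume : Measure ℝ)) hE).comp
      measurable_fst).ennreal_toReal).div_const 2
  exact (measurableSet_lt hv.neg measurable_snd).inter (measurableSet_lt measurable_snd hv)

theorem zero_mem_interior_of_convexBody {m : ℕ} {K : Set (Vm m)} (hK : IsConvexBody K)
    (hKo : IsOriginSymmetric K) : (0 : Vm m) ∈ interior K := by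
  obtain ⟨hconv, -, x, hx⟩ := hK
  have hneg : -x ∈ interior K := by
    have hsub : -interior K ⊆ interior K :=
      interior_maximal (fun y hy => by simpa using hKo _ (interior_subset hy))
        isOpen_interior.neg
    exact hsub (by simpa using hx)
  have h := hconv.interior hx hneg (a := 1 / 2) (b := 1 / 2) (by norm_num) (by norm_num)
    (by norm_num)
  simpa using h

theorem gauge_neg_last {m : ℕ} {K : Set (Vm m)} (hKs : IsSymmLast K) (z : Rm m) (t : ℝ) :
    gauge K (z, -t) = gauge K (z, t) := by
  rw [gauge_def', gauge_def']
  congr 1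
  ext r
  simp only [mem_ofPred_eq, Prod.smul_mk, smul_neg]
  refine and_congr_right fun _ => ⟨fun h => by simpa using hKs _ h, fun h => hKs _ h⟩

theorem gauge_le_gauge_of_abs_le {m : ℕ} {K : Set (Vm m)} (hconv : Convex ℝ K)
    (habs : Absorbent ℝ K) (hKs : IsSymmLast K) (z : Rm m) {u v : ℝ} (huv : |u| ≤ |v|) :
    gauge K (z, u) ≤ gauge K (z, v) := by
  rcases eq_or_ne v 0 with rfl | hv
  · rw [abs_zero, abs_nonpos_iff] at huv
    rw [huv]
  have hq := abs_le.1 (by rw [abs_div]; exact div_le_one_of_le₀ huv (abs_nonneg v) : |u / v| ≤ 1)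
  have ha : 0 ≤ (1 + u / v) / 2 := by linarith [hq.1]
  have hb : 0 ≤ (1 - u / v) / 2 := by linarith [hq.2]
  have hz : ((z, u) : Vm m) =
      ((1 + u / v) / 2) • ((z, v) : Vm m) + ((1 - u / v) / 2) • ((z, -v) : Vm m) := by
    ext1
    · simp only [Prod.fst_add, Prod.smul_fst]
      rw [← add_smul]
      ring_nf
      simp
    · simp only [Prod.snd_add, Prod.smul_snd, smul_eq_mul]
      field_simp
      ring
  rw [hz]
  refine (gauge_add_le hconv habs _ _).trans_eq ?_
  rw [gauge_smul_of_nonneg ha, gauge_smul_of_nonneg hb, gauge_neg_last hKs, smul_eq_mul,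
    smul_eq_mul]
  ring

/-- **Corollary 3.2 (inequality).** Steiner inequality for anisotropic fractional
perimeters: if `K` is symmetric with respect to `{xₙ = 0}`, then
`P_s(E,K) ≥ P_s(E^#,K)`. -/
theorem steiner_inequality_fracPer
    (m : ℕ) (s : ℝ) (hs : s ∈ Set.Ioo (0 : ℝ) 1)
    (K : Set (Vm m)) (hK : IsConvexBody K) (hKo : IsOriginSymmetric K) (hKs : IsSymmLast K)
    (E : Set (Vm m)) (hE : MeasurableSet E) (hEfin : volume E < ⊤) :
    fracPerP s (steinerSet E) K ≤ fracPerP s E K := by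
  have hK0 : K ∈ nhds (0 : Vm m) :=
    mem_interior_iff_mem_nhds.1 (zero_mem_interior_of_convexBody hK hKo)
  have hp : 0 ≤ (m : ℝ) + 1 + s := by have := hs.1; positivity
  have hg : Measurable (gauge K) := (continuous_gauge hK.1 hK0).measurable
  set k : Vm m → ℝ≥0∞ :=
    fun z => (ENNReal.ofReal (gauge K z ^ ((m : ℝ) + 1 + s)))⁻¹
  have hk : Measurable k := by fun_prop
  have hfin : ∀ᵐ x' : Rm m, volume {t : ℝ | (x', t) ∈ E} < ⊤ :=
    Measure.ae_measure_lt_top hE hEfin.ne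
  have hL := setLIntegral_setLIntegral_compl_eq (measurableSet_steinerSet hE) hk
  have hR := setLIntegral_setLIntegral_compl_eq hE hk
  unfold fracPerP
  refine (hL.trans_le ?_).trans_eq hR.symm
  refine lintegral_mono_ae ?_
  filter_upwards [hfin] with x' hx'
  refine lintegral_mono_ae ?_
  filter_upwards [hfin] with y' hy'
  refine setLIntegral_schwarz1_le (φ := fun v => k (x' - y', v)) (measurable_prodMk_left hE)
    hx'.ne hy'.ne (by fun_prop) fun u v huv => ?_
  refine ENNReal.inv_le_inv.2 (ENNReal.ofReal_le_ofReal ?_)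
  exact Real.rpow_le_rpow (gauge_nonneg _)
    (gauge_le_gauge_of_abs_le hK.1 (absorbent_nhds_zero hK0) hKs _ huv) hp
end
end

section
/- Let J be a non-negative convex function on ℝ with J(0) = 0, and let k ∈ L¹(ℝ^m) be symmetric decreasing. For non-negative measurable functions f and g on ℝ^m all of whose superlevel sets {f > τ}, {g > τ} (τ > 0) have finite measure, define 𝓔[f,g] = ∫_{ℝ^m}∫_{ℝ^m} J(f(x) − g(y)) k(x−y) dy dx. Then 𝓔[f,g] ≥ 𝓔[f*, g*], where f* and g* denote the symmetric decreasing rearrangements of f and g. -/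
open MeasureTheory Set Bornology ENNReal Pointwise

noncomputable section

/-- `ℝ^m` with the Euclidean norm. -/
abbrev Rn (m : ℕ) := EuclideanSpace ℝ (Fin m)

/-- A symmetric decreasing function: it depends only on `|x|` and is non-increasing in `|x|`. -/
def SymmDec {m : ℕ} (k : Rn m → ℝ) : Prop := ∀ x y : Rn m, ‖x‖ ≤ ‖y‖ → k y ≤ k x

/-- A strictly symmetric decreasing function: `k x > k y` whenever `|x| < |y|`. -/
def StrictSymmDec {m : ℕ} (k : Rn m → ℝ) : Prop := ∀ x y : Rn m, ‖x‖ < ‖y‖ → k y < k x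

/-- `A*`: the open Euclidean ball centered at the origin with the same measure as `A`. -/
noncomputable def schwarzSet {m : ℕ} (A : Set (Rn m)) : Set (Rn m) :=
  Metric.ball 0 (((volume A / volume (Metric.ball (0 : Rn m) 1)).toReal) ^ ((1 : ℝ) / m))

/-- The symmetric decreasing rearrangement `f*(x) = sup {τ > 0 : x ∈ {f > τ}*}`. -/
noncomputable def schwarzFn {m : ℕ} (f : Rn m → ℝ) (x : Rn m) : ℝ :=
  sSup {τ : ℝ | 0 < τ ∧ x ∈ schwarzSet {y | τ < f y}}

/-- The energy functional `𝓔[f,g] = ∫∫ J(f(x) − g(y)) k(x−y) dy dx`. -/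
noncomputable def energy {α : Type*} [MeasureSpace α] [Sub α] (J : ℝ → ℝ) (k : α → ℝ)
    (f g : α → ℝ) : ℝ≥0∞ :=
  ∫⁻ x, ∫⁻ y, ENNReal.ofReal (J (f x - g y) * k (x - y))

section Reflection

variable {m : ℕ}

/-- The reflection across the affine hyperplane `{z | ⟪v, z⟫ = c}`. -/
def hyperplaneReflection (v : Rn m) (c : ℝ) (z : Rn m) : Rn m :=
  z - (2 * (inner ℝ v z - c) / ‖v‖ ^ 2) • v

theorem inner_hyperplaneReflection {v : Rn m} (hv : v ≠ 0) (c : ℝ) (z : Rn m) :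
    inner ℝ v (hyperplaneReflection v c z) = 2 * c - inner ℝ v z := by
  have : ‖v‖ ≠ 0 := norm_ne_zero_iff.2 hv
  rw [hyperplaneReflection, inner_sub_right, inner_smul_right, real_inner_self_eq_norm_sq]
  field_simp
  ring

theorem hyperplaneReflection_of_inner_eq {v : Rn m} {c : ℝ} {z : Rn m} (h : inner ℝ v z = c) :
    hyperplaneReflection v c z = z := by
  simp [hyperplaneReflection, h]

theorem hyperplaneReflection_involutive {v : Rn m} (hv : v ≠ 0) (c : ℝ) :
    Function.Involutive (hyperplaneReflection v c) := by
  intro z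
  rw [hyperplaneReflection, inner_hyperplaneReflection hv, hyperplaneReflection, sub_sub,
    ← add_smul, ← add_div]
  ring_nf
  simp

theorem norm_sub_hyperplaneReflection_sq {v : Rn m} (hv : v ≠ 0) (c : ℝ) (a b : Rn m) :
    ‖a - hyperplaneReflection v c b‖ ^ 2 =
      ‖a - b‖ ^ 2 + 4 * (c - inner ℝ v a) * (c - inner ℝ v b) / ‖v‖ ^ 2 := by
  have hv' : ‖v‖ ≠ 0 := norm_ne_zero_iff.2 hv
  rw [hyperplaneReflection, ← sub_add, norm_add_sq_real, norm_smul, inner_smul_right,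
    mul_pow, Real.norm_eq_abs, sq_abs, inner_sub_left, real_inner_comm v a, real_inner_comm v b]
  field_simp
  ring

theorem isometry_hyperplaneReflection {v : Rn m} (hv : v ≠ 0) (c : ℝ) :
    Isometry (hyperplaneReflection v c) := by
  refine Isometry.of_dist_eq fun a b => ?_
  rw [dist_eq_norm, dist_eq_norm, ← sq_eq_sq₀ (norm_nonneg _) (norm_nonneg _),
    norm_sub_hyperplaneReflection_sq hv, norm_sub_rev, norm_sub_hyperplaneReflection_sq hv,
    inner_hyperplaneReflection hv, norm_sub_rev]
  ring

theorem norm_sub_le_norm_sub_hyperplaneReflection {v : Rn m} (hv : v ≠ 0) {c : ℝ} {a b : Rn m}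
    (ha : inner ℝ v a ≤ c) (hb : inner ℝ v b ≤ c) :
    ‖a - b‖ ≤ ‖a - hyperplaneReflection v c b‖ := by
  refine le_of_sq_le_sq ?_ (norm_nonneg _)
  rw [norm_sub_hyperplaneReflection_sq hv]
  have := mul_nonneg (sub_nonneg.2 ha) (sub_nonneg.2 hb)
  have : 0 ≤ 4 * (c - inner ℝ v a) * (c - inner ℝ v b) / ‖v‖ ^ 2 := by
    rw [mul_assoc]; positivity
  linarith

theorem norm_hyperplaneReflection_sub {v : Rn m} (hv : v ≠ 0) (c : ℝ) (a b : Rn m) :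
    ‖hyperplaneReflection v c a - b‖ = ‖a - hyperplaneReflection v c b‖ := by
  have := (isometry_hyperplaneReflection hv c).dist_eq a (hyperplaneReflection v c b)
  rwa [hyperplaneReflection_involutive hv, dist_eq_norm, dist_eq_norm] at this

theorem measurePreserving_hyperplaneReflection (v : Rn m) (c : ℝ) :
    MeasurePreserving (hyperplaneReflection v c) volume volume := by
  have h := (measurePreserving_add_right volume ((2 * c / ‖v‖ ^ 2) • v)).comp
    ((ℝ ∙ v)ᗮ.reflection.measurePreserving)
  have heq : hyperplaneReflection v c =
      (fun x => x + (2 * c / ‖v‖ ^ 2) • v) ∘ (ℝ ∙ v)ᗮ.reflection := by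
    funext z
    simp only [Function.comp_apply, Submodule.reflection_orthogonal_apply,
      Submodule.reflection_singleton_apply, hyperplaneReflection]
    rw [neg_sub, sub_add]
    congr 1
    rw [two_smul, ← add_smul, ← sub_smul]
    congr 1
    simp only [RCLike.ofReal_real_eq_id, id]
    ring
  rw [heq]
  exact h

end Reflection

section Polarization

variable {m : ℕ}

/-- The polarization (two-point rearrangement) of `F` across the hyperplane `{z | ⟪v, z⟫ = c}`,
moving large values into `{z | ⟪v, z⟫ ≤ c}`. -/
def polarize (v : Rn m) (c : ℝ) (F : Rn m → ℝ) (z : Rn m) : ℝ :=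
  if inner ℝ v z ≤ c then max (F z) (F (hyperplaneReflection v c z))
  else min (F z) (F (hyperplaneReflection v c z))

theorem polarize_of_le {v : Rn m} {c : ℝ} (F : Rn m → ℝ) {z : Rn m} (h : inner ℝ v z ≤ c) :
    polarize v c F z = max (F z) (F (hyperplaneReflection v c z)) := if_pos h

theorem polarize_of_lt {v : Rn m} {c : ℝ} (F : Rn m → ℝ) {z : Rn m} (h : c < inner ℝ v z) :
    polarize v c F z = min (F z) (F (hyperplaneReflection v c z)) := if_neg h.not_ge

theorem polarize_reflection_of_le {v : Rn m} (hv : v ≠ 0) {c : ℝ} (F : Rn m → ℝ) {z : Rn m}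
    (h : inner ℝ v z ≤ c) :
    polarize v c F (hyperplaneReflection v c z) =
      min (F z) (F (hyperplaneReflection v c z)) := by
  rcases h.eq_or_lt with h | h
  · rw [hyperplaneReflection_of_inner_eq h, polarize_of_le F h.le,
      hyperplaneReflection_of_inner_eq h, max_self, min_self]
  · rw [polarize_of_lt, hyperplaneReflection_involutive hv, min_comm]
    rw [inner_hyperplaneReflection hv]; linarith

theorem polarize_reflection_of_lt {v : Rn m} (hv : v ≠ 0) {c : ℝ} (F : Rn m → ℝ) {z : Rn m}
    (h : c < inner ℝ v z) :
    polarize v c F (hyperplaneReflection v c z) =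
      max (F z) (F (hyperplaneReflection v c z)) := by
  rw [polarize_of_le, hyperplaneReflection_involutive hv, max_comm]
  rw [inner_hyperplaneReflection hv]; linarith

theorem abs_max_sub_min_le {p q r s D : ℝ} (h₁ : |p - r| ≤ D) (h₂ : |q - s| ≤ D)
    (h₃ : |p - s| ≤ D) (h₄ : |q - r| ≤ D) : |max p q - min r s| ≤ D := by
  rcases max_choice p q with h | h <;> rcases min_choice r s with h' | h' <;> rw [h, h'] <;>
    assumption

theorem LipschitzWith.polarize {v : Rn m} (hv : v ≠ 0) (c : ℝ) {L : NNReal} {F : Rn m → ℝ}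
    (hF : LipschitzWith L F) : LipschitzWith L (polarize v c F) := by
  have hFσ : LipschitzWith L fun z => F (hyperplaneReflection v c z) := by
    simpa [Function.comp_def] using hF.comp (isometry_hyperplaneReflection hv c).lipschitz
  have opposite : ∀ a b : Rn m, inner ℝ v a ≤ c → c < inner ℝ v b →
      |_root_.polarize v c F a - _root_.polarize v c F b| ≤ L * ‖a - b‖ := by
    intro a b ha hb
    have hσb : inner ℝ v (hyperplaneReflection v c b) ≤ c := by
      rw [inner_hyperplaneReflection hv]; linarith
    have hd : ‖a - hyperplaneReflection v c b‖ ≤ ‖a - b‖ := by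
      simpa [hyperplaneReflection_involutive hv c b] using
        norm_sub_le_norm_sub_hyperplaneReflection hv ha hσb
    have h3 := (hF.dist_le_mul a (hyperplaneReflection v c b)).trans
      (mul_le_mul_of_nonneg_left (by simpa only [dist_eq_norm] using hd) L.2)
    have h4 := (hF.dist_le_mul (hyperplaneReflection v c a) b).trans
      (mul_le_mul_of_nonneg_left (by
        simpa only [dist_eq_norm, norm_hyperplaneReflection_sub hv] using hd) L.2)
    rw [polarize_of_le F ha, polarize_of_lt F hb]
    exact abs_max_sub_min_le (hF.dist_le_mul a b) (hFσ.dist_le_mul a b) h3 h4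
  refine LipschitzWith.of_dist_le_mul fun a b => ?_
  rw [Real.dist_eq, dist_eq_norm]
  rcases le_or_gt (inner ℝ v a) c with ha | ha <;> rcases le_or_gt (inner ℝ v b) c with hb | hb
  · rw [polarize_of_le F ha, polarize_of_le F hb]
    simpa [Real.dist_eq, dist_eq_norm] using (hF.max hFσ).dist_le_mul a b
  · exact opposite a b ha hb
  · rw [abs_sub_comm, norm_sub_rev]
    exact opposite b a hb ha
  · rw [polarize_of_lt F ha, polarize_of_lt F hb]
    simpa [Real.dist_eq, dist_eq_norm] using (hF.min hFσ).dist_le_mul a b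

theorem lintegral_le_of_add_reflection_le {α : Type*} [MeasurableSpace α] {μ : Measure α}
    {σ : α → α} (hσ : MeasurePreserving σ μ μ) {a b : α → ℝ≥0∞} (ha : Measurable a)
    (hb : Measurable b) (h : ∀ z, a z + a (σ z) ≤ b z + b (σ z)) :
    ∫⁻ z, a z ∂μ ≤ ∫⁻ z, b z ∂μ := by
  have key : ∀ {f : α → ℝ≥0∞}, Measurable f →
      ∫⁻ z, (f z + f (σ z)) ∂μ = 2 * ∫⁻ z, f z ∂μ := by
    intro f hf
    rw [lintegral_add_left hf, hσ.lintegral_comp hf, two_mul]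
  have h2 := lintegral_mono (μ := μ) h
  rw [key ha, key hb] at h2
  exact (ENNReal.mul_le_mul_iff_right (by simp) (by simp)).1 h2

theorem lintegral_le_of_add_two_reflections_le {α : Type*} [MeasurableSpace α] {μ : Measure α}
    {σ τ : α → α} (hσ : MeasurePreserving σ μ μ) (hτ : MeasurePreserving τ μ μ)
    {a b : α → ℝ≥0∞} (ha : Measurable a) (hb : Measurable b)
    (h : ∀ z, a z + a (σ z) + (a (τ z) + a (σ (τ z))) ≤
      b z + b (σ z) + (b (τ z) + b (σ (τ z)))) :
    ∫⁻ z, a z ∂μ ≤ ∫⁻ z, b z ∂μ := by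
  have key : ∀ {f : α → ℝ≥0∞}, Measurable f →
      ∫⁻ z, (f z + f (σ z)) ∂μ = 2 * ∫⁻ z, f z ∂μ := by
    intro f hf
    rw [lintegral_add_left hf, hσ.lintegral_comp hf, two_mul]
  have h2 := lintegral_le_of_add_reflection_le hτ (ha.add (ha.comp hσ.measurable))
    (hb.add (hb.comp hσ.measurable)) h
  simp only [Pi.add_apply, Function.comp_apply] at h2
  rw [key ha, key hb] at h2
  exact (ENNReal.mul_le_mul_iff_right (by simp) (by simp)).1 h2

theorem volume_pos_polarize_le {v : Rn m} (hv : v ≠ 0) (c : ℝ) {F : Rn m → ℝ}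
    (hF : Continuous F) (hP : Continuous (polarize v c F)) :
    volume {z | 0 < polarize v c F z} ≤ volume {z | 0 < F z} := by
  have hF' := (isOpen_lt (continuous_const (y := (0 : ℝ))) hF).measurableSet
  have hP' := (isOpen_lt (continuous_const (y := (0 : ℝ))) hP).measurableSet
  rw [← lintegral_indicator_one hF', ← lintegral_indicator_one hP']
  refine lintegral_le_of_add_reflection_le (measurePreserving_hyperplaneReflection v c)
    (measurable_one.indicator hP') (measurable_one.indicator hF') fun z => ?_
  simp only [indicator, mem_ofPred_eq, Pi.one_apply]
  rcases le_or_gt (inner ℝ v z) c with hz | hz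
  · rw [polarize_of_le F hz, polarize_reflection_of_le hv F hz]
    rcases le_total (F z) (F (hyperplaneReflection v c z)) with h | h <;> simp [h, add_comm]
  · rw [polarize_of_lt F hz, polarize_reflection_of_lt hv F hz]
    rcases le_total (F z) (F (hyperplaneReflection v c z)) with h | h <;> simp [h, add_comm]

end Polarization

section Interaction

variable {m : ℕ}

/-- The interaction functional `∫∫ F(x) G(y) κ(x - y) dy dx`. -/
def interaction (κ F G : Rn m → ℝ≥0∞) : ℝ≥0∞ :=
  ∫⁻ p : Rn m × Rn m, F p.1 * G p.2 * κ (p.1 - p.2) ∂(volume.prod volume)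

/-- An extended-nonnegative kernel that is non-increasing in the norm. -/
def RadialDec (κ : Rn m → ℝ≥0∞) : Prop := ∀ x y : Rn m, ‖x‖ ≤ ‖y‖ → κ y ≤ κ x

theorem interaction_mono {κ F F' G G' : Rn m → ℝ≥0∞} (hF : F ≤ F') (hG : G ≤ G') :
    interaction κ F G ≤ interaction κ F' G' := by
  refine lintegral_mono fun p => ?_
  have := hF p.1
  have := hG p.2
  dsimp only
  gcongr

theorem measurable_interaction_integrand {κ F G : Rn m → ℝ≥0∞} (hκ : Measurable κ)
    (hF : Measurable F) (hG : Measurable G) :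
    Measurable fun p : Rn m × Rn m => F p.1 * G p.2 * κ (p.1 - p.2) := by
  fun_prop

theorem interaction_eq_iterated {κ F G : Rn m → ℝ≥0∞} (hκ : Measurable κ)
    (hF : Measurable F) (hG : Measurable G) :
    interaction κ F G = ∫⁻ x, ∫⁻ y, F x * G y * κ (x - y) :=
  lintegral_prod _ (measurable_interaction_integrand hκ hF hG).aemeasurable

theorem interaction_one_right {κ F : Rn m → ℝ≥0∞} (hκ : Measurable κ) (hF : Measurable F) :
    interaction κ F 1 = (∫⁻ x, F x) * ∫⁻ x, κ x := by
  rw [interaction_eq_iterated hκ hF measurable_one]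
  simp only [Pi.one_apply, mul_one]
  rw [← lintegral_mul_const _ hF]
  refine lintegral_congr fun x => ?_
  rw [lintegral_const_mul _ (by fun_prop), lintegral_sub_left_eq_self]

theorem interaction_swap {κ F G : Rn m → ℝ≥0∞} (hrad : RadialDec κ) :
    interaction κ F G = interaction κ G F := by
  rw [interaction, ← lintegral_prod_swap]
  refine lintegral_congr fun p => ?_
  have : κ (p.2 - p.1) = κ (p.1 - p.2) :=
    le_antisymm (hrad _ _ (norm_sub_rev _ _).le) (hrad _ _ (norm_sub_rev _ _).le)
  simp only [Prod.fst_swap, Prod.snd_swap, this, mul_comm (F _)]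

theorem interaction_add_left {κ F F' G : Rn m → ℝ≥0∞} (hκ : Measurable κ)
    (hF : Measurable F) (hG : Measurable G) :
    interaction κ (F + F') G = interaction κ F G + interaction κ F' G := by
  rw [interaction, interaction, interaction,
    ← lintegral_add_left (measurable_interaction_integrand hκ hF hG)]
  simp only [Pi.add_apply, add_mul]

theorem interaction_add_right {κ F G G' : Rn m → ℝ≥0∞} (hκ : Measurable κ)
    (hF : Measurable F) (hG : Measurable G) :
    interaction κ F (G + G') = interaction κ F G + interaction κ F G' := by
  rw [interaction, interaction, interaction,
    ← lintegral_add_left (measurable_interaction_integrand hκ hF hG)]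
  simp only [Pi.add_apply, mul_add, add_mul]

theorem interaction_indicator_le {κ F : Rn m → ℝ≥0∞} (hκ : Measurable κ)
    {A : Set (Rn m)} (hA : MeasurableSet A) (hF : F ≤ 1) :
    interaction κ (A.indicator 1) F ≤ volume A * ∫⁻ x, κ x := by
  refine (interaction_mono le_rfl hF).trans ?_
  rw [interaction_one_right hκ (measurable_one.indicator hA), lintegral_indicator_one hA]

theorem indicator_one_le_one (A : Set (Rn m)) : A.indicator (1 : Rn m → ℝ≥0∞) ≤ 1 :=
  indicator_le_self' fun _ _ => zero_le

/-- Stability of the interaction of two sets under changing the sets. -/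
theorem interaction_indicator_le_add {κ : Rn m → ℝ≥0∞} (hκ : Measurable κ) (hrad : RadialDec κ)
    {A A' B B' : Set (Rn m)} (hA : MeasurableSet A) (hA' : MeasurableSet A')
    (hB : MeasurableSet B) (hB' : MeasurableSet B') :
    interaction κ (A.indicator 1) (B.indicator 1) ≤
      interaction κ (A'.indicator 1) (B'.indicator 1) +
        (volume (A \ A') + volume (B \ B')) * ∫⁻ x, κ x := by
  have split : ∀ S S' : Set (Rn m),
      S.indicator (1 : Rn m → ℝ≥0∞) ≤ S'.indicator 1 + (S \ S').indicator 1 := by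
    intro S S' x
    by_cases h : x ∈ S <;> by_cases h' : x ∈ S' <;> simp [h, h']
  have mi : ∀ {S : Set (Rn m)}, MeasurableSet S → Measurable (S.indicator (1 : Rn m → ℝ≥0∞)) :=
    fun hS => measurable_one.indicator hS
  calc interaction κ (A.indicator 1) (B.indicator 1)
      ≤ interaction κ (A'.indicator 1 + (A \ A').indicator 1) (B.indicator 1) :=
        interaction_mono (split A A') le_rfl
    _ = interaction κ (A'.indicator 1) (B.indicator 1) +
        interaction κ ((A \ A').indicator 1) (B.indicator 1) :=
        interaction_add_left hκ (mi hA') (mi hB)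
    _ ≤ interaction κ (A'.indicator 1) (B'.indicator 1 + (B \ B').indicator 1) +
        volume (A \ A') * ∫⁻ x, κ x :=
        add_le_add (interaction_mono le_rfl (split B B'))
          (interaction_indicator_le hκ (hA.diff hA') (indicator_one_le_one _))
    _ = interaction κ (A'.indicator 1) (B'.indicator 1) +
        interaction κ ((B \ B').indicator 1) (A'.indicator 1) +
        volume (A \ A') * ∫⁻ x, κ x := by
        rw [interaction_add_right hκ (mi hA') (mi hB'),
          interaction_swap hrad (F := A'.indicator 1) (G := (B \ B').indicator 1)]
    _ ≤ interaction κ (A'.indicator 1) (B'.indicator 1) +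
        volume (B \ B') * (∫⁻ x, κ x) + volume (A \ A') * ∫⁻ x, κ x := by
        gcongr
        exact interaction_indicator_le hκ (hB.diff hB') (indicator_one_le_one _)
    _ = _ := by ring

theorem two_point_inequality (a b c d : ℝ≥0∞) {p q : ℝ≥0∞} (hqp : q ≤ p) :
    a * c * p + b * d * p + b * c * q + a * d * q ≤
      max a b * max c d * p + min a b * min c d * p + min a b * max c d * q +
        max a b * min c d * q := by
  obtain ⟨r, rfl⟩ := le_iff_exists_add.1 hqp
  rcases le_total a b with h | h <;> rcases le_total c d with h' | h' <;>
    simp only [max_eq_left, max_eq_right, min_eq_left, min_eq_right, h, h'] <;>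
    obtain ⟨e, rfl⟩ := le_iff_exists_add.1 h <;> obtain ⟨f, rfl⟩ := le_iff_exists_add.1 h'
  · exact le_of_eq (by ring)
  · exact le_iff_exists_add.2 ⟨e * f * r, by ring⟩
  · exact le_iff_exists_add.2 ⟨e * f * r, by ring⟩
  · exact le_of_eq (by ring)

theorem ofReal_max_eq (a b : ℝ) :
    ENNReal.ofReal (max a b) = max (ENNReal.ofReal a) (ENNReal.ofReal b) :=
  ENNReal.ofReal_mono.map_max

theorem ofReal_min_eq (a b : ℝ) :
    ENNReal.ofReal (min a b) = min (ENNReal.ofReal a) (ENNReal.ofReal b) :=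
  ENNReal.ofReal_mono.map_min

/-- Polarization does not decrease the interaction. -/
theorem interaction_le_polarize {κ : Rn m → ℝ≥0∞} (hκ : Measurable κ) (hrad : RadialDec κ)
    {v : Rn m} (hv : v ≠ 0) (c : ℝ) {F G : Rn m → ℝ} (hF : Continuous F) (hG : Continuous G)
    (hPF : Continuous (polarize v c F)) (hPG : Continuous (polarize v c G)) :
    interaction κ (fun x => ENNReal.ofReal (F x)) (fun x => ENNReal.ofReal (G x)) ≤
      interaction κ (fun x => ENNReal.ofReal (polarize v c F x))
        (fun x => ENNReal.ofReal (polarize v c G x)) := by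
  set σ := hyperplaneReflection v c with hσ
  have mp : MeasurePreserving σ volume volume := measurePreserving_hyperplaneReflection v c
  have κeq : ∀ {x y : Rn m}, ‖x‖ = ‖y‖ → κ x = κ y :=
    fun h => le_antisymm (hrad _ _ h.ge) (hrad _ _ h.le)
  have meas : ∀ {F G : Rn m → ℝ}, Continuous F → Continuous G → Measurable
      fun p : Rn m × Rn m => ENNReal.ofReal (F p.1) * ENNReal.ofReal (G p.2) * κ (p.1 - p.2) :=
    fun hF hG => measurable_interaction_integrand hκ hF.measurable.ennreal_ofReal
      hG.measurable.ennreal_ofReal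
  refine lintegral_le_of_add_two_reflections_le ((MeasurePreserving.id volume).prod mp)
    (mp.prod (MeasurePreserving.id volume)) (meas hF hG) (meas hPF hPG) ?_
  rintro ⟨x, y⟩
  simp only [Prod.map_apply, id_eq]
  have e₁ : κ (σ x - σ y) = κ (x - y) := κeq <| by
    rw [norm_hyperplaneReflection_sub hv, hyperplaneReflection_involutive hv]
  have e₂ : κ (σ x - y) = κ (x - σ y) := κeq (norm_hyperplaneReflection_sub hv c x y)
  have le_σ : ∀ z, c < inner ℝ v z → inner ℝ v (σ z) ≤ c := fun z hz => by
    rw [inner_hyperplaneReflection hv]; linarith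
  rw [e₁, e₂]
  have key := @two_point_inequality (ENNReal.ofReal (F x)) (ENNReal.ofReal (F (σ x)))
  have hyy : σ (σ y) = y := hyperplaneReflection_involutive hv c y
  rcases le_or_gt (inner ℝ v x) c with hx | hx <;> rcases le_or_gt (inner ℝ v y) c with hy | hy
  · rw [polarize_of_le F hx, polarize_of_le G hy, polarize_reflection_of_le hv F hx,
      polarize_reflection_of_le hv G hy]
    simp only [ofReal_max_eq, ofReal_min_eq]
    convert key (ENNReal.ofReal (G y)) (ENNReal.ofReal (G (σ y)))
      (hrad _ _ (norm_sub_le_norm_sub_hyperplaneReflection hv hx hy)) using 1 <;> ring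
  · rw [polarize_of_le F hx, polarize_of_lt G hy, polarize_reflection_of_le hv F hx,
      polarize_reflection_of_lt hv G hy]
    simp only [ofReal_max_eq, ofReal_min_eq]
    have h := norm_sub_le_norm_sub_hyperplaneReflection hv hx (le_σ y hy)
    rw [← hσ, hyy] at h
    rw [max_comm (ENNReal.ofReal (G y)), min_comm (ENNReal.ofReal (G y))]
    convert key (ENNReal.ofReal (G (σ y))) (ENNReal.ofReal (G y)) (hrad _ _ h) using 1 <;> ring
  · rw [polarize_of_lt F hx, polarize_of_le G hy, polarize_reflection_of_lt hv F hx,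
      polarize_reflection_of_le hv G hy]
    simp only [ofReal_max_eq, ofReal_min_eq]
    have h := norm_sub_le_norm_sub_hyperplaneReflection hv (le_σ x hx) hy
    rw [norm_hyperplaneReflection_sub hv, norm_hyperplaneReflection_sub hv, ← hσ, hyy] at h
    rw [max_comm (ENNReal.ofReal (G y)), min_comm (ENNReal.ofReal (G y))]
    convert key (ENNReal.ofReal (G (σ y))) (ENNReal.ofReal (G y)) (hrad _ _ h) using 1 <;> ring
  · rw [polarize_of_lt F hx, polarize_of_lt G hy, polarize_reflection_of_lt hv F hx,
      polarize_reflection_of_lt hv G hy]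
    simp only [ofReal_max_eq, ofReal_min_eq]
    have h := norm_sub_le_norm_sub_hyperplaneReflection hv (le_σ x hx) (le_σ y hy)
    rw [norm_hyperplaneReflection_sub hv, norm_hyperplaneReflection_sub hv, ← hσ, hyy] at h
    convert key (ENNReal.ofReal (G y)) (ENNReal.ofReal (G (σ y))) (hrad _ _ h) using 1 <;> ring

end Interaction

section Compactness

open Filter Topology

variable {m : ℕ}

/-- Lipschitz functions with values in `[0, 1]`, supported in the closed ball of radius `R`, and
positive on a set of measure at most `V`. -/
def lipschitzBumps (m : ℕ) (L : NNReal) (R : ℝ) (V : ℝ≥0∞) : Set C(Rn m, ℝ) :=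
  {F | LipschitzWith L F ∧ (∀ x, F x ∈ Icc (0 : ℝ) 1) ∧ (∀ x, R < ‖x‖ → F x = 0) ∧
    volume {x | 0 < F x} ≤ V}

theorem isCompact_lipschitz_Icc (L : NNReal) :
    IsCompact {F : C(Rn m, ℝ) | LipschitzWith L F ∧ ∀ x, F x ∈ Icc (0 : ℝ) 1} := by
  refine ArzelaAscoli.isCompact_of_equicontinuous _ ?_ ?_
  · have himg : ContinuousMap.toFun ''
        {F : C(Rn m, ℝ) | LipschitzWith L F ∧ ∀ x, F x ∈ Icc (0 : ℝ) 1} =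
        Set.pi univ (fun _ : Rn m => Icc (0 : ℝ) 1) ∩ {f | LipschitzWith L f} := by
      ext f
      constructor
      · rintro ⟨F, ⟨h₁, h₂⟩, rfl⟩
        exact ⟨fun x _ => h₂ x, h₁⟩
      · rintro ⟨h₁, h₂⟩
        exact ⟨⟨f, h₂.continuous⟩, ⟨h₂, fun x => h₁ x (mem_univ x)⟩, rfl⟩
    rw [himg]
    refine (isCompact_univ_pi fun _ => isCompact_Icc).inter_right ?_
    simp only [lipschitzWith_iff_dist_le_mul, ofPred_forall]
    refine isClosed_iInter fun x => isClosed_iInter fun y => isClosed_le ?_ continuous_const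
    exact (continuous_apply x).dist (continuous_apply y)
  · refine (LipschitzWith.uniformEquicontinuous _ L fun F => ?_).equicontinuous
    exact F.2.1

theorem isCompact_lipschitzBumps (L : NNReal) (R : ℝ) (V : ℝ≥0∞) :
    IsCompact (lipschitzBumps m L R V) := by
  have heq : lipschitzBumps m L R V =
      {F : C(Rn m, ℝ) | LipschitzWith L F ∧ ∀ x, F x ∈ Icc (0 : ℝ) 1} ∩
        {F | (∀ x, R < ‖x‖ → F x = 0) ∧ volume {x | 0 < F x} ≤ V} := by
    ext F; simp only [lipschitzBumps, mem_ofPred_eq, mem_inter_iff, and_assoc]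
  rw [heq]
  refine (isCompact_lipschitz_Icc L).inter_right (IsSeqClosed.isClosed ?_)
  intro u F hu hlim
  have hpt : ∀ x, Tendsto (fun n => u n x) atTop (𝓝 (F x)) := fun x =>
    ((continuous_eval_const x).tendsto F).comp hlim
  refine ⟨fun x hx => tendsto_nhds_unique (hpt x) ?_, ?_⟩
  · simp [fun n => (hu n).1 x hx]
  · have meas : ∀ G : C(Rn m, ℝ), MeasurableSet {x | 0 < G x} := fun G =>
      (isOpen_lt (continuous_const (y := (0 : ℝ))) G.continuous).measurableSet
    rw [← lintegral_indicator_one (meas F)]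
    calc ∫⁻ x, {x | 0 < F x}.indicator 1 x
        ≤ ∫⁻ x, liminf (fun n => {x | 0 < u n x}.indicator (1 : Rn m → ℝ≥0∞) x) atTop := by
          refine lintegral_mono fun x => ?_
          by_cases hx : 0 < F x
          · rw [indicator_of_mem (show x ∈ {x | 0 < F x} from hx)]
            refine le_liminf_of_le (by isBoundedDefault) ?_
            filter_upwards [(hpt x).eventually (lt_mem_nhds hx)] with n hn
            rw [indicator_of_mem (show x ∈ {x | 0 < u n x} from hn)]
          · rw [indicator_of_notMem (show x ∉ {x | 0 < F x} from hx)]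
            exact zero_le
      _ ≤ liminf (fun n => ∫⁻ x, {x | 0 < u n x}.indicator (1 : Rn m → ℝ≥0∞) x) atTop :=
          lintegral_liminf_le fun n => measurable_one.indicator (meas (u n))
      _ ≤ V := by
          refine (liminf_le_liminf (v := fun _ => V) (.of_forall fun n => ?_)).trans
            (liminf_const V).le
          rw [lintegral_indicator_one (meas (u n))]
          exact (hu n).2

theorem polarize_mem_lipschitzBumps {v : Rn m} (hv : v ≠ 0) {c : ℝ} (hc : 0 ≤ c) {L : NNReal}
    {R : ℝ} {V : ℝ≥0∞} {F : C(Rn m, ℝ)} (hF : F ∈ lipschitzBumps m L R V) :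
    (⟨polarize v c F, (hF.1.polarize hv c).continuous⟩ : C(Rn m, ℝ)) ∈
      lipschitzBumps m L R V := by
  obtain ⟨h₁, h₂, h₃, h₄⟩ := hF
  refine ⟨h₁.polarize hv c, fun x => ?_, fun x hx => ?_,
    (volume_pos_polarize_le hv c F.continuous (h₁.polarize hv c).continuous).trans h₄⟩
  · rcases le_or_gt (inner ℝ v x) c with hx | hx
    · simp only [ContinuousMap.coe_mk, polarize_of_le _ hx]
      exact ⟨(h₂ x).1.trans (le_max_left _ _), max_le (h₂ x).2 (h₂ _).2⟩
    · simp only [ContinuousMap.coe_mk, polarize_of_lt _ hx]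
      exact ⟨le_min (h₂ x).1 (h₂ _).1, (min_le_left _ _).trans (h₂ x).2⟩
  · rcases le_or_gt (inner ℝ v x) c with h | h
    · have hn : ‖x‖ ≤ ‖hyperplaneReflection v c x‖ := by
        simpa using norm_sub_le_norm_sub_hyperplaneReflection hv (a := 0) (by simpa using hc) h
      simp only [ContinuousMap.coe_mk, polarize_of_le _ h, h₃ x hx, h₃ _ (hx.trans_le hn),
        max_self]
    · simp only [ContinuousMap.coe_mk, polarize_of_lt _ h, h₃ x hx]
      exact min_eq_left (h₂ _).1

theorem continuousOn_interaction {κ : Rn m → ℝ≥0∞} (hκ : Measurable κ) (hfin : ∫⁻ x, κ x ≠ ⊤)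
    (hκt : ∀ x, κ x ≠ ⊤) (L : NNReal) (R : ℝ) (V W : ℝ≥0∞) :
    ContinuousOn (fun P : C(Rn m, ℝ) × C(Rn m, ℝ) =>
      interaction κ (fun x => ENNReal.ofReal (P.1 x)) (fun x => ENNReal.ofReal (P.2 x)))
      (lipschitzBumps m L R V ×ˢ lipschitzBumps m L R W) := by
  intro P hP
  have hball : MeasurableSet (Metric.closedBall (0 : Rn m) R) := measurableSet_closedBall
  refine tendsto_lintegral_filter_of_dominated_convergence
    (fun p => (Metric.closedBall (0 : Rn m) R).indicator 1 p.1 * (1 : Rn m → ℝ≥0∞) p.2 *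
      κ (p.1 - p.2)) ?_ ?_ ?_ ?_
  · exact .of_forall fun Q => measurable_interaction_integrand hκ
      Q.1.continuous.measurable.ennreal_ofReal Q.2.continuous.measurable.ennreal_ofReal
  · filter_upwards [self_mem_nhdsWithin] with Q hQ
    refine .of_forall fun p => ?_
    gcongr
    · by_cases hp : p.1 ∈ Metric.closedBall (0 : Rn m) R
      · rw [indicator_of_mem hp]
        exact ENNReal.ofReal_le_one.2 (hQ.1.2.1 _).2
      · rw [hQ.1.2.2.1 p.1 (by simpa using hp)]
        simp
    · exact ENNReal.ofReal_le_one.2 (hQ.2.2.1 _).2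
  · refine ne_top_of_le_ne_top ?_ (interaction_indicator_le hκ hball le_rfl)
    exact ENNReal.mul_ne_top measure_closedBall_lt_top.ne hfin
  · refine .of_forall fun p => ?_
    have h₁ : Tendsto (fun Q : C(Rn m, ℝ) × C(Rn m, ℝ) => ENNReal.ofReal (Q.1 p.1))
        (𝓝 P) (𝓝 (ENNReal.ofReal (P.1 p.1))) :=
      (ENNReal.continuous_ofReal.comp
        ((continuous_eval_const p.1).comp continuous_fst)).tendsto P
    have h₂ : Tendsto (fun Q : C(Rn m, ℝ) × C(Rn m, ℝ) => ENNReal.ofReal (Q.2 p.2))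
        (𝓝 P) (𝓝 (ENNReal.ofReal (P.2 p.2))) :=
      (ENNReal.continuous_ofReal.comp
        ((continuous_eval_const p.2).comp continuous_snd)).tendsto P
    refine Tendsto.mono_left ?_ nhdsWithin_le_nhds
    exact ENNReal.Tendsto.mul_const (ENNReal.Tendsto.mul h₁ (.inr ENNReal.ofReal_ne_top) h₂
      (.inr ENNReal.ofReal_ne_top)) (.inr (hκt _))

/-- The second moment of a nonnegative function. -/
def secondMoment (F : Rn m → ℝ) : ℝ≥0∞ := ∫⁻ x, ENNReal.ofReal (F x * ‖x‖ ^ 2)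

theorem secondMoment_bound {L : NNReal} {R : ℝ} {V : ℝ≥0∞} {F : C(Rn m, ℝ)}
    (hF : F ∈ lipschitzBumps m L R V) (x : Rn m) :
    ENNReal.ofReal (F x * ‖x‖ ^ 2) ≤
      (Metric.closedBall (0 : Rn m) R).indicator (fun _ => ENNReal.ofReal (R ^ 2)) x := by
  by_cases hx : x ∈ Metric.closedBall (0 : Rn m) R
  · rw [indicator_of_mem hx]
    have hx' : ‖x‖ ≤ R := by simpa using hx
    refine ENNReal.ofReal_le_ofReal ?_
    calc F x * ‖x‖ ^ 2 ≤ 1 * R ^ 2 := by gcongr; exact (hF.2.1 x).2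
      _ = R ^ 2 := one_mul _
  · rw [hF.2.2.1 x (by simpa using hx)]
    simp

theorem lintegral_secondMoment_bound_ne_top (R : ℝ) :
    ∫⁻ x, (Metric.closedBall (0 : Rn m) R).indicator (fun _ => ENNReal.ofReal (R ^ 2)) x ≠ ⊤ := by
  rw [lintegral_indicator_const measurableSet_closedBall]
  exact ENNReal.mul_ne_top ENNReal.ofReal_ne_top measure_closedBall_lt_top.ne

theorem secondMoment_ne_top {L : NNReal} {R : ℝ} {V : ℝ≥0∞} {F : C(Rn m, ℝ)}
    (hF : F ∈ lipschitzBumps m L R V) : secondMoment F ≠ ⊤ :=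
  ne_top_of_le_ne_top (lintegral_secondMoment_bound_ne_top R)
    (lintegral_mono (secondMoment_bound hF))

theorem continuousOn_secondMoment (L : NNReal) (R : ℝ) (V : ℝ≥0∞) :
    ContinuousOn (fun F : C(Rn m, ℝ) => secondMoment F) (lipschitzBumps m L R V) := by
  intro F hF
  refine tendsto_lintegral_filter_of_dominated_convergence _ ?_ ?_
    (lintegral_secondMoment_bound_ne_top R) ?_
  · exact .of_forall fun Q => by
      have := Q.continuous
      fun_prop
  · filter_upwards [self_mem_nhdsWithin] with Q hQ
    exact .of_forall (secondMoment_bound hQ)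
  · refine .of_forall fun x => Tendsto.mono_left ?_ nhdsWithin_le_nhds
    exact (ENNReal.continuous_ofReal.comp
      ((continuous_eval_const x).mul continuous_const)).tendsto F

end Compactness

section RadialExtremal

variable {m : ℕ}

theorem polarize_moment_le {v : Rn m} (hv : v ≠ 0) {c : ℝ} (hc : 0 ≤ c) (F : Rn m → ℝ)
    (z : Rn m) :
    polarize v c F z * ‖z‖ ^ 2 +
        polarize v c F (hyperplaneReflection v c z) * ‖hyperplaneReflection v c z‖ ^ 2 ≤
      F z * ‖z‖ ^ 2 + F (hyperplaneReflection v c z) * ‖hyperplaneReflection v c z‖ ^ 2 := by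
  have norm_le : ∀ w : Rn m, inner ℝ v w ≤ c → ‖w‖ ^ 2 ≤ ‖hyperplaneReflection v c w‖ ^ 2 := by
    intro w hw
    gcongr
    simpa using norm_sub_le_norm_sub_hyperplaneReflection hv (a := 0) (by simpa using hc) hw
  rcases le_or_gt (inner ℝ v z) c with hz | hz
  · rw [polarize_of_le F hz, polarize_reflection_of_le hv F hz]
    have := norm_le z hz
    rcases le_total (F z) (F (hyperplaneReflection v c z)) with h | h
    · rw [max_eq_right h, min_eq_left h]; nlinarith
    · rw [max_eq_left h, min_eq_right h]
  · rw [polarize_of_lt F hz, polarize_reflection_of_lt hv F hz]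
    have := norm_le (hyperplaneReflection v c z)
      (by rw [inner_hyperplaneReflection hv]; linarith)
    rw [hyperplaneReflection_involutive hv] at this
    rcases le_total (F z) (F (hyperplaneReflection v c z)) with h | h
    · rw [max_eq_right h, min_eq_left h]
    · rw [max_eq_left h, min_eq_right h]; nlinarith

theorem two_mul_secondMoment (v : Rn m) (c : ℝ) {F : Rn m → ℝ} (hF : Continuous F)
    (hF0 : ∀ x, 0 ≤ F x) :
    2 * secondMoment F = ∫⁻ z, ENNReal.ofReal (F z * ‖z‖ ^ 2 +
      F (hyperplaneReflection v c z) * ‖hyperplaneReflection v c z‖ ^ 2) := by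
  have meas : Measurable fun z : Rn m => ENNReal.ofReal (F z * ‖z‖ ^ 2) := by fun_prop
  have hadd : ∀ z, ENNReal.ofReal (F z * ‖z‖ ^ 2 +
      F (hyperplaneReflection v c z) * ‖hyperplaneReflection v c z‖ ^ 2) =
      ENNReal.ofReal (F z * ‖z‖ ^ 2) + ENNReal.ofReal
        (F (hyperplaneReflection v c z) * ‖hyperplaneReflection v c z‖ ^ 2) := fun z =>
    ENNReal.ofReal_add (mul_nonneg (hF0 _) (sq_nonneg _)) (mul_nonneg (hF0 _) (sq_nonneg _))
  simp_rw [hadd]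
  rw [lintegral_add_left meas,
    (measurePreserving_hyperplaneReflection v c).lintegral_comp meas, two_mul]
  rfl

theorem secondMoment_polarize_le {v : Rn m} (hv : v ≠ 0) {c : ℝ} (hc : 0 ≤ c)
    {L : NNReal} {R : ℝ} {V : ℝ≥0∞} {F : C(Rn m, ℝ)} (hF : F ∈ lipschitzBumps m L R V) :
    secondMoment (polarize v c F) ≤ secondMoment F := by
  have hP := polarize_mem_lipschitzBumps hv hc hF
  have hPc : Continuous (polarize v c F) := hP.1.continuous
  have hP0 : ∀ x, 0 ≤ polarize v c F x := fun x => (hP.2.1 x).1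
  refine (ENNReal.mul_le_mul_iff_right two_ne_zero ENNReal.ofNat_ne_top).1 ?_
  rw [two_mul_secondMoment v c F.continuous fun x => (hF.2.1 x).1,
    two_mul_secondMoment v c hPc hP0]
  exact lintegral_mono fun z => ENNReal.ofReal_le_ofReal (polarize_moment_le hv hc F z)

/-- If polarization does not lower the second moment, then it does not lower it pointwise on
orbits of the reflection. -/
theorem polarize_moment_eq {v : Rn m} (hv : v ≠ 0) {c : ℝ} (hc : 0 ≤ c)
    {L : NNReal} {R : ℝ} {V : ℝ≥0∞} {F : C(Rn m, ℝ)} (hF : F ∈ lipschitzBumps m L R V)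
    (hle : secondMoment F ≤ secondMoment (polarize v c F)) (z : Rn m) :
    polarize v c F z * ‖z‖ ^ 2 +
        polarize v c F (hyperplaneReflection v c z) * ‖hyperplaneReflection v c z‖ ^ 2 =
      F z * ‖z‖ ^ 2 + F (hyperplaneReflection v c z) * ‖hyperplaneReflection v c z‖ ^ 2 := by
  have hP := polarize_mem_lipschitzBumps hv hc hF
  have hF0 : ∀ x, 0 ≤ F x := fun x => (hF.2.1 x).1
  have hP0 : ∀ x, 0 ≤ polarize v c F x := fun x => (hP.2.1 x).1
  have hσ := (isometry_hyperplaneReflection hv c).continuous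
  have cont : ∀ {G : Rn m → ℝ}, Continuous G → Continuous fun z => ENNReal.ofReal
      (G z * ‖z‖ ^ 2 +
        G (hyperplaneReflection v c z) * ‖hyperplaneReflection v c z‖ ^ 2) := fun hG =>
    ENNReal.continuous_ofReal.comp ((hG.mul (continuous_norm.pow 2)).add
      ((hG.comp hσ).mul ((continuous_norm.comp hσ).pow 2)))
  have hPc : Continuous (polarize v c F) := hP.1.continuous
  have hae := ae_eq_of_ae_le_of_lintegral_le (μ := volume)
    (.of_forall fun z => ENNReal.ofReal_le_ofReal (polarize_moment_le hv hc F z))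
    (by
      rw [← two_mul_secondMoment v c hPc hP0]
      exact ENNReal.mul_ne_top ENNReal.ofNat_ne_top (secondMoment_ne_top hP))
    (cont F.continuous).aemeasurable
    (by
      rw [← two_mul_secondMoment v c hPc hP0, ← two_mul_secondMoment v c F.continuous hF0]
      gcongr)
  have heq := congrFun
    ((Continuous.ae_eq_iff_eq volume (cont hPc) (cont F.continuous)).1 hae) z
  have nn : ∀ {G : Rn m → ℝ}, (∀ x, 0 ≤ G x) → 0 ≤ G z * ‖z‖ ^ 2 +
      G (hyperplaneReflection v c z) * ‖hyperplaneReflection v c z‖ ^ 2 := fun hG =>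
    add_nonneg (mul_nonneg (hG _) (sq_nonneg _)) (mul_nonneg (hG _) (sq_nonneg _))
  exact (ENNReal.ofReal_eq_ofReal_iff (nn hP0) (nn hF0)).1 heq

/-- The reflection across the perpendicular bisector of `x` and `y` exchanges them. -/
theorem hyperplaneReflection_bisector {x y : Rn m} (hxy : x ≠ y) :
    hyperplaneReflection (y - x) ((‖y‖ ^ 2 - ‖x‖ ^ 2) / 2) x = y := by
  have hv : ‖y - x‖ ^ 2 ≠ 0 := by simpa [sub_eq_zero] using hxy.symm
  have h : 2 * (inner ℝ (y - x) x - (‖y‖ ^ 2 - ‖x‖ ^ 2) / 2) / ‖y - x‖ ^ 2 = -1 := by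
    rw [div_eq_iff hv, norm_sub_sq_real, inner_sub_left, real_inner_self_eq_norm_sq]
    ring
  rw [hyperplaneReflection, h]
  simp

theorem inner_bisector_le (x y : Rn m) :
    inner ℝ (y - x) x ≤ (‖y‖ ^ 2 - ‖x‖ ^ 2) / 2 := by
  have := sq_nonneg ‖y - x‖
  rw [norm_sub_sq_real] at this
  rw [inner_sub_left, real_inner_self_eq_norm_sq]
  linarith

theorem le_of_polarize_moment_eq {F : Rn m → ℝ} {x y : Rn m} (hxy : ‖x‖ < ‖y‖)
    (h : ∀ z, polarize (y - x) ((‖y‖ ^ 2 - ‖x‖ ^ 2) / 2) F z * ‖z‖ ^ 2 +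
        polarize (y - x) ((‖y‖ ^ 2 - ‖x‖ ^ 2) / 2) F
          (hyperplaneReflection (y - x) ((‖y‖ ^ 2 - ‖x‖ ^ 2) / 2) z) *
            ‖hyperplaneReflection (y - x) ((‖y‖ ^ 2 - ‖x‖ ^ 2) / 2) z‖ ^ 2 =
      F z * ‖z‖ ^ 2 + F (hyperplaneReflection (y - x) ((‖y‖ ^ 2 - ‖x‖ ^ 2) / 2) z) *
        ‖hyperplaneReflection (y - x) ((‖y‖ ^ 2 - ‖x‖ ^ 2) / 2) z‖ ^ 2) :
    F y ≤ F x := by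
  have hne : x ≠ y := fun h => hxy.ne (by rw [h])
  have hx := h x
  rw [polarize_reflection_of_le (sub_ne_zero.2 hne.symm) F (inner_bisector_le x y),
    polarize_of_le F (inner_bisector_le x y), hyperplaneReflection_bisector hne] at hx
  by_contra! hlt
  rw [max_eq_right hlt.le, min_eq_left hlt.le] at hx
  have hsq : ‖x‖ ^ 2 < ‖y‖ ^ 2 := by gcongr
  nlinarith

/-- Among pairs of bumps, one with at least the given interaction can be chosen radially
decreasing: minimise the second moments. -/
theorem exists_radial_interaction_ge {κ : Rn m → ℝ≥0∞} (hκ : Measurable κ) (hrad : RadialDec κ)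
    (hfin : ∫⁻ x, κ x ≠ ⊤) (hκt : ∀ x, κ x ≠ ⊤) {L : NNReal} {R : ℝ} {V W : ℝ≥0∞}
    {f g : C(Rn m, ℝ)} (hf : f ∈ lipschitzBumps m L R V) (hg : g ∈ lipschitzBumps m L R W) :
    ∃ F ∈ lipschitzBumps m L R V, ∃ G ∈ lipschitzBumps m L R W,
      interaction κ (fun x => ENNReal.ofReal (f x)) (fun x => ENNReal.ofReal (g x)) ≤
        interaction κ (fun x => ENNReal.ofReal (F x)) (fun x => ENNReal.ofReal (G x)) ∧
      (∀ x y, ‖x‖ < ‖y‖ → F y ≤ F x) ∧ ∀ x y, ‖x‖ < ‖y‖ → G y ≤ G x := by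
  set S := lipschitzBumps m L R V ×ˢ lipschitzBumps m L R W
  have hS : IsCompact S := (isCompact_lipschitzBumps L R V).prod (isCompact_lipschitzBumps L R W)
  set I : C(Rn m, ℝ) × C(Rn m, ℝ) → ℝ≥0∞ := fun P =>
    interaction κ (fun x => ENNReal.ofReal (P.1 x)) (fun x => ENNReal.ofReal (P.2 x)) with hI
  have hIc : ContinuousOn I S := continuousOn_interaction hκ hfin hκt L R V W
  have hT : IsCompact (S ∩ I ⁻¹' Ici (I (f, g))) :=
    hS.of_isClosed_subset (hIc.preimage_isClosed_of_isClosed hS.isClosed isClosed_Ici)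
      inter_subset_left
  have hMc : ContinuousOn (fun P : C(Rn m, ℝ) × C(Rn m, ℝ) =>
      secondMoment P.1 + secondMoment P.2) (S ∩ I ⁻¹' Ici (I (f, g))) :=
    ((continuousOn_secondMoment L R V).comp continuousOn_fst fun P hP => hP.1.1).add
      ((continuousOn_secondMoment L R W).comp continuousOn_snd fun P hP => hP.1.2)
  obtain ⟨⟨F, G⟩, ⟨⟨hF, hG⟩, hFG⟩, hmin⟩ :=
    hT.exists_isMinOn ⟨(f, g), ⟨hf, hg⟩, mem_preimage.2 self_mem_Ici⟩ hMc
  have key : ∀ x y : Rn m, ‖x‖ < ‖y‖ → F y ≤ F x ∧ G y ≤ G x := by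
    intro x y hxy
    have hv : y - x ≠ 0 := sub_ne_zero.2 fun h => hxy.ne (by rw [h])
    have hc : 0 ≤ (‖y‖ ^ 2 - ‖x‖ ^ 2) / 2 := by
      have : ‖x‖ ^ 2 ≤ ‖y‖ ^ 2 := by gcongr
      linarith
    have hPF := polarize_mem_lipschitzBumps hv hc hF
    have hPG := polarize_mem_lipschitzBumps hv hc hG
    have hle : secondMoment F + secondMoment G ≤
        secondMoment (polarize (y - x) ((‖y‖ ^ 2 - ‖x‖ ^ 2) / 2) F) +
          secondMoment (polarize (y - x) ((‖y‖ ^ 2 - ‖x‖ ^ 2) / 2) G) :=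
      hmin (a := (⟨_, hPF.1.continuous⟩, ⟨_, hPG.1.continuous⟩))
        ⟨⟨hPF, hPG⟩, le_trans hFG (interaction_le_polarize hκ hrad hv _
          F.continuous G.continuous hPF.1.continuous hPG.1.continuous)⟩
    have hF' := secondMoment_polarize_le hv hc hF
    have hG' := secondMoment_polarize_le hv hc hG
    have hFt := secondMoment_ne_top hF
    have hGt := secondMoment_ne_top hG
    constructor
    · refine le_of_polarize_moment_eq hxy (polarize_moment_eq hv hc hF ?_)
      exact (ENNReal.add_le_add_iff_right hGt).1 (hle.trans (add_le_add_right hG' _))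
    · refine le_of_polarize_moment_eq hxy (polarize_moment_eq hv hc hG ?_)
      exact (ENNReal.add_le_add_iff_left hFt).1 (hle.trans (add_le_add_left hF' _))
  exact ⟨F, hF, G, hG, hFG, fun x y h => (key x y h).1, fun x y h => (key x y h).2⟩

end RadialExtremal

section RieszSets

variable {m : ℕ}

theorem mem_schwarzSet_iff [NeZero m] {A : Set (Rn m)} (hA : volume A ≠ ⊤) {x : Rn m} :
    x ∈ schwarzSet A ↔ volume (Metric.ball (0 : Rn m) ‖x‖) < volume A := by
  have hω0 : volume (Metric.ball (0 : Rn m) 1) ≠ 0 := (Metric.measure_ball_pos _ _ one_pos).ne'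
  have hωt : volume (Metric.ball (0 : Rn m) 1) ≠ ⊤ := measure_ball_lt_top.ne
  have hdiv : volume A / volume (Metric.ball (0 : Rn m) 1) ≠ ⊤ := ENNReal.div_ne_top hA hω0
  rw [schwarzSet, mem_ball_zero_iff, Measure.addHaar_ball _ _ (norm_nonneg x),
    finrank_euclideanSpace_fin, ← ENNReal.lt_div_iff_mul_lt (.inl hω0) (.inl hωt),
    ENNReal.ofReal_lt_iff_lt_toReal (by positivity) hdiv, one_div,
    Real.lt_rpow_inv_iff_of_pos (norm_nonneg x) ENNReal.toReal_nonneg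
      (by exact_mod_cast NeZero.pos m), Real.rpow_natCast]

theorem measurableSet_schwarzSet (A : Set (Rn m)) : MeasurableSet (schwarzSet A) :=
  measurableSet_ball

theorem volume_schwarzSet [NeZero m] {A : Set (Rn m)} (hA : volume A ≠ ⊤) :
    volume (schwarzSet A) = volume A := by
  have hω0 : volume (Metric.ball (0 : Rn m) 1) ≠ 0 := (Metric.measure_ball_pos _ _ one_pos).ne'
  have hωt : volume (Metric.ball (0 : Rn m) 1) ≠ ⊤ := measure_ball_lt_top.ne
  have hm : (m : ℝ) ≠ 0 := by exact_mod_cast NeZero.ne m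
  rw [schwarzSet, Measure.addHaar_ball _ _ (by positivity), finrank_euclideanSpace_fin,
    ← Real.rpow_natCast, ← Real.rpow_mul ENNReal.toReal_nonneg, one_div_mul_cancel hm,
    Real.rpow_one, ENNReal.ofReal_toReal (ENNReal.div_ne_top hA hω0),
    ENNReal.div_mul_cancel hω0 hωt]

theorem schwarzSet_mono [NeZero m] {A B : Set (Rn m)} (h : volume A ≤ volume B)
    (hB : volume B ≠ ⊤) : schwarzSet A ⊆ schwarzSet B := fun _ hx =>
  (mem_schwarzSet_iff hB).2 (((mem_schwarzSet_iff (ne_top_of_le_ne_top hB h)).1 hx).trans_le h)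

/-- A radially decreasing bump is supported in the ball with the measure of its support. -/
theorem ofReal_le_indicator_schwarzSet [NeZero m] {F : Rn m → ℝ} (hF : Continuous F)
    (hF1 : ∀ x, F x ≤ 1) (hrad : ∀ x y, ‖x‖ < ‖y‖ → F y ≤ F x) {U : Set (Rn m)}
    (hU : volume U ≠ ⊤) (hFU : volume {x | 0 < F x} ≤ volume U) :
    (fun x => ENNReal.ofReal (F x)) ≤ (schwarzSet U).indicator 1 := by
  intro x
  rcases le_or_gt (F x) 0 with hx | hx
  · simp [ENNReal.ofReal_of_nonpos hx]
  have hopen : IsOpen {x | 0 < F x} := isOpen_lt (continuous_const (y := (0 : ℝ))) hF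
  have hcl : x ∈ closure (Metric.closedBall (0 : Rn m) ‖x‖)ᶜ := by
    rw [closure_compl, interior_closedBall']
    simp
  obtain ⟨y, hy, hxy⟩ := mem_closure_iff.1 hcl _ hopen hx
  have hxy : ‖x‖ < ‖y‖ := by simpa using hxy
  have hsub : Metric.ball (0 : Rn m) ‖y‖ ⊆ {x | 0 < F x} := fun z hz =>
    lt_of_lt_of_le (show 0 < F y from hy) (hrad z y (by simpa using hz))
  have hmem : x ∈ schwarzSet U := by
    rw [mem_schwarzSet_iff hU]
    refine lt_of_lt_of_le ?_ ((measure_mono hsub).trans hFU)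
    rw [Measure.addHaar_ball _ _ (norm_nonneg x), Measure.addHaar_ball _ _ (norm_nonneg y)]
    refine ENNReal.mul_lt_mul_left (Metric.measure_ball_pos _ _ one_pos).ne'
      measure_ball_lt_top.ne ?_
    have hy0 : 0 < ‖y‖ := (norm_nonneg x).trans_lt hxy
    rw [ENNReal.ofReal_lt_ofReal_iff (by positivity)]
    exact pow_lt_pow_left₀ hxy (norm_nonneg x)
      (by rw [finrank_euclideanSpace_fin]; exact NeZero.ne m)
  rw [indicator_of_mem hmem]
  simpa using ENNReal.ofReal_le_ofReal (hF1 x)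

/-- A compact set inside an open set is separated from its complement by a Lipschitz bump. -/
theorem exists_lipschitzBump {K U : Set (Rn m)} {δ R : ℝ} (hδ : 0 < δ)
    (hKU : Metric.thickening δ K ⊆ U) (hR : Metric.thickening δ K ⊆ Metric.closedBall 0 R) :
    ∃ f ∈ lipschitzBumps m δ.toNNReal⁻¹ R (volume U),
      K.indicator 1 ≤ fun x => ENNReal.ofReal (f x) := by
  have hlip : LipschitzWith δ.toNNReal⁻¹ fun x => (thickenedIndicator hδ K x : ℝ) :=
    lipschitzWith_thickenedIndicator hδ K
  have hsupp : ∀ x, x ∉ Metric.thickening δ K → (thickenedIndicator hδ K x : ℝ) = 0 :=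
    fun x hx => by simp [thickenedIndicator_zero hδ K hx]
  refine ⟨⟨_, hlip.continuous⟩, ⟨hlip, fun x => ⟨NNReal.coe_nonneg _, ?_⟩, fun x hx => ?_, ?_⟩, ?_⟩
  · exact_mod_cast thickenedIndicator_le_one hδ K x
  · exact hsupp x fun h => hx.not_ge (by simpa using hR h)
  · refine measure_mono fun x hx => hKU ?_
    by_contra h
    exact (ne_of_gt hx) (hsupp x h)
  · refine indicator_le fun x hx => ?_
    rw [ContinuousMap.coe_mk, thickenedIndicator_one hδ K hx]
    simp

theorem interaction_compact_le [NeZero m] {κ : Rn m → ℝ≥0∞} (hκ : Measurable κ)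
    (hrad : RadialDec κ) (hfin : ∫⁻ x, κ x ≠ ⊤) (hκt : ∀ x, κ x ≠ ⊤) {K L U W : Set (Rn m)}
    (hK : IsCompact K) (hL : IsCompact L) (hU : IsOpen U) (hW : IsOpen W) (hKU : K ⊆ U)
    (hLW : L ⊆ W) (hUt : volume U ≠ ⊤) (hWt : volume W ≠ ⊤) :
    interaction κ (K.indicator 1) (L.indicator 1) ≤
      interaction κ ((schwarzSet U).indicator 1) ((schwarzSet W).indicator 1) := by
  obtain ⟨δ₁, hδ₁, h₁⟩ := hK.exists_thickening_subset_open hU hKU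
  obtain ⟨δ₂, hδ₂, h₂⟩ := hL.exists_thickening_subset_open hW hLW
  set δ := min δ₁ δ₂
  have hδ : 0 < δ := lt_min hδ₁ hδ₂
  obtain ⟨R, hR⟩ := ((hK.isBounded.thickening (δ := δ)).union
    (hL.isBounded.thickening (δ := δ))).subset_closedBall 0
  obtain ⟨f, hf, hKf⟩ := exists_lipschitzBump hδ
    ((Metric.thickening_mono (min_le_left _ _) K).trans h₁) (subset_union_left.trans hR)
  obtain ⟨g, hg, hLg⟩ := exists_lipschitzBump hδ
    ((Metric.thickening_mono (min_le_right _ _) L).trans h₂) (subset_union_right.trans hR)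
  obtain ⟨F, hF, G, hG, hle, hFr, hGr⟩ := exists_radial_interaction_ge hκ hrad hfin hκt hf hg
  refine ((interaction_mono hKf hLg).trans hle).trans (interaction_mono ?_ ?_)
  · exact ofReal_le_indicator_schwarzSet F.continuous (fun x => (hF.2.1 x).2) hFr hUt hF.2.2.2
  · exact ofReal_le_indicator_schwarzSet G.continuous (fun x => (hG.2.1 x).2) hGr hWt hG.2.2.2

/-- The Riesz rearrangement inequality for sets. -/
theorem interaction_le_schwarzSet [NeZero m] {κ : Rn m → ℝ≥0∞} (hκ : Measurable κ)
    (hrad : RadialDec κ) (hfin : ∫⁻ x, κ x ≠ ⊤) (hκt : ∀ x, κ x ≠ ⊤) {A B : Set (Rn m)}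
    (hA : MeasurableSet A) (hB : MeasurableSet B) (hAt : volume A ≠ ⊤) (hBt : volume B ≠ ⊤) :
    interaction κ (A.indicator 1) (B.indicator 1) ≤
      interaction κ ((schwarzSet A).indicator 1) ((schwarzSet B).indicator 1) := by
  set I := interaction κ ((schwarzSet A).indicator 1) ((schwarzSet B).indicator 1)
  have approx : ∀ {S : Set (Rn m)}, MeasurableSet S → volume S ≠ ⊤ → ∀ {ε : ℝ≥0∞}, ε ≠ 0 →
      ∃ K U, IsCompact K ∧ IsOpen U ∧ K ⊆ U ∧ volume U ≠ ⊤ ∧ volume (S \ K) ≤ ε ∧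
        volume (schwarzSet U \ schwarzSet S) ≤ ε := by
    intro S hS hSt ε hε
    obtain ⟨K, hKS, hK, hKε⟩ := hS.exists_isCompact_sdiff_lt hSt hε
    obtain ⟨U, hSU, hU, hUε⟩ := S.exists_isOpen_lt_add hSt
      (lt_min (pos_iff_ne_zero.2 hε) one_pos).ne'
    have hUt : volume U ≠ ⊤ := (hUε.trans_le (le_top)).ne
    refine ⟨K, U, hK, hU, hKS.trans hSU, hUt, hKε.le, ?_⟩
    rw [measure_sdiff (schwarzSet_mono (measure_mono hSU) hUt)
      (measurableSet_schwarzSet S).nullMeasurableSet (by rwa [volume_schwarzSet hSt]),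
      volume_schwarzSet hUt, volume_schwarzSet hSt, tsub_le_iff_left]
    exact hUε.le.trans (by gcongr; exact min_le_left _ _)
  have key : ∀ ε : ℝ≥0∞, ε ≠ 0 → interaction κ (A.indicator 1) (B.indicator 1) ≤
      I + (ε + ε) * (∫⁻ x, κ x) + (ε + ε) * ∫⁻ x, κ x := by
    intro ε hε
    obtain ⟨K, U, hK, hU, hKU, hUt, hAK, hUA⟩ := approx hA hAt hε
    obtain ⟨L, W, hL, hW, hLW, hWt, hBL, hWB⟩ := approx hB hBt hε
    calc interaction κ (A.indicator 1) (B.indicator 1)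
        ≤ interaction κ (K.indicator 1) (L.indicator 1) +
            (volume (A \ K) + volume (B \ L)) * ∫⁻ x, κ x :=
          interaction_indicator_le_add hκ hrad hA hK.measurableSet hB hL.measurableSet
      _ ≤ interaction κ ((schwarzSet U).indicator 1) ((schwarzSet W).indicator 1) +
            (ε + ε) * ∫⁻ x, κ x := by
          gcongr
          exact interaction_compact_le hκ hrad hfin hκt hK hL hU hW hKU hLW hUt hWt
      _ ≤ (I + (volume (schwarzSet U \ schwarzSet A) + volume (schwarzSet W \ schwarzSet B)) *
            ∫⁻ x, κ x) + (ε + ε) * ∫⁻ x, κ x := by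
          gcongr
          exact interaction_indicator_le_add hκ hrad (measurableSet_schwarzSet U)
            (measurableSet_schwarzSet A) (measurableSet_schwarzSet W) (measurableSet_schwarzSet B)
      _ ≤ _ := by gcongr
  have hlim : Filter.Tendsto (fun ε : ℝ≥0∞ =>
      I + (ε + ε) * (∫⁻ x, κ x) + (ε + ε) * ∫⁻ x, κ x) (nhdsWithin 0 (Ioi 0)) (nhds I) := by
    have h0 : Filter.Tendsto (fun ε : ℝ≥0∞ => (ε + ε) * ∫⁻ x, κ x) (nhds 0) (nhds 0) := by
      simpa using ENNReal.Tendsto.mul_const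
        ((Filter.tendsto_id (x := nhds (0 : ℝ≥0∞))).add Filter.tendsto_id) (.inr hfin)
    simpa using ((tendsto_const_nhds.add h0).add h0).mono_left nhdsWithin_le_nhds
  exact ge_of_tendsto hlim (Filter.eventually_of_mem self_mem_nhdsWithin fun ε hε => key ε hε.ne')

theorem interaction_schwarzSet_compl_le [NeZero m] {κ : Rn m → ℝ≥0∞} (hκ : Measurable κ)
    (hrad : RadialDec κ) (hfin : ∫⁻ x, κ x ≠ ⊤) (hκt : ∀ x, κ x ≠ ⊤) {A B : Set (Rn m)}
    (hA : MeasurableSet A) (hB : MeasurableSet B) (hAt : volume A ≠ ⊤) (hBt : volume B ≠ ⊤) :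
    interaction κ ((schwarzSet A).indicator 1) ((schwarzSet B)ᶜ.indicator 1) ≤
      interaction κ (A.indicator 1) (Bᶜ.indicator 1) := by
  have sum : ∀ {S T : Set (Rn m)}, MeasurableSet S → MeasurableSet T →
      interaction κ (S.indicator 1) (T.indicator 1) +
        interaction κ (S.indicator 1) (Tᶜ.indicator 1) = volume S * ∫⁻ x, κ x := by
    intro S T hS hT
    rw [← interaction_add_right hκ (measurable_one.indicator hS) (measurable_one.indicator hT),
      indicator_self_add_compl, interaction_one_right hκ (measurable_one.indicator hS),
      lintegral_indicator_one hS]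
  have h := sum hA hB
  rw [← volume_schwarzSet hAt,
    ← sum (measurableSet_schwarzSet A) (measurableSet_schwarzSet B)] at h
  have hle := interaction_le_schwarzSet hκ hrad hfin hκt hA hB hAt hBt
  have hne : interaction κ ((schwarzSet A).indicator 1) ((schwarzSet B).indicator 1) ≠ ⊤ := by
    refine ne_top_of_le_ne_top (ENNReal.mul_ne_top hAt hfin) ?_
    rw [← volume_schwarzSet hAt, ← sum (measurableSet_schwarzSet A) (measurableSet_schwarzSet B)]
    exact le_self_add
  refine (ENNReal.add_le_add_iff_left hne).1 ?_
  rw [← h]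
  gcongr

end RieszSets

section SchwarzFn

variable {m : ℕ}

theorem schwarzFn_nonneg (f : Rn m → ℝ) (x : Rn m) : 0 ≤ schwarzFn f x :=
  Real.sSup_nonneg fun _ hτ => hτ.1.le

theorem bddAbove_schwarzFn [NeZero m] {f : Rn m → ℝ} (hfm : Measurable f)
    (hfl : ∀ τ : ℝ, 0 < τ → volume {x | τ < f x} < ⊤) {x : Rn m} (hx : x ≠ 0) :
    BddAbove {τ : ℝ | 0 < τ ∧ x ∈ schwarzSet {y | τ < f y}} := by
  have hanti : Antitone fun n : ℕ => {y | (n : ℝ) + 1 < f y} := fun a b hab y hy =>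
    lt_of_le_of_lt (by gcongr) (show (b : ℝ) + 1 < f y from hy)
  have hinter : ⋂ n : ℕ, {y | (n : ℝ) + 1 < f y} = ∅ := by
    refine eq_empty_of_forall_notMem fun y hy => ?_
    obtain ⟨n, hn⟩ := exists_nat_gt (f y)
    have : (n : ℝ) + 1 < f y := mem_iInter.1 hy n
    linarith
  have hinf := hanti.measure_iInter (μ := volume)
    (fun n => (measurableSet_lt measurable_const hfm).nullMeasurableSet)
    ⟨0, (hfl _ (by positivity)).ne⟩
  rw [hinter, measure_empty] at hinf
  have hpos : 0 < volume (Metric.ball (0 : Rn m) ‖x‖) :=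
    Metric.measure_ball_pos _ _ (norm_pos_iff.2 hx)
  rw [hinf, iInf_lt_iff] at hpos
  obtain ⟨n, hn⟩ := hpos
  refine ⟨n + 1, fun τ ⟨hτ, hτx⟩ => ?_⟩
  rw [mem_schwarzSet_iff (hfl τ hτ).ne] at hτx
  by_contra! hlt
  exact (hτx.trans_le (measure_mono fun y hy => hlt.trans hy)).not_gt hn

/-- Away from the origin, the superlevel sets of the rearrangement are the rearranged superlevel
sets. -/
theorem lt_schwarzFn_iff [NeZero m] {f : Rn m → ℝ} (hfm : Measurable f)
    (hfl : ∀ τ : ℝ, 0 < τ → volume {x | τ < f x} < ⊤) {x : Rn m} (hx : x ≠ 0) {τ : ℝ}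
    (hτ : 0 < τ) : τ < schwarzFn f x ↔ x ∈ schwarzSet {y | τ < f y} := by
  constructor
  · intro h
    have hne : {τ : ℝ | 0 < τ ∧ x ∈ schwarzSet {y | τ < f y}}.Nonempty := by
      by_contra hempty
      rw [schwarzFn, not_nonempty_iff_eq_empty.1 hempty, Real.sSup_empty] at h
      exact h.not_gt hτ
    obtain ⟨σ, hσ, hlt⟩ := exists_lt_of_lt_csSup hne h
    exact schwarzSet_mono (measure_mono fun y hy => hlt.trans hy) (hfl τ hτ).ne hσ.2
  · intro h
    have hmono : Monotone fun n : ℕ => {y | τ + 1 / ((n : ℝ) + 1) < f y} := fun a b hab y hy =>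
      lt_of_le_of_lt (by gcongr) (show τ + 1 / ((a : ℝ) + 1) < f y from hy)
    have hunion : ⋃ n : ℕ, {y | τ + 1 / ((n : ℝ) + 1) < f y} = {y | τ < f y} := by
      refine Subset.antisymm (iUnion_subset fun n y hy => ?_) fun y hy => ?_
      · exact lt_trans (lt_add_of_pos_right τ (by positivity)) hy
      · obtain ⟨n, hn⟩ := exists_nat_one_div_lt (sub_pos.2 (show τ < f y from hy))
        exact mem_iUnion.2 ⟨n, show τ + 1 / ((n : ℝ) + 1) < f y by linarith⟩
    rw [mem_schwarzSet_iff (hfl τ hτ).ne, ← hunion, hmono.measure_iUnion, lt_iSup_iff] at h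
    obtain ⟨n, hn⟩ := h
    have hpos : 0 < τ + 1 / ((n : ℝ) + 1) := by positivity
    exact lt_of_lt_of_le (lt_add_of_pos_right τ (by positivity))
      (le_csSup (bddAbove_schwarzFn hfm hfl hx)
        ⟨hpos, (mem_schwarzSet_iff (hfl _ hpos).ne).2 hn⟩)

theorem superlevel_schwarzFn_ae_eq [NeZero m] {f : Rn m → ℝ} (hfm : Measurable f)
    (hfl : ∀ τ : ℝ, 0 < τ → volume {x | τ < f x} < ⊤) {τ : ℝ} (hτ : 0 < τ) :
    {x | τ < schwarzFn f x} =ᵐ[volume] schwarzSet {y | τ < f y} := by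
  filter_upwards [Measure.ae_ne volume (0 : Rn m)] with x hx
  exact propext (lt_schwarzFn_iff hfm hfl hx hτ)

theorem measurable_schwarzFn [NeZero m] {f : Rn m → ℝ} (hfm : Measurable f)
    (hfl : ∀ τ : ℝ, 0 < τ → volume {x | τ < f x} < ⊤) : Measurable (schwarzFn f) := by
  have hpos : ∀ τ : ℝ, 0 < τ → MeasurableSet {x | τ < schwarzFn f x} := by
    intro τ hτ
    have heq : {x | τ < schwarzFn f x} =
        ({0} ∩ {x | τ < schwarzFn f x}) ∪ (schwarzSet {y | τ < f y} \ {0}) := by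
      ext x
      by_cases hx : x = 0
      · simp [hx]
      · simpa [hx] using lt_schwarzFn_iff hfm hfl hx hτ
    rw [heq]
    exact (subsingleton_singleton.anti inter_subset_left).measurableSet.union
      ((measurableSet_schwarzSet _).diff (measurableSet_singleton 0))
  refine measurable_of_Ioi fun a => ?_
  rcases lt_or_ge a 0 with ha | ha
  · have : schwarzFn f ⁻¹' Ioi a = univ :=
      eq_univ_of_forall fun x => ha.trans_le (schwarzFn_nonneg f x)
    rw [this]
    exact MeasurableSet.univ
  · have : schwarzFn f ⁻¹' Ioi a = ⋃ n : ℕ, {x | a + 1 / ((n : ℝ) + 1) < schwarzFn f x} := by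
      refine Subset.antisymm (fun x hx => ?_) (iUnion_subset fun n x hx => ?_)
      · obtain ⟨n, hn⟩ := exists_nat_one_div_lt (sub_pos.2 (show a < schwarzFn f x from hx))
        exact mem_iUnion.2 ⟨n, show a + 1 / ((n : ℝ) + 1) < schwarzFn f x by linarith⟩
      · exact lt_trans (lt_add_of_pos_right a (by positivity)) hx
    rw [this]
    exact MeasurableSet.iUnion fun n => hpos _ (by positivity)

end SchwarzFn

section HingeDecomposition

theorem ConvexOn.monotone_rightDeriv {J : ℝ → ℝ} (hJ : ConvexOn ℝ univ J) :
    Monotone fun u => derivWithin J (Ioi u) u := by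
  have := hJ.monotoneOn_rightDeriv
  rwa [interior_univ, monotoneOn_univ] at this

theorem ConvexOn.rightDeriv_nonneg_of_nonneg {J : ℝ → ℝ} (hJ : ConvexOn ℝ univ J)
    (hJ0 : J 0 = 0) (hJnn : ∀ t, 0 ≤ J t) {u : ℝ} (hu : 0 ≤ u) :
    0 ≤ derivWithin J (Ioi u) u := by
  refine le_trans ?_ (hJ.monotone_rightDeriv hu)
  simp only
  rw [hJ.rightDeriv_eq_sInf_slope_of_mem_interior (by simp)]
  refine Real.sInf_nonneg ?_
  rintro _ ⟨y, hy, rfl⟩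
  rw [slope_def_field, hJ0, sub_zero, sub_zero]
  exact div_nonneg (hJnn y) (le_of_lt hy.2)

theorem ConvexOn.ofReal_eq_lintegral_rightDeriv {J : ℝ → ℝ} (hJ : ConvexOn ℝ univ J)
    (hJ0 : J 0 = 0) (hJnn : ∀ t, 0 ≤ J t) {t : ℝ} (ht : 0 ≤ t) :
    ENNReal.ofReal (J t) = ∫⁻ u in Ioc 0 t, ENNReal.ofReal (derivWithin J (Ioi u) u) := by
  have hD_int : IntervalIntegrable (fun u => derivWithin J (Ioi u) u) volume 0 t :=
    hJ.monotone_rightDeriv.intervalIntegrable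
  have hFTC := intervalIntegral.integral_eq_sub_of_hasDeriv_right_of_le ht
    ((hJ.continuousOn isOpen_univ).mono (subset_univ _))
    (fun x _ => hJ.hasDerivWithinAt_rightDeriv_of_mem_interior (by simp)) hD_int
  rw [hJ0, sub_zero, intervalIntegral.integral_of_le ht] at hFTC
  rw [← hFTC]
  refine ofReal_integral_eq_lintegral_ofReal hD_int.1 ?_
  exact (ae_restrict_iff' measurableSet_Ioc).2 (.of_forall fun u hu =>
    hJ.rightDeriv_nonneg_of_nonneg hJ0 hJnn hu.1.le)

/-- A monotone function exceeds a level on a ray, so the part of `(0, t]` where it does so has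
the length of a hinge function of `t`. -/
theorem Monotone.volume_Ioc_superlevel {D : ℝ → ℝ} (hD : Monotone D) (s : ℝ) :
    (∀ t, volume {u | 0 < u ∧ u ≤ t ∧ s < D u} = 0) ∨
      ∃ c, 0 ≤ c ∧ ∀ t, volume {u | 0 < u ∧ u ≤ t ∧ s < D u} = ENNReal.ofReal (t - c) := by
  set S := {u | 0 < u ∧ s < D u}
  rcases S.eq_empty_or_nonempty with hS | hS
  · refine .inl fun t => ?_
    have : {u | 0 < u ∧ u ≤ t ∧ s < D u} = ∅ :=
      subset_empty_iff.1 (hS ▸ fun u hu => ⟨hu.1, hu.2.2⟩)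
    rw [this, measure_empty]
  · have hbdd : BddBelow S := ⟨0, fun u hu => hu.1.le⟩
    refine .inr ⟨sInf S, le_csInf hS fun u hu => hu.1.le, fun t => le_antisymm ?_ ?_⟩
    · rw [← Real.volume_Icc]
      exact measure_mono fun u hu => ⟨csInf_le hbdd ⟨hu.1, hu.2.2⟩, hu.2.1⟩
    · rw [← Real.volume_Ioc]
      refine measure_mono fun u hu => ?_
      obtain ⟨v, hv, hvu⟩ := exists_lt_of_csInf_lt hS hu.1
      exact ⟨hv.1.trans hvu, hu.2, hv.2.trans_le (hD hvu.le)⟩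

/-- The positive part of a convex function is a superposition of hinge functions. -/
theorem ConvexOn.exists_hinge_decomposition {J : ℝ → ℝ} (hJ : ConvexOn ℝ univ J)
    (hJ0 : J 0 = 0) (hJnn : ∀ t, 0 ≤ J t) :
    ∃ h : ℝ → ℝ → ℝ≥0∞, Measurable (Function.uncurry h) ∧
      (∀ s, (∀ t, h s t = 0) ∨ ∃ c, 0 ≤ c ∧ ∀ t, h s t = ENNReal.ofReal (t - c)) ∧
      ∀ t, ENNReal.ofReal (J (max t 0)) = ∫⁻ s in Ioi 0, h s t := by
  set D : ℝ → ℝ := fun u => derivWithin J (Ioi u) u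
  have hD : Monotone D := hJ.monotone_rightDeriv
  have hDm : Measurable D := hD.measurable
  have hset : MeasurableSet {q : (ℝ × ℝ) × ℝ | 0 < q.2 ∧ q.2 ≤ q.1.2 ∧ q.1.1 < D q.2} :=
    (measurableSet_lt measurable_const measurable_snd).inter
      ((measurableSet_le measurable_snd (measurable_snd.comp measurable_fst)).inter
        (measurableSet_lt (measurable_fst.comp measurable_fst) (hDm.comp measurable_snd)))
  refine ⟨fun s t => volume {u | 0 < u ∧ u ≤ t ∧ s < D u}, measurable_measure_prodMk_left hset,
    fun s => hD.volume_Ioc_superlevel s, fun t => ?_⟩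
  have hJt : ENNReal.ofReal (J (max t 0)) = ∫⁻ u in Ioc 0 t, ENNReal.ofReal (D u) := by
    rcases le_total t 0 with ht | ht
    · simp [max_eq_right ht, hJ0, Ioc_eq_empty_of_le ht]
    · rw [max_eq_left ht, hJ.ofReal_eq_lintegral_rightDeriv hJ0 hJnn ht]
  have hlayer : ∀ u, ENNReal.ofReal (D u) = ∫⁻ s in Ioi 0, {q : ℝ × ℝ | q.1 < D q.2}.indicator
      (1 : ℝ × ℝ → ℝ≥0∞) (s, u) := by
    intro u
    have : (fun s => {q : ℝ × ℝ | q.1 < D q.2}.indicator (1 : ℝ × ℝ → ℝ≥0∞) (s, u)) =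
        (Iio (D u)).indicator 1 := rfl
    rw [this, lintegral_indicator_one measurableSet_Iio, Measure.restrict_apply measurableSet_Iio,
      Iio_inter_Ioi, Real.volume_Ioo, sub_zero]
  have hset' : MeasurableSet {q : ℝ × ℝ | q.1 < D q.2} :=
    measurableSet_lt measurable_fst (hDm.comp measurable_snd)
  rw [hJt]
  simp_rw [hlayer]
  rw [lintegral_lintegral_swap]
  swap
  · exact ((measurable_one.indicator hset').comp measurable_swap).aemeasurable
  refine lintegral_congr fun s => ?_
  have : (fun u => {q : ℝ × ℝ | q.1 < D q.2}.indicator (1 : ℝ × ℝ → ℝ≥0∞) (s, u)) =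
      {u | s < D u}.indicator 1 := rfl
  have hs : MeasurableSet {u | s < D u} := measurableSet_lt measurable_const hDm
  rw [this, lintegral_indicator_one hs, Measure.restrict_apply hs]
  congr 1
  ext u
  simp only [mem_inter_iff, mem_ofPred_eq, mem_Ioc]
  tauto

end HingeDecomposition

section EnergyComparison

variable {m : ℕ}

theorem interaction_congr_ae {κ F F' G G' : Rn m → ℝ≥0∞} (hF : F =ᵐ[volume] F')
    (hG : G =ᵐ[volume] G') : interaction κ F G = interaction κ F' G' := by
  refine lintegral_congr_ae ?_
  filter_upwards [Measure.quasiMeasurePreserving_fst.ae_eq_comp hF,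
    Measure.quasiMeasurePreserving_snd.ae_eq_comp hG] with p hp hq
  simp only [Function.comp_apply] at hp hq
  rw [hp, hq]

theorem ofReal_sub_sub_eq_setLIntegral {a b : ℝ} (c : ℝ) (hb : 0 ≤ b) :
    ENNReal.ofReal (a - b - c) =
      ∫⁻ τ in Ioi 0, (Iio (a - c) ∩ Ici b).indicator (1 : ℝ → ℝ≥0∞) τ := by
  have hm : MeasurableSet (Iio (a - c) ∩ Ici b) := measurableSet_Iio.inter measurableSet_Ici
  rw [setLIntegral_congr Ioi_ae_eq_Ici, lintegral_indicator_one hm, Measure.restrict_apply hm]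
  have : Iio (a - c) ∩ Ici b ∩ Ici 0 = Ico b (a - c) := by
    ext τ
    simp only [mem_inter_iff, mem_Iio, mem_Ici, mem_Ico]
    exact ⟨fun h => ⟨h.1.2, h.1.1⟩, fun h => ⟨⟨h.2, h.1⟩, hb.trans h.1⟩⟩
  rw [this, Real.volume_Ico, sub_right_comm]

theorem lintegral_hinge_eq {κ : Rn m → ℝ≥0∞} (hκ : Measurable κ) {f g : Rn m → ℝ}
    (hf : Measurable f) (hg : Measurable g) (hg0 : ∀ x, 0 ≤ g x) (c : ℝ) :
    ∫⁻ p : Rn m × Rn m, ENNReal.ofReal (f p.1 - g p.2 - c) * κ (p.1 - p.2)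
        ∂(volume.prod volume) =
      ∫⁻ τ in Ioi 0, interaction κ ({x | τ + c < f x}.indicator 1)
        ({x | τ < g x}ᶜ.indicator 1) := by
  have hset : MeasurableSet {q : (Rn m × Rn m) × ℝ | q.2 < f q.1.1 - c ∧ g q.1.2 ≤ q.2} :=
    (measurableSet_lt measurable_snd (by fun_prop)).inter
      (measurableSet_le (by fun_prop) measurable_snd)
  have hκm : Measurable fun p : Rn m × Rn m => κ (p.1 - p.2) :=
    hκ.comp (measurable_fst.sub measurable_snd)
  have hpt : ∀ p : Rn m × Rn m, ENNReal.ofReal (f p.1 - g p.2 - c) * κ (p.1 - p.2) =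
      ∫⁻ τ in Ioi 0, {q : (Rn m × Rn m) × ℝ | q.2 < f q.1.1 - c ∧ g q.1.2 ≤ q.2}.indicator
        (1 : (Rn m × Rn m) × ℝ → ℝ≥0∞) (p, τ) * κ (p.1 - p.2) := by
    intro p
    have hm : Measurable fun τ : ℝ => {q : (Rn m × Rn m) × ℝ | q.2 < f q.1.1 - c ∧
        g q.1.2 ≤ q.2}.indicator (1 : (Rn m × Rn m) × ℝ → ℝ≥0∞) (p, τ) :=
      (measurable_one.indicator hset).comp measurable_prodMk_left
    rw [lintegral_mul_const _ hm, ofReal_sub_sub_eq_setLIntegral c (hg0 p.2)]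
    rfl
  simp_rw [hpt]
  rw [lintegral_lintegral_swap]
  · refine lintegral_congr fun τ => lintegral_congr fun p => ?_
    congr 1
    by_cases h₁ : τ + c < f p.1 <;> by_cases h₂ : τ < g p.2 <;>
      simp [indicator, h₁, h₂, lt_sub_iff_add_lt, not_le.2, not_lt.1]
  · exact ((measurable_one.indicator hset).mul (hκm.comp measurable_fst)).aemeasurable

theorem lintegral_hinge_schwarzFn_le [NeZero m] {κ : Rn m → ℝ≥0∞} (hκ : Measurable κ)
    (hrad : RadialDec κ) (hfin : ∫⁻ x, κ x ≠ ⊤) (hκt : ∀ x, κ x ≠ ⊤) {f g : Rn m → ℝ}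
    (hfm : Measurable f) (hgm : Measurable g) (hgnn : ∀ x, 0 ≤ g x)
    (hfl : ∀ τ : ℝ, 0 < τ → volume {x | τ < f x} < ⊤)
    (hgl : ∀ τ : ℝ, 0 < τ → volume {x | τ < g x} < ⊤) {c : ℝ} (hc : 0 ≤ c) :
    ∫⁻ p : Rn m × Rn m, ENNReal.ofReal (schwarzFn f p.1 - schwarzFn g p.2 - c) * κ (p.1 - p.2)
        ∂(volume.prod volume) ≤
      ∫⁻ p : Rn m × Rn m, ENNReal.ofReal (f p.1 - g p.2 - c) * κ (p.1 - p.2)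
        ∂(volume.prod volume) := by
  rw [lintegral_hinge_eq hκ (measurable_schwarzFn hfm hfl) (measurable_schwarzFn hgm hgl)
    (schwarzFn_nonneg g), lintegral_hinge_eq hκ hfm hgm hgnn]
  refine setLIntegral_mono' measurableSet_Ioi fun τ hτ => ?_
  have hτ : 0 < τ := hτ
  have hτc : 0 < τ + c := by linarith
  rw [interaction_congr_ae
    (indicator_ae_eq_of_ae_eq_set (superlevel_schwarzFn_ae_eq hfm hfl hτc))
    (indicator_ae_eq_of_ae_eq_set (superlevel_schwarzFn_ae_eq hgm hgl hτ).compl)]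
  exact interaction_schwarzSet_compl_le hκ hrad hfin hκt (measurableSet_lt measurable_const hfm)
    (measurableSet_lt measurable_const hgm) (hfl _ hτc).ne (hgl _ hτ).ne

theorem lintegral_convex_posPart_schwarzFn_le [NeZero m] {κ : Rn m → ℝ≥0∞} (hκ : Measurable κ)
    (hrad : RadialDec κ) (hfin : ∫⁻ x, κ x ≠ ⊤) (hκt : ∀ x, κ x ≠ ⊤) {f g : Rn m → ℝ}
    (hfm : Measurable f) (hgm : Measurable g) (hgnn : ∀ x, 0 ≤ g x)
    (hfl : ∀ τ : ℝ, 0 < τ → volume {x | τ < f x} < ⊤)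
    (hgl : ∀ τ : ℝ, 0 < τ → volume {x | τ < g x} < ⊤) {J : ℝ → ℝ} (hJ : ConvexOn ℝ univ J)
    (hJ0 : J 0 = 0) (hJnn : ∀ t, 0 ≤ J t) :
    ∫⁻ p : Rn m × Rn m, ENNReal.ofReal (J (max (schwarzFn f p.1 - schwarzFn g p.2) 0)) *
        κ (p.1 - p.2) ∂(volume.prod volume) ≤
      ∫⁻ p : Rn m × Rn m, ENNReal.ofReal (J (max (f p.1 - g p.2) 0)) * κ (p.1 - p.2)
        ∂(volume.prod volume) := by
  obtain ⟨h, hm, hh, hJh⟩ := hJ.exists_hinge_decomposition hJ0 hJnn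
  have layer : ∀ {F G : Rn m → ℝ}, Measurable F → Measurable G →
      ∫⁻ p : Rn m × Rn m, ENNReal.ofReal (J (max (F p.1 - G p.2) 0)) * κ (p.1 - p.2)
        ∂(volume.prod volume) =
      ∫⁻ s in Ioi 0, ∫⁻ p : Rn m × Rn m, h s (F p.1 - G p.2) * κ (p.1 - p.2)
        ∂(volume.prod volume) := by
    intro F G hF hG
    have hmeas : Measurable fun q : (Rn m × Rn m) × ℝ => h q.2 (F q.1.1 - G q.1.2) :=
      hm.comp (measurable_snd.prodMk (by fun_prop))
    have hκm : Measurable fun p : Rn m × Rn m => κ (p.1 - p.2) :=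
      hκ.comp (measurable_fst.sub measurable_snd)
    rw [← lintegral_lintegral_swap]
    · refine lintegral_congr fun p => ?_
      have hmp : Measurable fun s => h s (F p.1 - G p.2) := hmeas.comp measurable_prodMk_left
      rw [hJh, lintegral_mul_const _ hmp]
    · exact (hmeas.mul (hκm.comp measurable_fst)).aemeasurable
  rw [layer (measurable_schwarzFn hfm hfl) (measurable_schwarzFn hgm hgl), layer hfm hgm]
  refine lintegral_mono fun s => ?_
  rcases hh s with h0 | ⟨c, hc, hsc⟩
  · simp [h0]
  · simp_rw [hsc]
    exact lintegral_hinge_schwarzFn_le hκ hrad hfin hκt hfm hgm hgnn hfl hgl hc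

theorem SymmDec.measurable [NeZero m] {k : Rn m → ℝ} (hk : SymmDec k) : Measurable k := by
  set e : Rn m := EuclideanSpace.single 0 1
  have he : ‖e‖ = 1 := by simp [e]
  have hanti : Antitone fun t : ℝ => k (max t 0 • e) := by
    intro s t hst
    refine hk _ _ ?_
    rw [norm_smul, norm_smul, Real.norm_of_nonneg (le_max_right _ _),
      Real.norm_of_nonneg (le_max_right _ _)]
    gcongr
  have heq : k = fun x => k (max ‖x‖ 0 • e) := by
    funext x
    have hx : ‖max ‖x‖ 0 • e‖ = ‖x‖ := by
      rw [norm_smul, he, mul_one, max_eq_left (norm_nonneg x), norm_norm]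
    exact le_antisymm (hk _ _ hx.le) (hk _ _ hx.ge)
  rw [heq]
  exact hanti.measurable.comp measurable_norm

/-- The energy splits into the contributions of the positive and negative parts of `f x - g y`. -/
theorem energy_eq_add {J : ℝ → ℝ} (hJm : Measurable J) (hJ0 : J 0 = 0) (hJnn : ∀ t, 0 ≤ J t)
    {k : Rn m → ℝ} (hk : Measurable k) (hksd : SymmDec k) {f g : Rn m → ℝ} (hf : Measurable f)
    (hg : Measurable g) :
    energy J k f g =
      ∫⁻ p : Rn m × Rn m, ENNReal.ofReal (J (max (f p.1 - g p.2) 0)) *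
          ENNReal.ofReal (k (p.1 - p.2)) ∂(volume.prod volume) +
        ∫⁻ p : Rn m × Rn m, ENNReal.ofReal (J (-max (g p.1 - f p.2) 0)) *
          ENNReal.ofReal (k (p.1 - p.2)) ∂(volume.prod volume) := by
  have hkm : Measurable fun p : Rn m × Rn m => k (p.1 - p.2) :=
    hk.comp (measurable_fst.sub measurable_snd)
  have hJpm : Measurable fun p : Rn m × Rn m => J (max (f p.1 - g p.2) 0) :=
    hJm.comp (by fun_prop)
  have hpos : Measurable fun p : Rn m × Rn m => ENNReal.ofReal (J (max (f p.1 - g p.2) 0)) *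
      ENNReal.ofReal (k (p.1 - p.2)) := hJpm.ennreal_ofReal.mul hkm.ennreal_ofReal
  have hJfg : Measurable fun p : Rn m × Rn m => J (f p.1 - g p.2) := hJm.comp (by fun_prop)
  have heven : ∀ p : Rn m × Rn m, k (p.1 - p.2) = k (p.2 - p.1) := fun p =>
    le_antisymm (hksd _ _ (norm_sub_rev _ _).le) (hksd _ _ (norm_sub_rev _ _).le)
  have hsplit : ∀ t, ENNReal.ofReal (J t) =
      ENNReal.ofReal (J (max t 0)) + ENNReal.ofReal (J (-max (-t) 0)) := by
    intro t
    rcases le_total t 0 with ht | ht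
    · rw [max_eq_right ht, max_eq_left (by linarith), hJ0]; simp
    · rw [max_eq_left ht, max_eq_right (by linarith)]; simp [hJ0]
  rw [energy, ← lintegral_prod_swap (fun p : Rn m × Rn m =>
      ENNReal.ofReal (J (-max (g p.1 - f p.2) 0)) * ENNReal.ofReal (k (p.1 - p.2))),
    ← lintegral_add_left hpos,
    ← lintegral_prod (fun p : Rn m × Rn m => ENNReal.ofReal (J (f p.1 - g p.2) * k (p.1 - p.2)))
      (hJfg.mul hkm).ennreal_ofReal.aemeasurable]
  refine lintegral_congr fun p => ?_
  rw [ENNReal.ofReal_mul (hJnn _), hsplit (f p.1 - g p.2), add_mul, neg_sub]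
  simp only [Prod.fst_swap, Prod.snd_swap]
  rw [heven p]

end EnergyComparison

/-- **Proposition 3.4(1).** The energy functional does not increase under symmetric
decreasing rearrangement. -/
theorem energy_rearrangement_inequality
    (m : ℕ) (hm : 1 ≤ m)
    (J : ℝ → ℝ) (hJc : ConvexOn ℝ Set.univ J) (hJnn : ∀ t, 0 ≤ J t) (hJ0 : J 0 = 0)
    (k : Rn m → ℝ) (hki : Integrable k volume) (hknn : ∀ x, 0 ≤ k x) (hksd : SymmDec k)
    (f g : Rn m → ℝ) (hfm : Measurable f) (hgm : Measurable g)
    (hfnn : ∀ x, 0 ≤ f x) (hgnn : ∀ x, 0 ≤ g x)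
    (hfl : ∀ τ : ℝ, 0 < τ → volume {x | τ < f x} < ⊤)
    (hgl : ∀ τ : ℝ, 0 < τ → volume {x | τ < g x} < ⊤) :
    energy J k (schwarzFn f) (schwarzFn g) ≤ energy J k f g := by
  have : NeZero m := ⟨by omega⟩
  have hk := hksd.measurable
  have hJm : Measurable J :=
    (continuousOn_univ.1 (hJc.continuousOn isOpen_univ)).measurable
  have hJneg : ConvexOn ℝ univ fun t => J (-t) := by
    simpa [Function.comp_def] using hJc.comp_linearMap (-LinearMap.id)
  have hrad : RadialDec fun x => ENNReal.ofReal (k x) := fun x y hxy =>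
    ENNReal.ofReal_le_ofReal (hksd x y hxy)
  rw [energy_eq_add hJm hJ0 hJnn hk hksd hfm hgm, energy_eq_add hJm hJ0 hJnn hk hksd
    (measurable_schwarzFn hfm hfl) (measurable_schwarzFn hgm hgl)]
  exact add_le_add
    (lintegral_convex_posPart_schwarzFn_le hk.ennreal_ofReal hrad hki.lintegral_lt_top.ne
      (fun _ => ENNReal.ofReal_ne_top) hfm hgm hgnn hfl hgl hJc hJ0 hJnn)
    (lintegral_convex_posPart_schwarzFn_le hk.ennreal_ofReal hrad hki.lintegral_lt_top.ne
      (fun _ => ENNReal.ofReal_ne_top) hgm hfm hfnn hgl hfl hJneg (by simpa using hJ0)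
      fun t => hJnn (-t))
end
end

section
/- Let J be a non-negative convex function on ℝ with J(0) = 0, and let k ∈ L¹(ℝⁿ) be such that for every x′ ∈ ℝ^{n−1} the section k_{x′}(t) = k(x′,t) is a symmetric decreasing function on ℝ. Let f and g be non-negative measurable functions on ℝⁿ such that for almost every x′ ∈ ℝ^{n−1} the one-dimensional superlevel sets {t : f(x′,t) > τ} and {t : g(x′,t) > τ} have finite measure for all τ > 0. Then 𝓔[f,g] = ∫_{ℝⁿ}∫_{ℝⁿ} J(f(x)−g(y)) k(x−y) dy dx ≥ 𝓔[f^#, g^#], where f^# denotes the Steiner symmetrization of f with respect to x_n. -/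
open MeasureTheory Set Bornology ENNReal Pointwise

noncomputable section

/-- A symmetric decreasing function on `ℝ`: it depends only on `|t|` and is
non-increasing in `|t|`. -/
def SymmDec1 (κ : ℝ → ℝ) : Prop := ∀ a b : ℝ, |a| ≤ |b| → κ b ≤ κ a

/-- A strictly symmetric decreasing function on `ℝ`: `κ a > κ b` whenever `|a| < |b|`. -/
def StrictSymmDec1 (κ : ℝ → ℝ) : Prop := ∀ a b : ℝ, |a| < |b| → κ b < κ a

/-- Integrating the measure of the part of `E` seen through a moving window. -/
lemma lintegral_volume_inter_window (E : Set ℝ) (p q : ℝ) :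
    ∫⁻ t, volume (E ∩ Ioo (t + p) (t + q)) = ENNReal.ofReal (q - p) * volume E := by
  have h1 : ∀ t, volume (E ∩ Ioo (t + p) (t + q))
      = ∫⁻ s in E, (Ioo (t + p) (t + q)).indicator 1 s := by
    intro t
    rw [lintegral_indicator_one measurableSet_Ioo, Measure.restrict_apply measurableSet_Ioo,
      inter_comm]
  simp_rw [h1]
  have hm : MeasurableSet {z : ℝ × ℝ | z.1 + p < z.2 ∧ z.2 < z.1 + q} := by
    refine MeasurableSet.inter (s₁ := {z : ℝ × ℝ | z.1 + p < z.2})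
      (s₂ := {z : ℝ × ℝ | z.2 < z.1 + q}) ?_ ?_ <;>
    exact measurableSet_lt (by fun_prop) (by fun_prop)
  rw [lintegral_lintegral_swap]
  · have h2 : ∀ s, ∫⁻ t, (Ioo (t + p) (t + q)).indicator (1 : ℝ → ℝ≥0∞) s
        = ENNReal.ofReal (q - p) := by
      intro s
      have : (fun t => (Ioo (t + p) (t + q)).indicator (1 : ℝ → ℝ≥0∞) s)
          = (Ioo (s - q) (s - p)).indicator 1 := by
        ext t
        simp only [indicator, mem_Ioo]
        congr 1
        apply propext
        constructor <;> rintro ⟨h, h'⟩ <;> constructor <;> linarith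
      rw [this, lintegral_indicator_one measurableSet_Ioo, Real.volume_Ioo]
      congr 1; ring
    simp_rw [h2]
    simp
  · have : (Function.uncurry fun (t s : ℝ) => (Ioo (t + p) (t + q)).indicator (1 : ℝ → ℝ≥0∞) s)
        = {z : ℝ × ℝ | z.1 + p < z.2 ∧ z.2 < z.1 + q}.indicator 1 := by
      ext ⟨t, s⟩
      simp [indicator]
    rw [this]
    exact (measurable_one.indicator hm).aemeasurable

/-- A set of finite measure can be cut by a half-line into a part of prescribed measure. -/
lemma exists_volume_inter_Ioi_eq {B : Set ℝ} (hBf : volume B ≠ ⊤) {l : ℝ}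
    (hl0 : 0 < l) (hlb : l < (volume B).toReal) :
    ∃ p : ℝ, volume (B ∩ Ioi p) = ENNReal.ofReal l := by
  have hfin : ∀ p, volume (B ∩ Ioi p) ≠ ⊤ := fun p => measure_ne_top_of_subset inter_subset_left hBf
  have hstep : ∀ p q, p ≤ q →
      (volume (B ∩ Ioi p)).toReal ≤ (volume (B ∩ Ioi q)).toReal + (q - p) := by
    intro p q hpq
    have h : volume (B ∩ Ioi p) ≤ volume (B ∩ Ioi q) + ENNReal.ofReal (q - p) := by
      rw [← Real.volume_Ioc]
      refine (measure_mono ?_).trans (measure_union_le _ _)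
      rintro x ⟨hx, hxp⟩
      by_cases h : q < x
      · exact Or.inl ⟨hx, h⟩
      · exact Or.inr ⟨hxp, not_lt.1 h⟩
    have := ENNReal.toReal_mono (by simp [hfin]) h
    rwa [ENNReal.toReal_add (hfin q) (by simp), ENNReal.toReal_ofReal (by linarith)] at this
  have hanti : ∀ p q, p ≤ q → (volume (B ∩ Ioi q)).toReal ≤ (volume (B ∩ Ioi p)).toReal :=
    fun p q hpq => ENNReal.toReal_mono (hfin p)
      (measure_mono (inter_subset_inter_right _ (Ioi_subset_Ioi hpq)))
  have hcont : Continuous fun p => (volume (B ∩ Ioi p)).toReal := by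
    refine (LipschitzWith.of_le_add (f := fun p => (volume (B ∩ Ioi p)).toReal) ?_).continuous
    intro p q
    rw [Real.dist_eq]
    rcases le_total p q with h | h
    · have := hstep p q h
      rw [abs_sub_comm, abs_of_nonneg (by linarith)]; exact this
    · exact (hanti q p h).trans (le_add_of_nonneg_right (abs_nonneg _))
  have hbot : Filter.Tendsto (fun n : ℕ => volume (B ∩ Ioi (-(n : ℝ)))) Filter.atTop
      (nhds (volume B)) := by
    have hU : ⋃ n : ℕ, B ∩ Ioi (-(n : ℝ)) = B := by
      rw [← inter_iUnion, inter_eq_left]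
      intro x _
      obtain ⟨n, hn⟩ := exists_nat_gt (-x)
      exact mem_iUnion.2 ⟨n, show -(n : ℝ) < x by linarith⟩
    have := tendsto_measure_iUnion_atTop (μ := volume) (s := fun n : ℕ => B ∩ Ioi (-(n : ℝ)))
      (fun i j hij => inter_subset_inter_right _
        (Ioi_subset_Ioi (by simpa using hij)))
    rwa [hU] at this
  have htop : Filter.Tendsto (fun n : ℕ => volume (B ∩ Ioi (n : ℝ))) Filter.atTop (nhds 0) := by
    have : ∀ n : ℕ, volume (B ∩ Ioi (n : ℝ)) = volume.restrict B (Ioi (n : ℝ)) := fun n => by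
      rw [Measure.restrict_apply measurableSet_Ioi, inter_comm]
    simp_rw [this]
    have hI : ⋂ n : ℕ, Ioi (n : ℝ) = ∅ := by
      ext x
      obtain ⟨n, hn⟩ := exists_nat_gt x
      simp only [mem_iInter, mem_Ioi, mem_empty_iff_false, iff_false, not_forall, not_lt]
      exact ⟨n, hn.le⟩
    have := tendsto_measure_iInter_atTop (μ := volume.restrict B) (s := fun n : ℕ => Ioi (n : ℝ))
      (fun _ => measurableSet_Ioi.nullMeasurableSet)
      (fun i j hij => Ioi_subset_Ioi (by simpa using hij))
      ⟨0, by simpa [Measure.restrict_apply measurableSet_Ioi, inter_comm] using hfin 0⟩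
    rwa [hI, measure_empty] at this
  have h1 : ∃ p, l ≤ (volume (B ∩ Ioi p)).toReal := by
    have := ((ENNReal.tendsto_toReal hBf).comp hbot).eventually_const_le hlb
    obtain ⟨n, hn⟩ := this.exists
    exact ⟨_, hn⟩
  have h2 : ∃ p, (volume (B ∩ Ioi p)).toReal ≤ l := by
    have := ((ENNReal.tendsto_toReal zero_ne_top).comp htop).eventually_le_const (by simpa using hl0)
    obtain ⟨n, hn⟩ := this.exists
    exact ⟨_, hn⟩
  obtain ⟨p, hp⟩ := mem_range_of_exists_le_of_exists_ge hcont h2 h1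
  exact ⟨p, by rw [← hp, ENNReal.ofReal_toReal (hfin p)]⟩

lemma measurable_volume_inter_window {E : Set ℝ} (hE : MeasurableSet E) (p q : ℝ) :
    Measurable fun t : ℝ => volume (E ∩ Ioo (t + p) (t + q)) := by
  have hm : MeasurableSet {z : ℝ × ℝ | z.2 ∈ E ∧ (z.1 + p < z.2 ∧ z.2 < z.1 + q)} := by
    refine (measurable_snd hE).inter (MeasurableSet.inter (s₁ := {z : ℝ × ℝ | z.1 + p < z.2})
      (s₂ := {z : ℝ × ℝ | z.2 < z.1 + q}) ?_ ?_) <;>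
    exact measurableSet_lt (by fun_prop) (by fun_prop)
  exact measurable_measure_prodMk_left hm

/-- Pointwise part of the one-dimensional Riesz inequality. -/
lemma volume_window_add_le {B : Set ℝ} {r l p : ℝ} (hlr : l ≤ 2 * r)
    (hp : volume (B ∩ Ioi p) = ENNReal.ofReal l) (t : ℝ) :
    volume ((B ∩ Ioi p) ∩ Ioo (t + -r) (t + r)) + volume ((B ∩ Iic p) ∩ Ioo (t + (r - l)) (t + r))
      ≤ min (volume (B ∩ Ioo (t + -r) (t + r))) (ENNReal.ofReal l) := by
  refine le_min ?_ ?_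
  · calc _ ≤ volume ((B ∩ Ioo (t + -r) (t + r)) ∩ Ioi p)
          + volume ((B ∩ Ioo (t + -r) (t + r)) \ Ioi p) := by
          refine add_le_add (measure_mono ?_) (measure_mono ?_)
          · rintro x ⟨⟨h1, h2⟩, h3⟩
            exact ⟨⟨h1, h3⟩, h2⟩
          · rintro x ⟨⟨h1, h2⟩, h3, h4⟩
            exact ⟨⟨h1, by linarith, h4⟩, notMem_Ioi.2 h2⟩
      _ = _ := measure_inter_add_sdiff _ measurableSet_Ioi
  · by_cases h : t + (r - l) < p
    · calc _ ≤ volume (Ioo (t + (r - l)) (t + r) ∩ Ioi p)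
          + volume (Ioo (t + (r - l)) (t + r) \ Ioi p) := by
            refine add_le_add (measure_mono ?_) (measure_mono ?_)
            · rintro x ⟨⟨h1, h2⟩, h3, h4⟩
              exact ⟨⟨lt_trans h h2, h4⟩, h2⟩
            · rintro x ⟨⟨h1, h2⟩, h3⟩
              exact ⟨h3, notMem_Ioi.2 h2⟩
        _ = volume (Ioo (t + (r - l)) (t + r)) := measure_inter_add_sdiff _ measurableSet_Ioi
        _ = _ := by rw [Real.volume_Ioo]; congr 1; ring
    · have : (B ∩ Iic p) ∩ Ioo (t + (r - l)) (t + r) = ∅ := by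
        ext x
        simp only [mem_inter_iff, mem_Iic, mem_Ioo, mem_empty_iff_false, iff_false]
        rintro ⟨⟨_, h2⟩, h3, _⟩
        linarith
      rw [this, measure_empty, add_zero, ← hp]
      exact measure_mono inter_subset_left

lemma ofReal_max_zero (x : ℝ) : ENNReal.ofReal x = ENNReal.ofReal (max x 0) := by
  rcases le_total x 0 with h | h
  · rw [max_eq_right h, ENNReal.ofReal_of_nonpos h, ENNReal.ofReal_zero]
  · rw [max_eq_left h]

lemma volume_Ioo_inter_Ioo (x y u v : ℝ) :
    volume (Ioo x y ∩ Ioo u v) = ENNReal.ofReal (max (min y v - max x u) 0) := by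
  rw [Ioo_inter_Ioo, Real.volume_Ioo, ← ofReal_max_zero]

lemma volume_Ioo_inter_Ioi_inter_Ioo (x y p u v : ℝ) :
    volume ((Ioo x y ∩ Ioi p) ∩ Ioo u v) = ENNReal.ofReal (max (min y v - max (max x p) u) 0) := by
  rw [Ioo_inter_Ioi, volume_Ioo_inter_Ioo]

lemma volume_Ioo_inter_Iic_inter_Ioo (x y p u v : ℝ) :
    volume ((Ioo x y ∩ Iic p) ∩ Ioo u v) = ENNReal.ofReal (max (min (min y p) v - max x u) 0) := by
  have h : ((Ioo x y ∩ Iic p) ∩ Ioo u v : Set ℝ) =ᵐ[volume] ((Ioo x y ∩ Iio p) ∩ Ioo u v : Set ℝ) :=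
    ((Filter.EventuallyEq.refl _ _).inter Iio_ae_eq_Iic.symm).inter (Filter.EventuallyEq.refl _ _)
  rw [measure_congr h, Ioo_inter_Iio, volume_Ioo_inter_Ioo]

/-- Equality in `volume_window_add_le` for centred intervals. -/
lemma volume_window_add_eq {a b r : ℝ} (h1 : |b - 2 * r| ≤ a) (h2 : a ≤ b + 2 * r) (t : ℝ) :
    (Ioo (-(a / 2)) (a / 2)).indicator
        (fun t => volume (Ioo (-(b / 2)) (b / 2) ∩ Ioo (t + -r) (t + r))) t
      + (volume ((Ioo (-(b / 2)) (b / 2) ∩ Ioi (b / 2 - (b + 2 * r - a) / 2))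
            ∩ Ioo (t + -r) (t + r))
        + volume ((Ioo (-(b / 2)) (b / 2) ∩ Iic (b / 2 - (b + 2 * r - a) / 2))
            ∩ Ioo (t + (r - (b + 2 * r - a) / 2)) (t + r)))
      = volume (Ioo (-(b / 2)) (b / 2) ∩ Ioo (t + -r) (t + r))
        + (Ioo (-(a / 2)) (a / 2)).indicator
          (fun _ => ENNReal.ofReal ((b + 2 * r - a) / 2)) t := by
  obtain ⟨h3, h4⟩ := abs_le.1 h1
  by_cases ht : t ∈ Ioo (-(a / 2)) (a / 2)
  · rw [indicator_of_mem ht, indicator_of_mem ht, volume_Ioo_inter_Ioi_inter_Ioo,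
      volume_Ioo_inter_Iic_inter_Ioo, ← ENNReal.ofReal_add (le_max_right _ _) (le_max_right _ _)]
    congr 2
    obtain ⟨h5, h6⟩ := ht
    grind
  · rw [indicator_of_notMem ht, indicator_of_notMem ht, volume_Ioo_inter_Ioi_inter_Ioo,
      volume_Ioo_inter_Iic_inter_Ioo, ← ENNReal.ofReal_add (le_max_right _ _) (le_max_right _ _),
      volume_Ioo_inter_Ioo, zero_add, add_zero]
    congr 1
    rw [mem_Ioo, not_and_or, not_lt, not_lt] at ht
    rcases ht with ht | ht <;> grind

lemma volume_schwarz1 {B : Set ℝ} (hB : volume B ≠ ⊤) : volume (schwarz1 B) = volume B := by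
  rw [schwarz1, Real.volume_Ioo]
  rw [show (volume B).toReal / 2 - -((volume B).toReal / 2) = (volume B).toReal by ring,
    ENNReal.ofReal_toReal hB]

lemma measurableSet_schwarz1 (B : Set ℝ) : MeasurableSet (schwarz1 B) := measurableSet_Ioo

lemma volume_inter_Iic_eq_of_inter_Ioi {B : Set ℝ} (hBf : volume B ≠ ⊤) {p l : ℝ}
    (hl : 0 ≤ l) (hp : volume (B ∩ Ioi p) = ENNReal.ofReal l) :
    volume (B ∩ Iic p) = ENNReal.ofReal ((volume B).toReal - l) := by
  have h := measure_inter_add_sdiff (μ := volume) B (measurableSet_Ioi (a := p))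
  rw [sdiff_eq, compl_Ioi, hp] at h
  rw [ENNReal.ofReal_sub _ hl, ENNReal.ofReal_toReal hBf, ← h,
    ENNReal.add_sub_cancel_left ENNReal.ofReal_ne_top]

/-- The one-dimensional Riesz rearrangement inequality for two sets of finite measure and a
centred interval. -/
lemma riesz_window {A B : Set ℝ} (hA : MeasurableSet A) (hB : MeasurableSet B)
    (hAf : volume A ≠ ⊤) (hBf : volume B ≠ ⊤) (r : ℝ) :
    ∫⁻ t in A, volume (B ∩ Ioo (t + -r) (t + r))
      ≤ ∫⁻ t in schwarz1 A, volume (schwarz1 B ∩ Ioo (t + -r) (t + r)) := by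
  set a := (volume A).toReal with ha
  set b := (volume B).toReal with hb
  have ha0 : 0 ≤ a := ENNReal.toReal_nonneg
  have hb0 : 0 ≤ b := ENNReal.toReal_nonneg
  have hAs : schwarz1 A = Ioo (-(a / 2)) (a / 2) := rfl
  have hBs : schwarz1 B = Ioo (-(b / 2)) (b / 2) := rfl
  have hVA : ENNReal.ofReal a = volume A := ENNReal.ofReal_toReal hAf
  have hVB : ENNReal.ofReal b = volume B := ENNReal.ofReal_toReal hBf
  have hVAs := volume_schwarz1 hAf
  have hVBs := volume_schwarz1 hBf
  have hmA := measurableSet_schwarz1 A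
  have hmB := measurableSet_schwarz1 B
  rcases le_or_gt (b + 2 * r) a with hbig | hbig
  · calc _ ≤ ∫⁻ t, volume (B ∩ Ioo (t + -r) (t + r)) := setLIntegral_le_lintegral _ _
      _ = ∫⁻ t, volume (schwarz1 B ∩ Ioo (t + -r) (t + r)) := by
        rw [lintegral_volume_inter_window B, lintegral_volume_inter_window (schwarz1 B), hVBs]
      _ = _ := by
        rw [← lintegral_indicator hmA]
        congr 1
        ext t
        by_cases ht : t ∈ schwarz1 A
        · rw [indicator_of_mem ht]
        · rw [indicator_of_notMem ht, hBs, volume_Ioo_inter_Ioo]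
          rw [hAs, mem_Ioo, not_and_or, not_lt, not_lt] at ht
          rw [ENNReal.ofReal_eq_zero]
          rcases ht with ht | ht <;> grind
  rcases le_or_gt a |b - 2 * r| with hsmall | hsmall
  · calc _ ≤ ∫⁻ t in A, ENNReal.ofReal (min b (2 * r)) := by
          refine lintegral_mono fun t => ?_
          rw [ENNReal.ofReal_min, hVB]
          refine le_min (measure_mono inter_subset_left) ?_
          refine (measure_mono inter_subset_right).trans_eq ?_
          rw [Real.volume_Ioo]; congr 1; ring
      _ = ∫⁻ t in schwarz1 A, ENNReal.ofReal (min b (2 * r)) := by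
          rw [setLIntegral_const, setLIntegral_const, hVAs]
      _ ≤ _ := by
          refine setLIntegral_mono' hmA fun t ht => ?_
          rw [hBs, volume_Ioo_inter_Ioo]
          apply ENNReal.ofReal_le_ofReal
          obtain ⟨h1, h2⟩ := ht
          rcases le_abs.1 hsmall with h | h <;> grind
  obtain ⟨hs1, hs2⟩ := abs_lt.1 hsmall
  set l := (b + 2 * r - a) / 2 with hl
  have hl0 : 0 < l := by rw [hl]; linarith
  have hlb : l < b := by rw [hl]; linarith
  have hlr : l ≤ 2 * r := by rw [hl]; linarith
  obtain ⟨p, hp⟩ := exists_volume_inter_Ioi_eq hBf hl0 hlb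
  have hps : volume (schwarz1 B ∩ Ioi (b / 2 - l)) = ENNReal.ofReal l := by
    rw [hBs, Ioo_inter_Ioi, Real.volume_Ioo, max_eq_right (by linarith)]
    congr 1; ring
  have hq := volume_inter_Iic_eq_of_inter_Ioi hBf hl0.le hp
  have hqs := volume_inter_Iic_eq_of_inter_Ioi (hVBs.trans_ne hBf) hl0.le hps
  rw [hVBs] at hqs
  set w : Set ℝ → ℝ → ℝ → ℝ≥0∞ := fun E p t => volume ((E ∩ Ioi p) ∩ Ioo (t + -r) (t + r))
    + volume ((E ∩ Iic p) ∩ Ioo (t + (r - l)) (t + r)) with hw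
  set c : ℝ≥0∞ := ENNReal.ofReal (r - -r) * ENNReal.ofReal l
    + ENNReal.ofReal (r - (r - l)) * ENNReal.ofReal (b - l) with hc
  have hcf : c ≠ ⊤ := by
    rw [hc]; finiteness
  have hwi : ∫⁻ t, w B p t = c := by
    rw [hw, lintegral_add_left (measurable_volume_inter_window (hB.inter measurableSet_Ioi) _ _),
      lintegral_volume_inter_window, lintegral_volume_inter_window, hp, hq]
  have hwis : ∫⁻ t, w (schwarz1 B) (b / 2 - l) t = c := by
    rw [hw, lintegral_add_left (measurable_volume_inter_window (hmB.inter measurableSet_Ioi) _ _),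
      lintegral_volume_inter_window, lintegral_volume_inter_window, hps, hqs]
  have hle : (∫⁻ t in A, volume (B ∩ Ioo (t + -r) (t + r))) + c
      ≤ ENNReal.ofReal (r - -r) * volume B + ENNReal.ofReal l * volume A := by
    rw [← hwi, ← lintegral_volume_inter_window B, ← setLIntegral_const, ← lintegral_indicator hA,
      ← lintegral_indicator hA,
      ← lintegral_add_left ((measurable_volume_inter_window hB _ _).indicator hA),
      ← lintegral_add_left (measurable_volume_inter_window hB _ _)]
    refine lintegral_mono fun t => ?_
    have h := volume_window_add_le hlr hp t
    by_cases ht : t ∈ A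
    · simp only [indicator_of_mem ht]
      gcongr
      exact h.trans (min_le_right _ _)
    · simp only [indicator_of_notMem ht, zero_add, add_zero]
      exact h.trans (min_le_left _ _)
  have heq : (∫⁻ t in schwarz1 A, volume (schwarz1 B ∩ Ioo (t + -r) (t + r))) + c
      = ENNReal.ofReal (r - -r) * volume B + ENNReal.ofReal l * volume A := by
    rw [← hwis, ← hVBs, ← hVAs, ← lintegral_volume_inter_window (schwarz1 B), ← setLIntegral_const,
      ← lintegral_indicator hmA, ← lintegral_indicator hmA,
      ← lintegral_add_left ((measurable_volume_inter_window hmB _ _).indicator hmA),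
      ← lintegral_add_left (measurable_volume_inter_window hmB _ _)]
    exact lintegral_congr fun t => volume_window_add_eq hsmall.le hbig.le t
  exact (ENNReal.add_le_add_iff_right hcf).1 (hle.trans_eq heq.symm)

/-- The complementary form of `riesz_window`. -/
lemma riesz_window_compl {A B : Set ℝ} (hA : MeasurableSet A) (hB : MeasurableSet B)
    (hAf : volume A ≠ ⊤) (hBf : volume B ≠ ⊤) (r : ℝ) :
    ∫⁻ t in schwarz1 A, volume ((schwarz1 B)ᶜ ∩ Ioo (t + -r) (t + r))
      ≤ ∫⁻ t in A, volume (Bᶜ ∩ Ioo (t + -r) (t + r)) := by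
  have key : ∀ {A B : Set ℝ}, MeasurableSet B →
      (∫⁻ t in A, volume (B ∩ Ioo (t + -r) (t + r))) + ∫⁻ t in A, volume (Bᶜ ∩ Ioo (t + -r) (t + r))
        = ENNReal.ofReal (2 * r) * volume A := by
    intro A B hB
    rw [← lintegral_add_left (measurable_volume_inter_window hB _ _), ← setLIntegral_const]
    refine lintegral_congr fun t => ?_
    rw [inter_comm B, inter_comm Bᶜ, ← sdiff_eq, measure_inter_add_sdiff _ hB, Real.volume_Ioo]
    congr 1; ring
  have h1 := key (A := A) hB
  have h2 := key (A := schwarz1 A) (measurableSet_schwarz1 B)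
  rw [volume_schwarz1 hAf] at h2
  have h3 := riesz_window hA hB hAf hBf r
  have hfin : ∫⁻ t in A, volume (B ∩ Ioo (t + -r) (t + r)) ≠ ⊤ := by
    refine ne_top_of_le_ne_top ?_ (h1 ▸ le_self_add)
    finiteness
  refine (ENNReal.add_le_add_iff_left hfin).1 ?_
  rw [h1, ← h2]
  gcongr

/-- A set of reals described by an upper bound on the absolute value is the whole line or, up to
a null set, a centred interval. -/
lemma eq_univ_or_ae_eq_Ioo_of_abs_le {S : Set ℝ} (hS : ∀ x y, |x| ≤ |y| → y ∈ S → x ∈ S) :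
    S = univ ∨ ∃ r : ℝ, S =ᵐ[volume] Ioo (-r) r := by
  rcases S.eq_empty_or_nonempty with rfl | hne
  · exact Or.inr ⟨0, by simp⟩
  by_cases hbd : BddAbove (abs '' S)
  · right
    refine ⟨sSup (abs '' S), ?_⟩
    have h1 : Ioo (-sSup (abs '' S)) (sSup (abs '' S)) ⊆ S := by
      intro x hx
      obtain ⟨_, ⟨y, hy, rfl⟩, hxy⟩ := exists_lt_of_lt_csSup (hne.image _) (abs_lt.2 hx)
      exact hS x y hxy.le hy
    have h2 : S ⊆ Icc (-sSup (abs '' S)) (sSup (abs '' S)) := fun x hx =>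
      abs_le.1 (le_csSup hbd (mem_image_of_mem _ hx))
    exact (h2.eventuallyLE.trans Ioo_ae_eq_Icc.symm.le).antisymm h1.eventuallyLE
  · left
    refine eq_univ_of_forall fun x => ?_
    obtain ⟨_, ⟨y, hy, rfl⟩, hxy⟩ := not_bddAbove_iff.1 hbd |x|
    exact hS x y hxy.le hy

lemma riesz_symm_compl {A B S : Set ℝ} (hA : MeasurableSet A) (hB : MeasurableSet B)
    (hAf : volume A ≠ ⊤) (hBf : volume B ≠ ⊤) (hS : ∀ x y, |x| ≤ |y| → y ∈ S → x ∈ S) :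
    ∫⁻ t in schwarz1 A, volume ((schwarz1 B)ᶜ ∩ {s | t - s ∈ S})
      ≤ ∫⁻ t in A, volume (Bᶜ ∩ {s | t - s ∈ S}) := by
  rcases eq_univ_or_ae_eq_Ioo_of_abs_le hS with rfl | ⟨r, hr⟩
  · simp only [mem_univ, ofPred_true, inter_univ, setLIntegral_const]
    rw [volume_schwarz1 hAf, measure_compl (measurableSet_schwarz1 B)
      ((volume_schwarz1 hBf).trans_ne hBf), measure_compl hB hBf, volume_schwarz1 hBf]
  · have key : ∀ (C : Set ℝ) (t : ℝ),
        volume (C ∩ {s | t - s ∈ S}) = volume (C ∩ Ioo (t + -r) (t + r)) := by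
      intro C t
      have h1 := (Measure.measurePreserving_sub_left volume t).quasiMeasurePreserving.preimage_ae_eq hr
      have h2 : (fun s => t - s) ⁻¹' Ioo (-r) r = Ioo (t + -r) (t + r) := by
        rw [preimage_const_sub_Ioo]
        congr 1; ring
      rw [h2] at h1
      exact measure_congr ((Filter.EventuallyEq.refl _ _).inter h1)
    simp_rw [key]
    exact riesz_window_compl hA hB hAf hBf r

/-- Tonelli form of the interaction of `A` with the complement of `B`. -/
lemma lintegral_indicator_mul_indicator_sub {A B S : Set ℝ} (hA : MeasurableSet A)
    (hB : MeasurableSet B) (hS : MeasurableSet S) :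
    ∫⁻ z : ℝ × ℝ, (A.indicator 1 z.1 * Bᶜ.indicator 1 z.2) * S.indicator 1 (z.1 - z.2)
      = ∫⁻ t in A, volume (Bᶜ ∩ {s | t - s ∈ S}) := by
  have hm : Measurable fun z : ℝ × ℝ =>
      (A.indicator (1 : ℝ → ℝ≥0∞) z.1 * Bᶜ.indicator (1 : ℝ → ℝ≥0∞) z.2)
        * S.indicator (1 : ℝ → ℝ≥0∞) (z.1 - z.2) :=
    (((measurable_one.indicator hA).comp measurable_fst).mul
      ((measurable_one.indicator hB.compl).comp measurable_snd)).mul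
      ((measurable_one.indicator hS).comp (measurable_fst.sub measurable_snd))
  rw [Measure.volume_eq_prod, lintegral_prod _ hm.aemeasurable, ← lintegral_indicator hA]
  refine lintegral_congr fun t => ?_
  by_cases ht : t ∈ A
  · simp only [indicator_of_mem ht, Pi.one_apply, one_mul]
    have hm' : MeasurableSet {s | t - s ∈ S} := (measurable_const.sub measurable_id) hS
    rw [← lintegral_indicator_one (hB.compl.inter hm'), inter_indicator_one]
    rfl
  · simp [indicator_of_notMem ht]

lemma SymmDec1.measurable {κ : ℝ → ℝ} (h : SymmDec1 κ) : Measurable κ := by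
  have h1 : Antitone fun v : ℝ => κ (max v 0) := fun u v huv => by
    refine h _ _ ?_
    rw [abs_of_nonneg (le_max_right _ _), abs_of_nonneg (le_max_right _ _)]
    exact max_le_max_right 0 huv
  have h2 : κ = (fun v : ℝ => κ (max v 0)) ∘ abs := by
    ext u
    have : |max |u| 0| = |u| := by rw [max_eq_left (abs_nonneg u), abs_abs]
    exact le_antisymm (h _ _ this.le) (h _ _ this.ge)
  rw [h2]
  exact h1.measurable.comp measurable_id.abs

/-- `φ'` is, up to null sets, the symmetric decreasing rearrangement of `φ`. -/
structure IsRearrangement (φ φ' : ℝ → ℝ) : Prop where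
  measurable : Measurable φ
  nonneg : ∀ t, 0 ≤ φ t
  measurable' : Measurable φ'
  nonneg' : ∀ t, 0 ≤ φ' t
  finite : ∀ τ, 0 < τ → volume {t | τ < φ t} ≠ ⊤
  ae_eq : ∀ τ, 0 < τ → {t | τ < φ' t} =ᵐ[volume] schwarz1 {t | τ < φ t}

/-- Layer-cake expansion of the positive part of the interaction energy. -/
lemma lintegral_hinge_mul_eq {φ ψ κ : ℝ → ℝ} (hφ : Measurable φ) (hψ : Measurable ψ)
    (hψ0 : ∀ t, 0 ≤ ψ t) (hκ : Measurable κ) (μ : Measure ℝ) [SFinite μ] :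
    ∫⁻ z : ℝ × ℝ, (∫⁻ r, ENNReal.ofReal (φ z.1 - ψ z.2 - r) ∂μ) * ENNReal.ofReal (κ (z.1 - z.2))
      = ∫⁻ w : ℝ × ℝ × ℝ, (∫⁻ t in {t | w.2.1 + w.1 < φ t},
          volume ({t | w.2.1 < ψ t}ᶜ ∩ {s | t - s ∈ {u | w.2.2 < κ u}}))
          ∂(μ.prod ((volume.restrict (Ioi 0)).prod (volume.restrict (Ioi 0)))) := by
  set G : ℝ × ℝ → ℝ × ℝ × ℝ → ℝ≥0∞ := fun z w =>
    ({t | w.2.1 + w.1 < φ t}.indicator 1 z.1 * {t | w.2.1 < ψ t}ᶜ.indicator 1 z.2)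
      * {u | w.2.2 < κ u}.indicator 1 (z.1 - z.2) with hG
  have hGm : Measurable (Function.uncurry G) := by
    have m1 : MeasurableSet {q : (ℝ × ℝ) × ℝ × ℝ × ℝ | q.2.2.1 + q.2.1 < φ q.1.1} :=
      measurableSet_lt (by fun_prop) (by fun_prop)
    have m2 : MeasurableSet {q : (ℝ × ℝ) × ℝ × ℝ × ℝ | q.2.2.1 < ψ q.1.2}ᶜ :=
      (measurableSet_lt (by fun_prop) (by fun_prop)).compl
    have m3 : MeasurableSet {q : (ℝ × ℝ) × ℝ × ℝ × ℝ | q.2.2.2 < κ (q.1.1 - q.1.2)} :=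
      measurableSet_lt (by fun_prop) (by fun_prop)
    exact ((measurable_one.indicator m1).mul (measurable_one.indicator m2)).mul
      (measurable_one.indicator m3)
  have hL : ∀ z : ℝ × ℝ, (∫⁻ r, ENNReal.ofReal (φ z.1 - ψ z.2 - r) ∂μ)
      * ENNReal.ofReal (κ (z.1 - z.2))
      = ∫⁻ w, G z w ∂(μ.prod ((volume.restrict (Ioi 0)).prod (volume.restrict (Ioi 0)))) := by
    intro z
    have hGz : Measurable (G z) := hGm.comp measurable_prodMk_left
    have hτ : ∀ r, ∫⁻ τ in Ioi (0 : ℝ), ({τ | τ + r < φ z.1}.indicator (1 : ℝ → ℝ≥0∞) τ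
        * {τ | τ < ψ z.2}ᶜ.indicator 1 τ) = ENNReal.ofReal (φ z.1 - ψ z.2 - r) := by
      intro r
      have : ∀ τ, ({τ | τ + r < φ z.1}.indicator (1 : ℝ → ℝ≥0∞) τ
          * {τ | τ < ψ z.2}ᶜ.indicator 1 τ) = (Ico (ψ z.2) (φ z.1 - r)).indicator 1 τ := by
        intro τ
        simp only [indicator, mem_ofPred_eq, mem_compl_iff, mem_Ico, not_lt, Pi.one_apply,
          lt_sub_iff_add_lt]
        split_ifs <;> simp_all
      simp_rw [this]
      rw [lintegral_indicator_one measurableSet_Ico, Measure.restrict_apply measurableSet_Ico,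
        measure_congr ((Filter.EventuallyEq.refl _ _).inter Ioi_ae_eq_Ici), inter_eq_left.2,
        Real.volume_Ico]
      · congr 1; ring
      · exact fun x hx => (hψ0 _).trans hx.1
    have hc : ∫⁻ c in Ioi (0 : ℝ), (Iio (κ (z.1 - z.2))).indicator (1 : ℝ → ℝ≥0∞) c
        = ENNReal.ofReal (κ (z.1 - z.2)) := by
      rw [lintegral_indicator_one measurableSet_Iio, Measure.restrict_apply measurableSet_Iio,
        Iio_inter_Ioi, Real.volume_Ioo, sub_zero]
    rw [lintegral_prod _ hGz.aemeasurable, ← hc, ← lintegral_mul_const]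
    · refine lintegral_congr fun r => ?_
      rw [← hτ r, ← lintegral_prod_mul]
      · rfl
      · refine Measurable.aemeasurable ?_
        refine (measurable_one.indicator ?_).mul (measurable_one.indicator ?_)
        · exact measurableSet_lt (by fun_prop) (by fun_prop)
        · exact measurableSet_Iio.compl
      · exact (measurable_one.indicator measurableSet_Iio).aemeasurable
    · fun_prop
  simp_rw [hL]
  rw [lintegral_lintegral_swap hGm.aemeasurable]
  refine lintegral_congr fun w => ?_
  exact lintegral_indicator_mul_indicator_sub (measurableSet_lt measurable_const hφ)
    (measurableSet_lt measurable_const hψ) (measurableSet_lt measurable_const hκ)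

lemma lintegral_hinge_mul_le {φ φ' ψ ψ' κ : ℝ → ℝ} (hφ : IsRearrangement φ φ')
    (hψ : IsRearrangement ψ ψ') (hκ : SymmDec1 κ) (μ : Measure ℝ) [SFinite μ]
    (hμ : ∀ᵐ r ∂μ, 0 ≤ r) :
    ∫⁻ z : ℝ × ℝ, (∫⁻ r, ENNReal.ofReal (φ' z.1 - ψ' z.2 - r) ∂μ)
        * ENNReal.ofReal (κ (z.1 - z.2))
      ≤ ∫⁻ z : ℝ × ℝ, (∫⁻ r, ENNReal.ofReal (φ z.1 - ψ z.2 - r) ∂μ)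
        * ENNReal.ofReal (κ (z.1 - z.2)) := by
  rw [lintegral_hinge_mul_eq hφ.measurable hψ.measurable hψ.nonneg hκ.measurable,
    lintegral_hinge_mul_eq hφ.measurable' hψ.measurable' hψ.nonneg' hκ.measurable]
  have h1 : ∀ᵐ w ∂(μ.prod ((volume.restrict (Ioi (0 : ℝ))).prod (volume.restrict (Ioi (0 : ℝ))))),
      0 ≤ w.1 := Measure.quasiMeasurePreserving_fst.ae hμ
  have h2 : ∀ᵐ w ∂(μ.prod ((volume.restrict (Ioi (0 : ℝ))).prod (volume.restrict (Ioi (0 : ℝ))))),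
      0 < w.2.1 := Measure.quasiMeasurePreserving_snd.ae
        (Measure.quasiMeasurePreserving_fst.ae (ae_restrict_mem measurableSet_Ioi))
  refine lintegral_mono_ae ?_
  filter_upwards [h1, h2] with w hr hτ
  have hA := hφ.ae_eq (w.2.1 + w.1) (by linarith)
  have hB := hψ.ae_eq w.2.1 hτ
  rw [setLIntegral_congr hA]
  have hB' : ∀ C : Set ℝ, volume ({t | w.2.1 < ψ' t}ᶜ ∩ C)
      = volume ((schwarz1 {t | w.2.1 < ψ t})ᶜ ∩ C) := fun C =>
    measure_congr (hB.compl.inter (Filter.EventuallyEq.refl _ _))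
  simp_rw [hB']
  exact riesz_symm_compl (measurableSet_lt measurable_const hφ.measurable)
    (measurableSet_lt measurable_const hψ.measurable) (hφ.finite _ (by linarith))
    (hψ.finite _ hτ) fun x y hxy hy => lt_of_lt_of_le hy (hκ _ _ hxy)

/-- A non-negative convex function vanishing at the origin is, on the positive half-line, a
superposition of hinge functions. -/
lemma exists_measure_hinge {J : ℝ → ℝ} (hJc : ConvexOn ℝ univ J) (hJnn : ∀ t, 0 ≤ J t)
    (hJ0 : J 0 = 0) : ∃ μ : Measure ℝ, SFinite μ ∧ (∀ᵐ r ∂μ, 0 ≤ r) ∧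
      ∀ u, 0 ≤ u → ENNReal.ofReal (J u) = ∫⁻ r, ENNReal.ofReal (u - r) ∂μ := by
  have hmono : Monotone fun x => derivWithin J (Ioi x) x := by
    have := hJc.monotoneOn_rightDeriv
    rwa [interior_univ, monotoneOn_univ] at this
  have hd0 : 0 ≤ derivWithin J (Ioi 0) 0 := by
    rw [hJc.rightDeriv_eq_sInf_slope_of_mem_interior (by simp)]
    refine Real.sInf_nonneg ?_
    rintro _ ⟨y, ⟨-, hy⟩, rfl⟩
    rw [slope_def_field, hJ0]
    have := hJnn y
    positivity
  set j : ℝ → ℝ := fun v => if v < 0 then 0 else derivWithin J (Ioi v) v with hj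
  have hjnn : ∀ v, 0 ≤ j v := by
    intro v
    simp only [hj]
    split_ifs with h
    · exact le_rfl
    · exact hd0.trans (hmono (not_lt.1 h))
  have hjm : Monotone j := by
    intro u v huv
    by_cases hu : u < 0
    · rw [show j u = 0 from if_pos hu]; exact hjnn v
    · rw [show j u = _ from if_neg hu, show j v = _ from if_neg (by linarith)]
      exact hmono huv
  set F := hjm.stieltjesFunction with hF
  have hFneg : ∀ v, v < 0 → F v = 0 := by
    intro v hv
    refine le_antisymm ?_ ?_
    · have := hjm.rightLim_le (show v < v / 2 by linarith)
      rwa [show j (v / 2) = 0 from if_pos (by linarith)] at this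
    · exact (hjnn v).trans (hjm.le_rightLim le_rfl)
  have hFbot : Filter.Tendsto F Filter.atBot (nhds 0) :=
    tendsto_const_nhds.congr' (by
      filter_upwards [Filter.eventually_lt_atBot 0] with v hv using (hFneg v hv).symm)
  have hFj : ∀ᵐ v, F v = j v := by
    filter_upwards [hjm.countable_not_continuousAt.ae_notMem volume] with v hv
    simp only [not_not] at hv
    exact hv.continuousWithinAt.rightLim_eq
  have hpos : ∀ᵐ r ∂F.measure, 0 ≤ r := by
    rw [ae_iff]
    have : {r : ℝ | ¬ 0 ≤ r} = Iio 0 := by ext; simp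
    rw [this, F.measure_Iio hFbot, sub_zero, ENNReal.ofReal_eq_zero]
    refine (leftLim_eq_of_tendsto ?_).le
    refine tendsto_const_nhds.congr' ?_
    filter_upwards [self_mem_nhdsWithin] with v hv using (hFneg v hv).symm
  refine ⟨F.measure, inferInstance, hpos, ?_⟩
  · intro u hu
    have hFTC : ∫ y in (0 : ℝ)..u, j y = J u - J 0 := by
      refine intervalIntegral.integral_eq_sub_of_hasDeriv_right_of_le hu ?_ ?_
        hjm.intervalIntegrable
      · exact (hJc.continuousOn isOpen_univ).mono (subset_univ _)
      · intro x hx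
        rw [show j x = _ from if_neg (by linarith [hx.1])]
        exact hJc.hasDerivWithinAt_rightDeriv_of_mem_interior (by simp)
    rw [hJ0, sub_zero, intervalIntegral.integral_of_le hu] at hFTC
    rw [← hFTC, ofReal_integral_eq_lintegral_ofReal
      ((intervalIntegrable_iff_integrableOn_Ioc_of_le hu).1 hjm.intervalIntegrable)
      (Filter.Eventually.of_forall hjnn)]
    have h1 : ∫⁻ v in Ioc 0 u, ENNReal.ofReal (j v)
        = ∫⁻ v in Ioc 0 u, ∫⁻ r, (Iic v).indicator 1 r ∂F.measure := by
      refine lintegral_congr_ae ?_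
      filter_upwards [ae_restrict_of_ae hFj] with v hv
      rw [lintegral_indicator_one measurableSet_Iic, F.measure_Iic hFbot, hv, sub_zero]
    rw [h1, lintegral_lintegral_swap]
    · refine lintegral_congr_ae ?_
      filter_upwards [hpos] with r hr
      have h2 : ∀ v : ℝ, (Iic v).indicator (1 : ℝ → ℝ≥0∞) r = (Ici r).indicator 1 v := by
        intro v
        simp [indicator_apply]
      simp only [h2]
      rw [lintegral_indicator_one measurableSet_Ici, Measure.restrict_apply measurableSet_Ici,
        measure_congr ((ae_eq_refl (Ici r)).inter (Ioc_ae_eq_Icc (a := (0 : ℝ)) (b := u))),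
        show Ici r ∩ Icc 0 u = Icc r u by
          ext v
          simp only [mem_inter_iff, mem_Ici, mem_Icc]
          exact ⟨fun h => ⟨h.1, h.2.2⟩, fun h => ⟨h.1, hr.trans h.1, h.2⟩⟩, Real.volume_Icc]
    · have h2 : Function.uncurry (fun v r : ℝ => (Iic v).indicator (1 : ℝ → ℝ≥0∞) r)
          = {z : ℝ × ℝ | z.2 ≤ z.1}.indicator 1 := by
        ext z
        simp [Function.uncurry, indicator_apply]
      exact (h2 ▸ measurable_one.indicator
        (measurableSet_le measurable_snd measurable_fst)).aemeasurable

/-- The Riesz-type rearrangement inequality on the line for convex interactions. -/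
lemma lintegral_convex_mul_le {φ φ' ψ ψ' κ J : ℝ → ℝ} (hφ : IsRearrangement φ φ')
    (hψ : IsRearrangement ψ ψ') (hκ : SymmDec1 κ) (hJc : ConvexOn ℝ univ J)
    (hJnn : ∀ t, 0 ≤ J t) (hJ0 : J 0 = 0) :
    ∫⁻ z : ℝ × ℝ, ENNReal.ofReal (J (φ' z.1 - ψ' z.2) * κ (z.1 - z.2))
      ≤ ∫⁻ z : ℝ × ℝ, ENNReal.ofReal (J (φ z.1 - ψ z.2) * κ (z.1 - z.2)) := by
  obtain ⟨μ, _, hμ, hμJ⟩ := exists_measure_hinge hJc hJnn hJ0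
  have hJc' : ConvexOn ℝ univ fun u => J (-u) :=
    hJc.comp_linearMap (-LinearMap.id : ℝ →ₗ[ℝ] ℝ)
  obtain ⟨ν, _, hν, hνJ⟩ := exists_measure_hinge hJc' (fun t => hJnn (-t)) (by simpa using hJ0)
  have hzero : ∀ (ρ : Measure ℝ), (∀ᵐ r ∂ρ, 0 ≤ r) → ∀ u ≤ 0,
      ∫⁻ r, ENNReal.ofReal (u - r) ∂ρ = 0 := by
    intro ρ hρ u hu
    rw [lintegral_congr_ae (g := fun _ => 0), lintegral_zero]
    filter_upwards [hρ] with r hr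
    exact ENNReal.ofReal_of_nonpos (by linarith)
  have hJ : ∀ a b : ℝ, ENNReal.ofReal (J (a - b))
      = (∫⁻ r, ENNReal.ofReal (a - b - r) ∂μ) + ∫⁻ r, ENNReal.ofReal (b - a - r) ∂ν := by
    intro a b
    rcases le_total b a with h | h
    · rw [hμJ _ (sub_nonneg.2 h), hzero ν hν _ (sub_nonpos.2 h), add_zero]
    · rw [hzero μ hμ _ (sub_nonpos.2 h), zero_add, ← hνJ _ (sub_nonneg.2 h), neg_sub]
  have hmeas : ∀ {φ ψ : ℝ → ℝ}, Measurable φ → Measurable ψ →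
      Measurable fun z : ℝ × ℝ => (∫⁻ r, ENNReal.ofReal (φ z.1 - ψ z.2 - r) ∂μ)
        * ENNReal.ofReal (κ (z.1 - z.2)) := by
    intro φ ψ hφ hψ
    refine Measurable.mul ?_
      (hκ.measurable.comp (measurable_fst.sub measurable_snd)).ennreal_ofReal
    refine Measurable.lintegral_prod_right' (f := fun p : (ℝ × ℝ) × ℝ =>
      ENNReal.ofReal (φ p.1.1 - ψ p.1.2 - p.2)) ?_
    fun_prop
  have hsplit : ∀ {φ ψ : ℝ → ℝ}, Measurable φ → Measurable ψ →
      ∫⁻ z : ℝ × ℝ, ENNReal.ofReal (J (φ z.1 - ψ z.2) * κ (z.1 - z.2))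
        = (∫⁻ z : ℝ × ℝ, (∫⁻ r, ENNReal.ofReal (φ z.1 - ψ z.2 - r) ∂μ)
            * ENNReal.ofReal (κ (z.1 - z.2)))
          + ∫⁻ z : ℝ × ℝ, (∫⁻ r, ENNReal.ofReal (ψ z.1 - φ z.2 - r) ∂ν)
            * ENNReal.ofReal (κ (z.1 - z.2)) := by
    intro φ ψ hφ hψ
    have hswap : ∫⁻ z : ℝ × ℝ, (∫⁻ r, ENNReal.ofReal (ψ z.1 - φ z.2 - r) ∂ν)
            * ENNReal.ofReal (κ (z.1 - z.2))
        = ∫⁻ z : ℝ × ℝ, (∫⁻ r, ENNReal.ofReal (ψ z.2 - φ z.1 - r) ∂ν)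
            * ENNReal.ofReal (κ (z.1 - z.2)) := by
      rw [Measure.volume_eq_prod, ← lintegral_prod_swap]
      refine lintegral_congr fun z => ?_
      simp only [Prod.fst_swap, Prod.snd_swap]
      rw [le_antisymm (hκ (z.1 - z.2) (z.2 - z.1) (abs_sub_comm _ _).le)
        (hκ (z.2 - z.1) (z.1 - z.2) (abs_sub_comm _ _).le)]
    rw [hswap, ← lintegral_add_left (hmeas hφ hψ)]
    refine lintegral_congr fun z => ?_
    rw [ENNReal.ofReal_mul (hJnn _), hJ, add_mul]
  rw [hsplit hφ.measurable hψ.measurable, hsplit hφ.measurable' hψ.measurable']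
  exact add_le_add (lintegral_hinge_mul_le hφ hψ hκ μ hμ) (lintegral_hinge_mul_le hψ hφ hκ ν hν)

lemma mem_schwarz1_iff {B : Set ℝ} (hB : volume B ≠ ⊤) {t : ℝ} :
    t ∈ schwarz1 B ↔ ENNReal.ofReal (2 * |t|) < volume B := by
  rw [schwarz1, mem_Ioo, ← abs_lt, ENNReal.ofReal_lt_iff_lt_toReal (by positivity) hB]
  constructor <;> intro h <;> linarith

/-- Off the hyperplane `{xₙ = 0}`, the superlevel sets of the Steiner symmetrization are determined
by the measures of the one-dimensional superlevel sets of the function. -/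
lemma lt_steinerFn_iff {m : ℕ} {f : Vm m → ℝ} {x' : Rm m} (hm : Measurable fun t => f (x', t))
    (hfin : ∀ τ : ℝ, 0 < τ → volume {t : ℝ | τ < f (x', t)} < ⊤) {c : ℝ} (hc : 0 ≤ c)
    {t : ℝ} (ht : t ≠ 0) :
    c < steinerFn f (x', t) ↔ ENNReal.ofReal (2 * |t|) < volume {s : ℝ | c < f (x', s)} := by
  have hmem : ∀ τ : ℝ, τ ∈ {τ : ℝ | 0 < τ ∧ t ∈ schwarz1 {s : ℝ | τ < f (x', s)}} ↔
      0 < τ ∧ ENNReal.ofReal (2 * |t|) < volume {s : ℝ | τ < f (x', s)} := fun τ =>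
    and_congr_right fun hτ => mem_schwarz1_iff (hfin τ hτ).ne
  unfold steinerFn
  constructor
  · intro h
    have hne : {τ : ℝ | 0 < τ ∧ t ∈ schwarz1 {s : ℝ | τ < f (x', s)}}.Nonempty := by
      by_contra hne
      rw [not_nonempty_iff_eq_empty] at hne
      rw [hne, Real.sSup_empty] at h
      exact absurd h hc.not_gt
    obtain ⟨τ, hτ, hcτ⟩ := exists_lt_of_lt_csSup hne h
    exact ((hmem τ).1 hτ).2.trans_le (measure_mono fun s hs => hcτ.trans hs)
  · intro h
    have hbdd : BddAbove {τ : ℝ | 0 < τ ∧ t ∈ schwarz1 {s : ℝ | τ < f (x', s)}} := by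
      have hlim := tendsto_measure_iInter_atTop (μ := volume)
        (s := fun n : ℕ => {s : ℝ | (n : ℝ) < f (x', s)})
        (fun n => (measurableSet_lt measurable_const hm).nullMeasurableSet)
        (fun a b hab s hs => (Nat.cast_le.2 hab : (a : ℝ) ≤ b).trans_lt hs)
        ⟨1, by simpa using (hfin 1 one_pos).ne⟩
      have hempty : ⋂ n : ℕ, {s : ℝ | (n : ℝ) < f (x', s)} = ∅ := by
        refine eq_empty_of_forall_notMem fun s hs => ?_
        obtain ⟨n, hn⟩ := exists_nat_ge (f (x', s))
        exact absurd (mem_iInter.1 hs n) hn.not_gt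
      rw [hempty, measure_empty] at hlim
      have hpos : (0 : ℝ≥0∞) < ENNReal.ofReal (2 * |t|) := by
        rw [ENNReal.ofReal_pos]; positivity
      obtain ⟨n, hn⟩ := (hlim.eventually (gt_mem_nhds hpos)).exists
      refine ⟨n, fun τ hτ => le_of_not_gt fun hlt => ?_⟩
      exact absurd (((hmem τ).1 hτ).2.trans_le (measure_mono fun s hs => hlt.trans hs)) hn.not_gt
    have hUnion : {s : ℝ | c < f (x', s)}
        = ⋃ n : ℕ, {s : ℝ | c + 1 / ((n : ℝ) + 1) < f (x', s)} := by
      ext s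
      simp only [mem_iUnion, mem_ofPred_eq]
      constructor
      · intro hs
        obtain ⟨n, hn⟩ := exists_nat_one_div_lt (sub_pos.2 hs)
        exact ⟨n, by linarith⟩
      · rintro ⟨n, hn⟩
        have : 0 < 1 / ((n : ℝ) + 1) := Nat.one_div_pos_of_nat
        linarith
    have hmono : Monotone fun n : ℕ => {s : ℝ | c + 1 / ((n : ℝ) + 1) < f (x', s)} := by
      intro a b hab s hs
      have : 1 / ((b : ℝ) + 1) ≤ 1 / ((a : ℝ) + 1) := Nat.one_div_le_one_div hab
      simp only [mem_ofPred_eq] at hs ⊢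
      linarith
    rw [hUnion, hmono.measure_iUnion, lt_iSup_iff] at h
    obtain ⟨n, hn⟩ := h
    have hn0 : 0 < 1 / ((n : ℝ) + 1) := Nat.one_div_pos_of_nat
    have := le_csSup hbdd ((hmem (c + 1 / ((n : ℝ) + 1))).2 ⟨by linarith, hn⟩)
    linarith

lemma steinerFn_nonneg {m : ℕ} (f : Vm m → ℝ) (p : Vm m) : 0 ≤ steinerFn f p :=
  Real.sSup_nonneg fun _ hτ => hτ.1.le

lemma isRearrangement_steinerFn {m : ℕ} {f : Vm m → ℝ} (hf : Measurable f) (hfnn : ∀ x, 0 ≤ f x)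
    {x' : Rm m} (hfin : ∀ τ : ℝ, 0 < τ → volume {t : ℝ | τ < f (x', t)} < ⊤) :
    IsRearrangement (fun t => f (x', t)) (fun t => steinerFn f (x', t)) where
  measurable := hf.comp measurable_prodMk_left
  nonneg t := hfnn _
  measurable' := by
    refine measurable_of_Ioi fun c => ?_
    rcases lt_or_ge c 0 with hc | hc
    · convert MeasurableSet.univ
      exact eq_univ_of_forall fun t => hc.trans_le (steinerFn_nonneg f _)
    · have hV : MeasurableSet
          {t : ℝ | ENNReal.ofReal (2 * |t|) < volume {s : ℝ | c < f (x', s)}} :=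
        measurableSet_lt (by fun_prop) measurable_const
      have h0 : ((fun t => steinerFn f (x', t)) ⁻¹' Ioi c)
          = ((fun t => steinerFn f (x', t)) ⁻¹' Ioi c) ∩ {0}
            ∪ {t : ℝ | ENNReal.ofReal (2 * |t|) < volume {s : ℝ | c < f (x', s)}} \ {0} := by
        ext t
        have ht := lt_steinerFn_iff (hf.comp measurable_prodMk_left) hfin hc (t := t)
        by_cases h : t = 0
        · simp [h]
        · simp [h, ht h]
      rw [h0]
      exact ((finite_singleton (0 : ℝ)).subset inter_subset_right).measurableSet.union
        (hV.diff (measurableSet_singleton 0))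
  nonneg' t := steinerFn_nonneg f _
  finite τ hτ := (hfin τ hτ).ne
  ae_eq τ hτ := by
    filter_upwards [Measure.ae_ne volume (0 : ℝ)] with t ht
    refine propext ?_
    exact (lt_steinerFn_iff (hf.comp measurable_prodMk_left) hfin hτ.le ht).trans
      (mem_schwarz1_iff (hfin τ hτ).ne).symm

lemma aemeasurable_steinerFn {m : ℕ} {f : Vm m → ℝ} (hf : Measurable f)
    (hfin : ∀ᵐ x' : Rm m, ∀ τ : ℝ, 0 < τ → volume {t : ℝ | τ < f (x', t)} < ⊤) :
    AEMeasurable (steinerFn f) := by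
  refine NullMeasurable.aemeasurable
    (measurable_of_Ioi (δ := NullMeasurableSpace (Vm m) volume) fun c => ?_)
  change NullMeasurableSet {p | c < steinerFn f p}
  rcases lt_or_ge c 0 with hc | hc
  · convert nullMeasurableSet_univ
    exact eq_univ_of_forall fun t => hc.trans_le (steinerFn_nonneg f _)
  · have hV : MeasurableSet
        {p : Vm m | ENNReal.ofReal (2 * |p.2|) < volume {s : ℝ | c < f (p.1, s)}} := by
      refine measurableSet_lt (by fun_prop) ?_
      exact (measurable_measure_prodMk_left (ν := volume)
        (measurableSet_lt measurable_const hf : MeasurableSet {p : Vm m | c < f p})).comp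
          measurable_fst
    refine hV.nullMeasurableSet.congr ?_
    have h1 : ∀ᵐ p : Vm m, ∀ τ : ℝ, 0 < τ → volume {t : ℝ | τ < f (p.1, t)} < ⊤ :=
      Measure.quasiMeasurePreserving_fst.ae hfin
    have h2 : ∀ᵐ p : Vm m, p.2 ≠ 0 :=
      Measure.quasiMeasurePreserving_snd.ae (Measure.ae_ne volume (0 : ℝ))
    filter_upwards [h1, h2] with p hp hp0
    exact propext (lt_steinerFn_iff (hf.comp measurable_prodMk_left) hp hc hp0).symm

/-- Exchanging the two inner factors of a fourfold product preserves the product measure. -/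
lemma measurePreserving_prodProdProdComm {α β γ δ : Type*} [MeasureSpace α] [MeasureSpace β]
    [MeasureSpace γ] [MeasureSpace δ] [SFinite (volume : Measure α)] [SFinite (volume : Measure β)]
    [SFinite (volume : Measure γ)] [SFinite (volume : Measure δ)] :
    MeasurePreserving (Equiv.prodProdProdComm α β γ δ) := by
  have h1 : MeasurePreserving (MeasurableEquiv.prodAssoc : (α × β) × (γ × δ) ≃ᵐ _) :=
    volume_preserving_prodAssoc
  have h2 : MeasurePreserving (MeasurableEquiv.prodAssoc : (β × γ) × δ ≃ᵐ _) :=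
    volume_preserving_prodAssoc
  have h3 : MeasurePreserving (MeasurableEquiv.prodAssoc : (γ × β) × δ ≃ᵐ _) :=
    volume_preserving_prodAssoc
  have h4 : MeasurePreserving (MeasurableEquiv.prodAssoc : (α × γ) × (β × δ) ≃ᵐ _) :=
    volume_preserving_prodAssoc
  have h5 : MeasurePreserving (Prod.swap : β × γ → γ × β) := Measure.measurePreserving_swap
  have h6 : MeasurePreserving (Prod.map Prod.swap id : (β × γ) × δ → (γ × β) × δ) :=
    h5.prod (.id volume)
  exact (h4.symm).comp (((MeasurePreserving.id volume).prod
    (h3.comp (h6.comp h2.symm))).comp h1)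

lemma aemeasurable_energy_integrand {m : ℕ} {J : ℝ → ℝ} (hJ : Continuous J) {k f g : Vm m → ℝ}
    (hk : AEMeasurable k) (hf : AEMeasurable f) (hg : AEMeasurable g) :
    AEMeasurable fun z : Vm m × Vm m =>
      ENNReal.ofReal (J (f z.1 - g z.2) * k (z.1 - z.2)) := by
  have hf' : AEMeasurable fun z : Vm m × Vm m => f z.1 :=
    hf.comp_quasiMeasurePreserving Measure.quasiMeasurePreserving_fst
  have hg' : AEMeasurable fun z : Vm m × Vm m => g z.2 :=
    hg.comp_quasiMeasurePreserving Measure.quasiMeasurePreserving_snd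
  have : (volume : Measure (Vm m)).IsAddRightInvariant :=
    inferInstanceAs ((volume : Measure (Rm m)).prod (volume : Measure ℝ)).IsAddRightInvariant
  have hk' : AEMeasurable fun z : Vm m × Vm m => k (z.1 - z.2) :=
    hk.comp_quasiMeasurePreserving (quasiMeasurePreserving_sub_of_right_invariant volume volume)
  exact ((hJ.measurable.comp_aemeasurable (hf'.sub hg')).mul hk').ennreal_ofReal

/-- The energy as an iterated integral, with the last coordinates integrated first. -/
lemma energy_eq_lintegral_sections {m : ℕ} {J : ℝ → ℝ} (hJ : Continuous J) {k f g : Vm m → ℝ}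
    (hk : AEMeasurable k) (hf : AEMeasurable f) (hg : AEMeasurable g) :
    energy J k f g = ∫⁻ w : Rm m × Rm m, ∫⁻ z : ℝ × ℝ,
      ENNReal.ofReal (J (f (w.1, z.1) - g (w.2, z.2)) * k (w.1 - w.2, z.1 - z.2)) := by
  have hmeas := aemeasurable_energy_integrand hJ hk hf hg
  have hT : MeasurePreserving (Equiv.prodProdProdComm (Rm m) (Rm m) ℝ ℝ) :=
    measurePreserving_prodProdProdComm
  have h1 : energy J k f g = ∫⁻ z : Vm m × Vm m,
      ENNReal.ofReal (J (f z.1 - g z.2) * k (z.1 - z.2)) := (lintegral_prod _ hmeas).symm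
  rw [h1, ← hT.map_eq, lintegral_map' (hT.map_eq.symm ▸ hmeas) hT.aemeasurable]
  exact lintegral_prod _ (hmeas.comp_quasiMeasurePreserving hT.quasiMeasurePreserving)

/-- **Corollary 3.5(1).** If every section `k_{x′}` of the kernel is symmetric decreasing
on `ℝ`, the energy functional does not increase under Steiner symmetrization. -/
theorem energy_steiner_inequality
    (m : ℕ)
    (J : ℝ → ℝ) (hJc : ConvexOn ℝ Set.univ J) (hJnn : ∀ t, 0 ≤ J t) (hJ0 : J 0 = 0)
    (k : Vm m → ℝ) (hki : Integrable k volume) (hknn : ∀ x, 0 ≤ k x)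
    (hksd : ∀ x' : Rm m, SymmDec1 (fun t => k (x', t)))
    (f g : Vm m → ℝ) (hfm : Measurable f) (hgm : Measurable g)
    (hfnn : ∀ x, 0 ≤ f x) (hgnn : ∀ x, 0 ≤ g x)
    (hfl : ∀ᵐ x' : Rm m ∂volume, ∀ τ : ℝ, 0 < τ → volume {t : ℝ | τ < f (x', t)} < ⊤)
    (hgl : ∀ᵐ x' : Rm m ∂volume, ∀ τ : ℝ, 0 < τ → volume {t : ℝ | τ < g (x', t)} < ⊤) :
    energy J k (steinerFn f) (steinerFn g) ≤ energy J k f g := by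
  have hJ : Continuous J := continuousOn_univ.1 (hJc.continuousOn isOpen_univ)
  rw [energy_eq_lintegral_sections hJ hki.aemeasurable hfm.aemeasurable hgm.aemeasurable,
    energy_eq_lintegral_sections hJ hki.aemeasurable (aemeasurable_steinerFn hfm hfl)
      (aemeasurable_steinerFn hgm hgl)]
  have h1 : ∀ᵐ w : Rm m × Rm m, ∀ τ : ℝ, 0 < τ → volume {t : ℝ | τ < f (w.1, t)} < ⊤ :=
    Measure.quasiMeasurePreserving_fst.ae hfl
  have h2 : ∀ᵐ w : Rm m × Rm m, ∀ τ : ℝ, 0 < τ → volume {t : ℝ | τ < g (w.2, t)} < ⊤ :=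
    Measure.quasiMeasurePreserving_snd.ae hgl
  refine lintegral_mono_ae ?_
  filter_upwards [h1, h2] with w hw1 hw2
  exact lintegral_convex_mul_le (isRearrangement_steinerFn hfm hfnn hw1)
    (isRearrangement_steinerFn hgm hgnn hw2) (hksd (w.1 - w.2)) hJc hJnn hJ0
end
end

section
/- Let E ⊆ ℝⁿ be a Borel set such that for almost every x′ ∈ ℝ^{n−1} the section E_{x′} = {y ∈ ℝ : (x′,y) ∈ E} is equivalent to an interval. Then the set E^{(1)} of points of density one of E has the property that for every x′ ∈ ℝ^{n−1} the section (E^{(1)})_{x′} is an interval. -/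
open MeasureTheory Set Bornology ENNReal Pointwise

noncomputable section

/-- The set `E^{(1)}` of points of density one of `E`, using Euclidean balls in
`ℝⁿ = ℝ^{n-1} × ℝ`. -/
noncomputable def densityOne {m : ℕ} (E : Set (Vm m)) : Set (Vm m) :=
  {x | Filter.Tendsto
        (fun r : ℝ => volume (E ∩ {y | prodEnorm (y - x) < r}) / volume {y | prodEnorm (y - x) < r})
        (nhdsWithin 0 (Set.Ioi 0)) (nhds 1)}

/-- If `S` is equivalent to an interval and `C` lies between `A` and `B`, all three of the same
measure, then the part of `C` missed by `S` is controlled by the parts of `A` and `B` it misses. -/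
lemma measure_diff_le_of_ordConnected {S I A B C : Set ℝ} (hI : I.OrdConnected)
    (hSI : volume (symmDiff S I) = 0) (hCA : volume C = volume A) (hCB : volume C = volume B)
    (hAC : ∀ s ∈ A, ∀ t ∈ C, s ≤ t) (hBC : ∀ t ∈ C, ∀ s ∈ B, t ≤ s) :
    volume (C \ S) ≤ volume (A \ S) + volume (B \ S) := by
  have miss : ∀ D : Set ℝ, volume C = volume D → ¬ (D ∩ I).Nonempty →
      volume (C \ S) ≤ volume (D \ S) := fun D hD hne => by
    calc volume (C \ S) ≤ volume C := measure_mono sdiff_subset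
      _ = volume D := hD
      _ ≤ volume ((D \ S) ∪ symmDiff S I) := measure_mono fun t ht => by
          by_cases hS : t ∈ S
          · exact Or.inr (Or.inl ⟨hS, fun hi => hne ⟨t, ht, hi⟩⟩)
          · exact Or.inl ⟨ht, hS⟩
      _ ≤ volume (D \ S) + volume (symmDiff S I) := measure_union_le _ _
      _ = volume (D \ S) := by rw [hSI, add_zero]
  by_cases hA : (A ∩ I).Nonempty
  · by_cases hB : (B ∩ I).Nonempty
    · obtain ⟨a, haA, haI⟩ := hA
      obtain ⟨b, hbB, hbI⟩ := hB
      have hnull : volume (C \ S) = 0 := measure_mono_null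
        (fun t ht => Or.inr ⟨hI.out haI hbI ⟨hAC a haA t ht.1, hBC t ht.1 b hbB⟩, ht.2⟩) hSI
      rw [hnull]
      exact zero_le
    · exact (miss B hCB hB).trans le_add_self
  · exact (miss A hCA hA).trans le_self_add

/-- The Euclidean ball of radius `r` around `x`. -/
def euclBall {m : ℕ} (x : Vm m) (r : ℝ) : Set (Vm m) := {y | prodEnorm (y - x) < r}

lemma continuous_prodEnorm {m : ℕ} : Continuous (prodEnorm : Vm m → ℝ) := by
  unfold prodEnorm
  fun_prop

lemma isOpen_euclBall {m : ℕ} (x : Vm m) (r : ℝ) : IsOpen (euclBall x r) :=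
  isOpen_lt (continuous_prodEnorm.comp (continuous_id.sub continuous_const)) continuous_const

lemma abs_snd_le_prodEnorm {m : ℕ} (p : Vm m) : |p.2| ≤ prodEnorm p :=
  Real.abs_le_sqrt (le_add_of_nonneg_left (sq_nonneg _))

lemma norm_le_prodEnorm {m : ℕ} (p : Vm m) : ‖p‖ ≤ prodEnorm p :=
  max_le (Real.le_sqrt_of_sq_le (le_add_of_nonneg_right (sq_nonneg _))) (abs_snd_le_prodEnorm p)

lemma volume_euclBall_ne_top {m : ℕ} (x : Vm m) (r : ℝ) : volume (euclBall x r) ≠ ∞ := by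
  refine ne_top_of_le_ne_top (measure_ball_lt_top (μ := volume) (x := x) (r := r)).ne
    (measure_mono fun y hy => ?_)
  rw [Metric.mem_ball, dist_eq_norm]
  exact (norm_le_prodEnorm _).trans_lt hy

lemma volume_euclBall_ne_zero {m : ℕ} (x : Vm m) {r : ℝ} (hr : 0 < r) :
    volume (euclBall x r) ≠ 0 :=
  ((isOpen_euclBall x r).measure_pos volume ⟨x, by simpa [euclBall, prodEnorm] using hr⟩).ne'

lemma volume_section_euclBall_eq {m : ℕ} (x' x : Rm m) (a c r : ℝ) :
    volume (Prod.mk x ⁻¹' euclBall (x', c) r) = volume (Prod.mk x ⁻¹' euclBall (x', a) r) := by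
  rw [← measure_preimage_add_right volume (a - c) (Prod.mk x ⁻¹' euclBall (x', a) r)]
  congr 1
  ext t
  have h : t + (a - c) - a = t - c := by ring
  simp only [euclBall, mem_ofPred_eq, mem_preimage, Prod.mk_sub_mk, h]

lemma volume_euclBall_eq {m : ℕ} (x' : Rm m) (a c r : ℝ) :
    volume (euclBall (x', c) r) = volume (euclBall (x', a) r) := by
  rw [Measure.volume_eq_prod, Measure.prod_apply (isOpen_euclBall _ _).measurableSet,
    Measure.prod_apply (isOpen_euclBall _ _).measurableSet]
  exact lintegral_congr fun x => volume_section_euclBall_eq x' x a c r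

lemma abs_sub_lt_of_mem_euclBall {m : ℕ} {x' x : Rm m} {a t r : ℝ}
    (h : (x, t) ∈ euclBall (x', a) r) : |t - a| < r :=
  (abs_snd_le_prodEnorm ((x, t) - (x', a))).trans_lt h

/-- If almost every vertical section of `E` is equivalent to an interval, the part of a ball missed
by `E` is controlled by the parts missed in a ball below it and a ball above it. -/
lemma volume_euclBall_diff_le {m : ℕ} {E : Set (Vm m)} (hE : MeasurableSet E)
    (hsec : ∀ᵐ x' : Rm m ∂volume, ∃ I : Set ℝ, I.OrdConnected ∧
      volume (symmDiff {t : ℝ | (x', t) ∈ E} I) = 0)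
    (x' : Rm m) {a b c r : ℝ} (hac : a + 2 * r ≤ c) (hcb : c + 2 * r ≤ b) :
    volume (euclBall (x', c) r \ E) ≤
      volume (euclBall (x', a) r \ E) + volume (euclBall (x', b) r \ E) := by
  have hmeas : ∀ p : ℝ, MeasurableSet (euclBall (x', p) r \ E) :=
    fun p => (isOpen_euclBall _ _).measurableSet.diff hE
  rw [Measure.volume_eq_prod, Measure.prod_apply (hmeas a), Measure.prod_apply (hmeas b),
    Measure.prod_apply (hmeas c), ← lintegral_add_left (measurable_measure_prodMk_left (hmeas a))]
  refine lintegral_mono_ae ?_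
  filter_upwards [hsec] with x ⟨I, hI, hSI⟩
  refine measure_diff_le_of_ordConnected hI hSI (volume_section_euclBall_eq x' x a c r)
    (volume_section_euclBall_eq x' x b c r) (fun s hs t ht => ?_) (fun t ht s hs => ?_)
  all_goals
    have h₁ := abs_lt.1 (abs_sub_lt_of_mem_euclBall hs)
    have h₂ := abs_lt.1 (abs_sub_lt_of_mem_euclBall ht)
    linarith [h₁.1, h₁.2, h₂.1, h₂.2]

/-- A point has density one iff the complement has density zero there. -/
lemma mem_densityOne_iff {m : ℕ} {E : Set (Vm m)} (hE : MeasurableSet E) (x : Vm m) :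
    x ∈ densityOne E ↔ Filter.Tendsto
      (fun r : ℝ => volume (euclBall x r \ E) / volume (euclBall x r))
      (nhdsWithin 0 (Set.Ioi 0)) (nhds 0) := by
  change Filter.Tendsto
    (fun r : ℝ => volume (E ∩ euclBall x r) / volume (euclBall x r)) _ _ ↔ _
  have hsum : ∀ r ∈ Ioi (0 : ℝ), volume (E ∩ euclBall x r) / volume (euclBall x r) +
      volume (euclBall x r \ E) / volume (euclBall x r) = 1 := fun r hr => by
    rw [← ENNReal.add_div, inter_comm, measure_inter_add_sdiff _ hE,
      ENNReal.div_self (volume_euclBall_ne_zero x hr) (volume_euclBall_ne_top x r)]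
  have hsub : ∀ u v : ℝ≥0∞, u + v = 1 → 1 - u = v := fun u v h =>
    (ENNReal.eq_sub_of_add_eq' one_ne_top (by rwa [add_comm])).symm
  constructor <;> intro h
  · have h' := ENNReal.Tendsto.sub (tendsto_const_nhds (x := (1 : ℝ≥0∞))) h (Or.inl one_ne_top)
    rw [tsub_self] at h'
    refine h'.congr' ?_
    filter_upwards [self_mem_nhdsWithin] with r hr
    exact hsub _ _ (hsum r hr)
  · have h' := ENNReal.Tendsto.sub (tendsto_const_nhds (x := (1 : ℝ≥0∞))) h (Or.inl one_ne_top)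
    rw [tsub_zero] at h'
    refine h'.congr' ?_
    filter_upwards [self_mem_nhdsWithin] with r hr
    exact hsub _ _ ((add_comm _ _).trans (hsum r hr))

/-- **Lemma 4.2.** If almost every section of a Borel set `E` is equivalent to an
interval, then every section of the set `E^{(1)}` of points of density one of `E` is an
interval. -/
theorem density_one_sections_are_intervals
    (m : ℕ) (E : Set (Vm m)) (hE : MeasurableSet E)
    (hsec : ∀ᵐ x' : Rm m ∂volume, ∃ I : Set ℝ, I.OrdConnected ∧
      volume (symmDiff {t : ℝ | (x', t) ∈ E} I) = 0) :
    ∀ x' : Rm m, Set.OrdConnected {t : ℝ | (x', t) ∈ densityOne E} := by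
  refine fun x' => ⟨fun a ha b hb c hc => ?_⟩
  rcases hc.1.eq_or_lt with rfl | hac
  · exact ha
  rcases hc.2.eq_or_lt with rfl | hcb
  · exact hb
  have hlim := ((mem_densityOne_iff hE _).1 ha).add ((mem_densityOne_iff hE _).1 hb)
  rw [add_zero] at hlim
  refine (mem_densityOne_iff hE _).2
    (tendsto_of_tendsto_of_tendsto_of_le_of_le' tendsto_const_nhds hlim
      (Filter.Eventually.of_forall fun _ => zero_le) ?_)
  have hpos : 0 < min ((c - a) / 2) ((b - c) / 2) :=
    lt_min (half_pos (sub_pos.2 hac)) (half_pos (sub_pos.2 hcb))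
  filter_upwards [nhdsWithin_le_nhds (Iio_mem_nhds hpos)] with r hr
  have h₁ := (lt_min_iff.1 (mem_Iio.1 hr)).1
  have h₂ := (lt_min_iff.1 (mem_Iio.1 hr)).2
  rw [volume_euclBall_eq x' c a, volume_euclBall_eq x' c b, ← ENNReal.add_div]
  exact ENNReal.div_le_div_right
    (volume_euclBall_diff_le hE hsec x' (by linarith) (by linarith)) _
end
end
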